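/- Let Γ be a finitely generated nilpotent group and let n ≥ 1. Set X = Hom(Γ, GL_n(ℝ)) with the topology of pointwise convergence, and let A ⊆ X be the subspace of those homomorphisms ρ such that ρ(γ) is an orthogonal matrix for every γ ∈ Γ. Then there is a strong deformation retraction H : X × [0,1] → X of X onto A which is O(n)-equivariant for the conjugation action, i.e. H(u·ρ(·)·u⁻¹, t) = u·H(ρ, t)(·)·u⁻¹ for every orthogonal u ∈ O(n), every ρ ∈ X and every t ∈ [0,1]. -/

import Mathlib

open Matrix

/-- The representation space `Hom(Γ, GL_n ℝ)`, realized as the subspace of the product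
space `Γ → Matrix (Fin n) (Fin n) ℝ` (with the topology of pointwise convergence)
consisting of the maps that are group homomorphisms into the invertible real matrices. -/
abbrev RepGLR (Γ : Type) [Group Γ] (n : ℕ) : Type :=
  {f : Γ → Matrix (Fin n) (Fin n) ℝ //
    f 1 = 1 ∧ (∀ γ₁ γ₂, f (γ₁ * γ₂) = f γ₁ * f γ₂) ∧ (∀ γ, IsUnit (f γ))}

section GroupTheory

open scoped commutatorElement

theorem finite_of_nilpotent_torsion (G : Type*) [Group G] [hfg : Group.FG G]
    [hn : Group.IsNilpotent G] (ht : IsMulTorsion G) : Finite G := by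
  have key : Group.FG G → IsMulTorsion G → Finite G := by
    refine Group.nilpotent_center_quotient_ind
      (P := fun G _ _ => Group.FG G → IsMulTorsion G → Finite G) G ?_ ?_
    · intro G _ _ _ _
      infer_instance
    · intro G _ _ ih hfg ht
      have hq : Finite (G ⧸ Subgroup.center G) := by
        refine ih inferInstance ?_
        intro q
        obtain ⟨g, rfl⟩ := QuotientGroup.mk_surjective q
        exact MonoidHom.isOfFinOrder (QuotientGroup.mk' _) (ht g)
      have hfi : (Subgroup.center G).FiniteIndex := Subgroup.finiteIndex_of_finite_quotient
      have hcfg : Group.FG (Subgroup.center G) := Subgroup.fg_of_index_ne_zero _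
      let : CommGroup (Subgroup.center G) :=
        { (inferInstance : Group (Subgroup.center G)) with
          mul_comm := fun a b => Subtype.ext (Subgroup.mem_center_iff.1 b.2 a) }
      have hcf : Finite (Subgroup.center G) :=
        CommGroup.finite_of_fg_isMulTorsion _ (ht.subgroup _)
      exact Finite.of_equiv _
        (Subgroup.groupEquivQuotientProdSubgroup (s := Subgroup.center G)).symm
  exact key hfg ht

theorem commutatorElement_pow_left {G : Type*} [Group G] {a b : G}
    (h : Commute ⁅a, b⁆ a) (d : ℕ) : ⁅a ^ d, b⁆ = ⁅a, b⁆ ^ d := by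
  have h1 : b * a * b⁻¹ = ⁅a, b⁆⁻¹ * a := by
    simp [commutatorElement_def, mul_assoc]
  have h2 : b * a ^ d * b⁻¹ = (⁅a, b⁆ ^ d)⁻¹ * a ^ d := by
    rw [← conj_pow, h1, (h.inv_left).mul_pow, inv_pow]
  calc ⁅a ^ d, b⁆ = a ^ d * (b * a ^ d * b⁻¹)⁻¹ := by
        simp [commutatorElement_def, mul_assoc]
    _ = ⁅a, b⁆ ^ d := by rw [h2]; simp

/-- If `d`-th powers of elements of the second centre are central, then `d`-th powers move each
term of the upper central series (from the second on) into the previous one. -/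
theorem pow_mem_upperCentralSeries {G : Type*} [Group G] {d : ℕ}
    (h : ∀ g ∈ Subgroup.upperCentralSeries G 2, g ^ d ∈ Subgroup.center G) (i : ℕ) :
    ∀ g ∈ Subgroup.upperCentralSeries G (i + 2), g ^ d ∈ Subgroup.upperCentralSeries G (i + 1) := by
  induction i with
  | zero => simpa using h
  | succ i ih =>
    intro g hg
    rw [Subgroup.mem_upperCentralSeries_succ_iff] at hg ⊢
    intro y
    have h1 := ih _ (hg y)
    have h2 : Commute (⁅(QuotientGroup.mk' (Subgroup.upperCentralSeries G (i + 1))) g,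
        (QuotientGroup.mk' (Subgroup.upperCentralSeries G (i + 1))) y⁆)
        ((QuotientGroup.mk' (Subgroup.upperCentralSeries G (i + 1))) g) := by
      rw [← map_commutatorElement, ← commutatorElement_eq_one_iff_commute, ← map_commutatorElement]
      exact (QuotientGroup.eq_one_iff _).2
        ((Subgroup.mem_upperCentralSeries_succ_iff).1 (hg y) g)
    have h3 := commutatorElement_pow_left h2 d
    rw [← map_pow, ← map_commutatorElement, ← map_commutatorElement, ← map_pow] at h3
    have h4 : (QuotientGroup.mk' (Subgroup.upperCentralSeries G (i + 1))) (⁅g, y⁆ ^ d) = 1 :=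
      (QuotientGroup.eq_one_iff _).2 h1
    rw [h4] at h3
    exact (QuotientGroup.eq_one_iff _).1 h3

theorem pow_pow_mem_center {G : Type*} [Group G] [Group.IsNilpotent G] {d c : ℕ}
    (h : ∀ g ∈ Subgroup.upperCentralSeries G 2, g ^ d ∈ Subgroup.center G)
    (hc : Group.nilpotencyClass G ≤ c) (g : G) :
    g ^ d ^ c ∈ Subgroup.center G := by
  have key : ∀ i, ∀ g ∈ Subgroup.upperCentralSeries G (i + 1), g ^ d ^ i ∈ Subgroup.center G := by
    intro i
    induction i with
    | zero => simp
    | succ i ih =>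
      intro g hg
      rw [pow_succ', pow_mul]
      exact ih _ (pow_mem_upperCentralSeries h i g hg)
  refine key c g (Subgroup.upperCentralSeries_mono G (hc.trans (Nat.le_succ c)) ?_)
  rw [Subgroup.upperCentralSeries_nilpotencyClass]
  trivial

end GroupTheory

section Irreducible

open Matrix
open scoped commutatorElement

/-- A matrix representation over `ℂ` without proper nonzero invariant subspaces. -/
def IsIrrRep {M ι : Type*} [Monoid M] [Fintype ι] [DecidableEq ι]
    (x : M →* Matrix ι ι ℂ) : Prop :=
  ∀ V : Submodule ℂ (ι → ℂ), (∀ m, ∀ v ∈ V, x m *ᵥ v ∈ V) → V = ⊥ ∨ V = ⊤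

theorem IsIrrRep.exists_eq_smul_one {M ι : Type*} [Monoid M] [Fintype ι] [DecidableEq ι]
    {x : M →* Matrix ι ι ℂ} (hx : IsIrrRep x) {A : Matrix ι ι ℂ}
    (hA : ∀ m, A * x m = x m * A) : ∃ c : ℂ, A = c • (1 : Matrix ι ι ℂ) := by
  rcases isEmpty_or_nonempty ι with h | h
  · exact ⟨0, Subsingleton.elim _ _⟩
  obtain ⟨c, hc⟩ := Module.End.exists_eigenvalue (Matrix.toLin' A)
  refine ⟨c, ?_⟩
  have hinv := hx (Module.End.eigenspace (Matrix.toLin' A) c) (by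
    intro m v hv
    rw [Module.End.mem_eigenspace_iff, Matrix.toLin'_apply] at hv ⊢
    rw [Matrix.mulVec_mulVec, hA, ← Matrix.mulVec_mulVec, hv, Matrix.mulVec_smul])
  rcases hinv with h0 | h1
  · exact absurd h0 hc
  · apply Matrix.toLin'.injective
    ext1 i
    ext1
    have : (Pi.single i 1 : ι → ℂ) ∈ Module.End.eigenspace (Matrix.toLin' A) c := by
      rw [h1]; trivial
    rw [Module.End.mem_eigenspace_iff] at this
    simp [this] 

theorem IsIrrRep.pow_eq_smul_one {Γ : Type*} [Group Γ] [Group.IsNilpotent Γ] {d n : ℕ}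
    (hd : d ≤ n) {x : Γ →* Matrix (Fin d) (Fin d) ℂ} (hx : IsIrrRep x) (γ : Γ) :
    ∃ c : ℂ, x (γ ^ (n.factorial ^ Group.nilpotencyClass Γ)) = c • 1 := by
  rcases Nat.eq_zero_or_pos d with rfl | hd0
  · exact ⟨0, Subsingleton.elim _ _⟩
  let f := x.toHomUnits.rangeRestrict
  have hf : Function.Surjective f := x.toHomUnits.rangeRestrict_surjective
  have hval : ∀ γ, (((f γ : x.toHomUnits.range) : (Matrix (Fin d) (Fin d) ℂ)ˣ) :
      Matrix (Fin d) (Fin d) ℂ) = x γ := fun γ => rfl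
  have : Group.IsNilpotent x.toHomUnits.range := Group.nilpotent_of_surjective f hf
  have hsc : ∀ g ∈ Subgroup.center x.toHomUnits.range,
      ∃ c : ℂ, ((g : (Matrix (Fin d) (Fin d) ℂ)ˣ) : Matrix (Fin d) (Fin d) ℂ) = c • 1 := by
    intro g hg
    apply hx.exists_eq_smul_one
    intro m
    have := Subgroup.mem_center_iff.1 hg (f m)
    rw [← hval]
    exact_mod_cast (congrArg (fun z : x.toHomUnits.range =>
      ((z : (Matrix (Fin d) (Fin d) ℂ)ˣ) : Matrix (Fin d) (Fin d) ℂ)) this).symm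
  have h2 : ∀ g ∈ Subgroup.upperCentralSeries x.toHomUnits.range 2,
      g ^ n.factorial ∈ Subgroup.center x.toHomUnits.range := by
    intro g hg
    rw [Subgroup.mem_upperCentralSeries_succ_iff, Subgroup.upperCentralSeries_one] at hg
    rw [Subgroup.mem_center_iff]
    intro y
    have hcomm : Commute ⁅g, y⁆ g := ((Subgroup.mem_center_iff.1 (hg y)) g).symm
    have hpow := commutatorElement_pow_left hcomm n.factorial
    obtain ⟨z, hz⟩ := hsc _ (hg y)
    have hdet : (((⁅g, y⁆ : x.toHomUnits.range) : (Matrix (Fin d) (Fin d) ℂ)ˣ) :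
        Matrix (Fin d) (Fin d) ℂ).det = 1 := by
      have : Matrix.detMonoidHom.comp ((Units.coeHom _).comp x.toHomUnits.range.subtype) ⁅g, y⁆
          = (1 : ℂ) := by
        have h3 : Units.map (Matrix.detMonoidHom (R := ℂ) (n := Fin d))
            (x.toHomUnits.range.subtype ⁅g, y⁆) = 1 := by
          rw [map_commutatorElement, map_commutatorElement, commutatorElement_def]
          simp
        exact congrArg Units.val h3
      exact this
    rw [hz, Matrix.det_smul, Matrix.det_one, mul_one, Fintype.card_fin] at hdet
    have hzn : z ^ n.factorial = 1 := by
      obtain ⟨k, hk⟩ := Nat.dvd_factorial hd0 hd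
      rw [hk, pow_mul, hdet, one_pow]
    have hone : ⁅g, y⁆ ^ n.factorial = 1 := by
      apply Subtype.ext
      apply Units.ext
      push_cast
      rw [hz, smul_pow, hzn]
      simp
    rw [hone, commutatorElement_eq_one_iff_mul_comm] at hpow
    exact hpow.symm
  have h4 := pow_pow_mem_center h2 (Group.nilpotencyClass_le_of_surjective f hf) (f γ)
  obtain ⟨c, hc⟩ := hsc _ h4
  refine ⟨c, ?_⟩
  rw [← hc, ← map_pow, hval]

/-- A finitely generated nilpotent group has a finite index normal subgroup which acts by scalars
in every irreducible representation of dimension at most `n`. -/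
theorem exists_finiteIndex_scalar (Γ : Type*) [Group Γ] [Group.FG Γ] [Group.IsNilpotent Γ]
    (n : ℕ) : ∃ Γ₀ : Subgroup Γ, Γ₀.Normal ∧ Finite (Γ ⧸ Γ₀) ∧
      (∃ N : ℕ, 0 < N ∧ ∀ γ : Γ, γ ^ N ∈ Γ₀) ∧
      ∀ d ≤ n, ∀ x : Γ →* Matrix (Fin d) (Fin d) ℂ, IsIrrRep x →
        ∀ γ ∈ Γ₀, ∃ c : ℂ, x γ = c • 1 := by
  set N := n.factorial ^ Group.nilpotencyClass Γ with hN
  have hNpos : 0 < N := pow_pos (Nat.factorial_pos n) _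
  have hmem : ∀ γ : Γ, γ ^ N ∈ Subgroup.normalClosure (Set.range fun γ : Γ => γ ^ N) :=
    fun γ => Subgroup.subset_normalClosure ⟨γ, rfl⟩
  refine ⟨Subgroup.normalClosure (Set.range fun γ : Γ => γ ^ N), inferInstance, ?_,
    ⟨N, hNpos, hmem⟩, ?_⟩
  · apply finite_of_nilpotent_torsion
    intro q
    obtain ⟨g, rfl⟩ := QuotientGroup.mk_surjective q
    rw [isOfFinOrder_iff_pow_eq_one]
    refine ⟨N, hNpos, ?_⟩
    rw [← QuotientGroup.mk_pow]
    exact (QuotientGroup.eq_one_iff _).2 (hmem g)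
  · intro d hd x hx
    let K : Subgroup Γ :=
      { carrier := {γ | ∃ c : ℂ, x γ = c • 1}
        one_mem' := ⟨1, by simp⟩
        mul_mem' := by
          rintro a b ⟨c, hc⟩ ⟨e, he⟩
          exact ⟨c * e, by rw [map_mul, hc, he]; simp [smul_smul, mul_comm]⟩
        inv_mem' := by
          rintro a ⟨c, hc⟩
          refine hx.exists_eq_smul_one fun m => ?_
          have h1 : a⁻¹ * m = a⁻¹ * (m * a) * a⁻¹ := by group
          have h2 : x (m * a) = x (a * m) := by rw [map_mul, map_mul, hc]; simp
          rw [← map_mul, h1, map_mul, map_mul, h2, ← map_mul, ← map_mul, ← map_mul]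
          congr 1
          group }
    have hK : K.Normal := ⟨by
      rintro a ⟨c, hc⟩ g
      refine ⟨c, ?_⟩
      rw [map_mul, map_mul, hc, Matrix.mul_smul, Matrix.smul_mul, mul_one, ← map_mul]
      simp⟩
    have hle : Subgroup.normalClosure (Set.range fun γ : Γ => γ ^ N) ≤ K := by
      apply Subgroup.normalClosure_le_normal
      rintro _ ⟨γ, rfl⟩
      exact hx.pow_eq_smul_one hd γ
    exact fun γ hγ => hle hγ

end Irreducible

section Block

open Matrix

/-- A reducible representation is unitarily equivalent to a block upper triangular one. -/
theorem exists_block_of_not_isIrrRep {M : Type*} [Monoid M] {d : ℕ}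
    (x : M →* Matrix (Fin d) (Fin d) ℂ) (hx : ¬ IsIrrRep x) :
    ∃ k l : ℕ, k < d ∧ l < d ∧ ∃ W : Matrix (Fin d) (Fin k ⊕ Fin l) ℂ,
      Wᴴ * W = 1 ∧ W * Wᴴ = 1 ∧ ∃ (a : M →* Matrix (Fin k) (Fin k) ℂ)
        (e : M →* Matrix (Fin l) (Fin l) ℂ) (b : M → Matrix (Fin k) (Fin l) ℂ),
        ∀ m, x m = W * fromBlocks (a m) (b m) 0 (e m) * Wᴴ := by
  unfold IsIrrRep at hx
  push Not at hx
  obtain ⟨V₀, hV, hbot, htop⟩ := hx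
  let φ := WithLp.linearEquiv 2 ℂ (Fin d → ℂ)
  let V : Submodule ℂ (EuclideanSpace ℂ (Fin d)) := V₀.comap φ.toLinearMap
  have hVbot : V ≠ ⊥ := by
    intro h
    apply hbot
    rw [eq_bot_iff]
    intro v hv
    have : φ.symm v ∈ V := by simpa [V] using hv
    rw [h, Submodule.mem_bot] at this
    simpa using this
  have hVtop : V ≠ ⊤ := by
    intro h
    apply htop
    rw [eq_top_iff]
    intro v _
    have : φ.symm v ∈ V := by rw [h]; trivial
    simpa [V] using this
  have hsum : Module.finrank ℂ V + Module.finrank ℂ Vᗮ = d := by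
    rw [Submodule.finrank_add_finrank_orthogonal]; simp
  have hk0 : 0 < Module.finrank ℂ V := Submodule.one_le_finrank_iff.2 hVbot
  have hkd : Module.finrank ℂ V < d := by
    have := Submodule.finrank_lt (s := V) hVtop
    simpa using this
  set k := Module.finrank ℂ V with hk
  set l := Module.finrank ℂ Vᗮ with hl
  let b1 := stdOrthonormalBasis ℂ V
  let b2 := stdOrthonormalBasis ℂ Vᗮ
  let W : Matrix (Fin d) (Fin k ⊕ Fin l) ℂ :=
    Matrix.of fun i s => Sum.elim (fun j => (b1 j : EuclideanSpace ℂ (Fin d)) i)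
      (fun j => (b2 j : EuclideanSpace ℂ (Fin d)) i) s
  have hW : Wᴴ * W = 1 := by
    ext s t
    have key : ∀ u v : EuclideanSpace ℂ (Fin d), ∑ i, star (u i) * v i = inner ℂ u v := by
      intro u v
      simp [PiLp.inner_apply, mul_comm]
    rcases s with s | s <;> rcases t with t | t
    · simp only [W, mul_apply, conjTranspose_apply, of_apply, Sum.elim_inl, key]
      rw [← Submodule.coe_inner, OrthonormalBasis.inner_eq_ite]
      simp [one_apply]
    · simp only [W, mul_apply, conjTranspose_apply, of_apply, Sum.elim_inl, Sum.elim_inr, key]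
      rw [Submodule.inner_right_of_mem_orthogonal (b1 s).2 (b2 t).2]
      simp
    · simp only [W, mul_apply, conjTranspose_apply, of_apply, Sum.elim_inl, Sum.elim_inr, key]
      rw [Submodule.inner_left_of_mem_orthogonal (b1 t).2 (b2 s).2]
      simp
    · simp only [W, mul_apply, conjTranspose_apply, of_apply, Sum.elim_inr, key]
      rw [← Submodule.coe_inner, OrthonormalBasis.inner_eq_ite]
      simp [one_apply]
  have hW' : W * Wᴴ = 1 :=
    (Matrix.mul_eq_one_comm_of_card_eq _ _ _ (by simp [hsum])).1 hW
  let T : M →* Matrix (Fin k ⊕ Fin l) (Fin k ⊕ Fin l) ℂ :=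
    { toFun := fun m => Wᴴ * x m * W
      map_one' := by simp [hW]
      map_mul' := fun m m' => by
        rw [map_mul]
        calc Wᴴ * (x m * x m') * W = Wᴴ * x m * (W * Wᴴ) * x m' * W := by
              rw [hW']; simp [Matrix.mul_assoc]
          _ = _ := by simp only [Matrix.mul_assoc] }
  have hT : ∀ m, T m = Wᴴ * x m * W := fun _ => rfl
  have hT21 : ∀ m, (T m).toBlocks₂₁ = 0 := by
    intro m
    ext i j
    have hmem : φ.symm (x m *ᵥ φ (b1 j : EuclideanSpace ℂ (Fin d))) ∈ V := by
      have : φ (b1 j : EuclideanSpace ℂ (Fin d)) ∈ V₀ := (b1 j).2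
      simpa [V] using hV m _ this
    have := Submodule.inner_left_of_mem_orthogonal hmem (b2 i).2
    rw [PiLp.inner_apply] at this
    simp only [toBlocks₂₁, of_apply, hT, Matrix.mul_assoc, Matrix.zero_apply]
    rw [mul_apply, ← this]
    refine Finset.sum_congr rfl fun r _ => ?_
    simp [mulVec, dotProduct, φ, W, mul_apply, mul_comm]
  have hTb : ∀ m, T m = fromBlocks (T m).toBlocks₁₁ (T m).toBlocks₁₂ 0 (T m).toBlocks₂₂ := by
    intro m
    conv_lhs => rw [← fromBlocks_toBlocks (T m), hT21]
  let a : M →* Matrix (Fin k) (Fin k) ℂ :=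
    { toFun := fun m => (T m).toBlocks₁₁
      map_one' := by rw [map_one, ← fromBlocks_one, toBlocks_fromBlocks₁₁]
      map_mul' := fun m m' => by
        rw [map_mul, hTb m, hTb m', fromBlocks_multiply]; simp }
  let e : M →* Matrix (Fin l) (Fin l) ℂ :=
    { toFun := fun m => (T m).toBlocks₂₂
      map_one' := by rw [map_one, ← fromBlocks_one, toBlocks_fromBlocks₂₂]
      map_mul' := fun m m' => by
        rw [map_mul, hTb m, hTb m', fromBlocks_multiply]; simp }
  refine ⟨k, l, hkd, by omega, W, hW, hW', a, e, fun m => (T m).toBlocks₁₂, fun m => ?_⟩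
  have := hTb m
  change x m = W * fromBlocks (T m).toBlocks₁₁ (T m).toBlocks₁₂ 0 (T m).toBlocks₂₂ * Wᴴ
  rw [← this, hT]
  calc x m = (W * Wᴴ) * x m * (W * Wᴴ) := by rw [hW']; simp
    _ = _ := by simp [Matrix.mul_assoc]

end Block

section Schur

open Matrix
open scoped Matrix.Norms.Frobenius

theorem frobenius_norm_sq {𝕜 m n : Type*} [RCLike 𝕜] [Fintype m] [Fintype n]
    (A : Matrix m n 𝕜) : ‖A‖ ^ 2 = ∑ i, ∑ j, ‖A i j‖ ^ 2 := by
  rw [frobenius_norm_def, ← Real.sqrt_eq_rpow, Real.sq_sqrt (by positivity)]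
  simp

theorem frobenius_norm_sq_eq_trace {𝕜 m n : Type*} [RCLike 𝕜] [Fintype m] [Fintype n]
    (A : Matrix m n 𝕜) : ‖A‖ ^ 2 = RCLike.re (Aᴴ * A).trace := by
  rw [frobenius_norm_sq, Finset.sum_comm]
  simp only [trace, diag_apply, mul_apply, conjTranspose_apply, map_sum]
  refine Finset.sum_congr rfl fun i _ => Finset.sum_congr rfl fun j _ => ?_
  rw [RCLike.star_def, RCLike.conj_mul]
  norm_cast

theorem frobenius_norm_isometry_mul {𝕜 l m n : Type*} [RCLike 𝕜] [Fintype l] [Fintype m]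
    [Fintype n] [DecidableEq m] {W : Matrix l m 𝕜} (hW : Wᴴ * W = 1) (A : Matrix m n 𝕜) :
    ‖W * A‖ = ‖A‖ := by
  rw [← sq_eq_sq₀ (norm_nonneg _) (norm_nonneg _), frobenius_norm_sq_eq_trace,
    frobenius_norm_sq_eq_trace, conjTranspose_mul, Matrix.mul_assoc, ← Matrix.mul_assoc Wᴴ, hW,
    Matrix.one_mul]

theorem frobenius_norm_mul_isometry {𝕜 l m n : Type*} [RCLike 𝕜] [Fintype l] [Fintype m]
    [Fintype n] [DecidableEq m] {W : Matrix m n 𝕜} (hW : W * Wᴴ = 1) (A : Matrix l m 𝕜) :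
    ‖A * W‖ = ‖A‖ := by
  rw [← frobenius_norm_conjTranspose, conjTranspose_mul,
    frobenius_norm_isometry_mul (by simpa using hW), frobenius_norm_conjTranspose]

theorem frobenius_norm_sq_fromBlocks {𝕜 k l m n : Type*} [RCLike 𝕜] [Fintype k] [Fintype l]
    [Fintype m] [Fintype n] (a : Matrix k m 𝕜) (b : Matrix k n 𝕜) (c : Matrix l m 𝕜)
    (e : Matrix l n 𝕜) :
    ‖fromBlocks a b c e‖ ^ 2 = ‖a‖ ^ 2 + ‖b‖ ^ 2 + ‖c‖ ^ 2 + ‖e‖ ^ 2 := by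
  simp only [frobenius_norm_sq, Fintype.sum_sum_type, fromBlocks_apply₁₁, fromBlocks_apply₁₂,
    fromBlocks_apply₂₁, fromBlocks_apply₂₂, Finset.sum_add_distrib]
  ring

theorem frobenius_norm_sq_smul_one {𝕜 n : Type*} [RCLike 𝕜] [Fintype n] [DecidableEq n] (c : 𝕜) :
    ‖c • (1 : Matrix n n 𝕜)‖ ^ 2 = Fintype.card n * ‖c‖ ^ 2 := by
  simp [frobenius_norm_sq, one_apply, apply_ite, ite_pow]

/-- The sum of the squared absolute values of the eigenvalues, with algebraic multiplicity. -/
noncomputable def eigSq {n : Type*} [Fintype n] [DecidableEq n] (A : Matrix n n ℂ) : ℝ :=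
  (A.charpoly.roots.map fun z => ‖z‖ ^ 2).sum

theorem eigSq_nonneg {n : Type*} [Fintype n] [DecidableEq n] (A : Matrix n n ℂ) :
    0 ≤ eigSq A := by
  refine Multiset.sum_nonneg fun r hr => ?_
  obtain ⟨z, -, rfl⟩ := Multiset.mem_map.1 hr
  positivity

theorem eigSq_mul_comm {m n : Type*} [Fintype m] [DecidableEq m] [Fintype n] [DecidableEq n]
    (h : Fintype.card m = Fintype.card n) (A : Matrix m n ℂ) (B : Matrix n m ℂ) :
    eigSq (A * B) = eigSq (B * A) := by
  rw [eigSq, eigSq, charpoly_mul_comm_of_le A B h.ge]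
  simp [h]

theorem card_eq_of_mul_eq_one {m n : Type*} [Fintype m] [DecidableEq m] [Fintype n]
    [DecidableEq n] {A : Matrix m n ℂ} {B : Matrix n m ℂ} (h : A * B = 1) (h' : B * A = 1) :
    Fintype.card m = Fintype.card n := by
  have h1 := congrArg trace h
  rw [trace_mul_comm, h'] at h1
  simpa using h1.symm

theorem eigSq_conj {m n : Type*} [Fintype m] [DecidableEq m] [Fintype n] [DecidableEq n]
    {g : Matrix m n ℂ} {g' : Matrix n m ℂ} (h : g * g' = 1) (h' : g' * g = 1)
    (A : Matrix n n ℂ) : eigSq (g * A * g') = eigSq A := by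
  rw [Matrix.mul_assoc, eigSq_mul_comm (card_eq_of_mul_eq_one h h'), Matrix.mul_assoc, h',
    Matrix.mul_one]

theorem eigSq_fromBlocks {m n : Type*} [Fintype m] [DecidableEq m] [Fintype n] [DecidableEq n]
    (a : Matrix m m ℂ) (b : Matrix m n ℂ) (e : Matrix n n ℂ) :
    eigSq (fromBlocks a b 0 e) = eigSq a + eigSq e := by
  rw [eigSq, charpoly_fromBlocks_zero₂₁, Polynomial.roots_mul
    (mul_ne_zero (charpoly_monic a).ne_zero (charpoly_monic e).ne_zero)]
  simp [eigSq]

theorem eigSq_smul_one {n : Type*} [Fintype n] [DecidableEq n] (c : ℂ) :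
    eigSq (c • (1 : Matrix n n ℂ)) = Fintype.card n * ‖c‖ ^ 2 := by
  have : c • (1 : Matrix n n ℂ) = diagonal fun _ => c := by
    ext i j; simp [one_apply, diagonal_apply]
  rw [eigSq, this, charpoly_diagonal, Finset.prod_const, Polynomial.roots_pow,
    Polynomial.roots_X_sub_C, Multiset.map_nsmul, Multiset.sum_nsmul]
  simp

/-- Schur's inequality, with the case of equality. -/
theorem eigSq_le_and_normal {d : ℕ} (A : Matrix (Fin d) (Fin d) ℂ) :
    eigSq A ≤ ‖A‖ ^ 2 ∧ (‖A‖ ^ 2 = eigSq A → Aᴴ * A = A * Aᴴ) := by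
  induction d using Nat.strong_induction_on with
  | _ d ih =>
  set x := powersHom (Matrix (Fin d) (Fin d) ℂ) A with hx
  have hxA : x (Multiplicative.ofAdd 1) = A := by simp [hx]
  by_cases h : IsIrrRep x
  · obtain ⟨c, rfl⟩ := h.exists_eq_smul_one (A := A) (by
      intro m
      simpa [hx] using ((Commute.refl A).pow_right _).eq)
    rw [frobenius_norm_sq_smul_one, eigSq_smul_one]
    refine ⟨le_rfl, fun _ => ?_⟩
    simp [smul_smul, mul_comm]
  · obtain ⟨k, l, hk, hl, W, hW, hW', a, e, b, hb⟩ := exists_block_of_not_isIrrRep x h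
    have hA := hb (Multiplicative.ofAdd 1)
    rw [hxA] at hA
    set a₁ := a (Multiplicative.ofAdd 1)
    set b₁ := b (Multiplicative.ofAdd 1)
    set e₁ := e (Multiplicative.ofAdd 1)
    have h1 : ‖A‖ ^ 2 = ‖a₁‖ ^ 2 + ‖b₁‖ ^ 2 + ‖e₁‖ ^ 2 := by
      rw [hA, frobenius_norm_mul_isometry (by simpa using hW), frobenius_norm_isometry_mul hW,
        frobenius_norm_sq_fromBlocks]
      simp
    have h2 : eigSq A = eigSq a₁ + eigSq e₁ := by
      rw [hA, eigSq_conj hW' hW, eigSq_fromBlocks]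
    obtain ⟨ha, ha'⟩ := ih k hk a₁
    obtain ⟨he, he'⟩ := ih l hl e₁
    rw [h1, h2]
    refine ⟨by nlinarith [sq_nonneg ‖b₁‖], fun heq => ?_⟩
    have hb0 : b₁ = 0 := by
      have : ‖b₁‖ ^ 2 = 0 := by nlinarith [sq_nonneg ‖b₁‖]
      simpa using this
    have ha'' := ha' (by nlinarith [sq_nonneg ‖b₁‖])
    have he'' := he' (by nlinarith [sq_nonneg ‖b₁‖])
    rw [hb0] at hA
    have key : (fromBlocks a₁ 0 0 e₁)ᴴ * fromBlocks a₁ 0 0 e₁ =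
        fromBlocks a₁ 0 0 e₁ * (fromBlocks a₁ 0 0 e₁)ᴴ := by
      simp [fromBlocks_conjTranspose, fromBlocks_multiply, ha'', he'']
    rw [hA]
    set T := fromBlocks a₁ 0 0 e₁
    calc (W * T * Wᴴ)ᴴ * (W * T * Wᴴ) = W * Tᴴ * (Wᴴ * W) * T * Wᴴ := by
          simp [Matrix.mul_assoc]
      _ = W * (Tᴴ * T) * Wᴴ := by rw [hW]; simp [Matrix.mul_assoc]
      _ = W * T * (Wᴴ * W) * Tᴴ * Wᴴ := by rw [hW, key]; simp [Matrix.mul_assoc]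
      _ = _ := by simp [Matrix.mul_assoc]

end Schur

section Gram

open Matrix
open scoped MatrixOrder ComplexOrder

theorem exists_eq_conjTranspose_mul_self {𝕜 n : Type*} [RCLike 𝕜] [Fintype n] [DecidableEq n]
    {H : Matrix n n 𝕜} (hH : H.PosSemidef) : ∃ g : Matrix n n 𝕜, gᴴ * g = H := by
  obtain ⟨g, rfl⟩ := CStarAlgebra.nonneg_iff_eq_star_mul_self.mp hH.nonneg
  exact ⟨g, rfl⟩

end Gram

section Conformal

open Matrix
open scoped Matrix.Norms.Frobenius ComplexOrder

theorem exists_gram_of_one_add {n : Type*} [Fintype n] [DecidableEq n] {K : Matrix n n ℂ}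
    (hK : K.PosSemidef) : ∃ g g' : Matrix n n ℂ, g * g' = 1 ∧ g' * g = 1 ∧ gᴴ * g = 1 + K ∧
      ‖g'‖ ^ 2 ≤ Fintype.card n := by
  have hpd : (1 + K).PosDef := Matrix.PosDef.one.add_posSemidef hK
  obtain ⟨g, hg⟩ := exists_eq_conjTranspose_mul_self hpd.posSemidef
  obtain ⟨v, -, hv⟩ := isUnit_iff_exists.1 hpd.isUnit
  have h1 : (v * gᴴ) * g = 1 := by rw [Matrix.mul_assoc, hg, hv]
  have h2 : g * (v * gᴴ) = 1 := mul_eq_one_comm.1 h1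
  refine ⟨g, v * gᴴ, h2, h1, hg, ?_⟩
  set g' : Matrix n n ℂ := v * gᴴ
  have h3 : g'ᴴ * g' + g'ᴴ * K * g' = 1 := by
    calc g'ᴴ * g' + g'ᴴ * K * g' = g'ᴴ * (1 + K) * g' := by
          rw [Matrix.mul_add, Matrix.add_mul, Matrix.mul_one]
      _ = (g * g')ᴴ * (g * g') := by rw [← hg, conjTranspose_mul g]; simp only [Matrix.mul_assoc]
      _ = 1 := by rw [h2]; simp
  have h4 := congrArg (fun M => RCLike.re (trace M)) h3
  have h5 : 0 ≤ RCLike.re (g'ᴴ * K * g').trace :=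
    (RCLike.le_iff_re_im.1 (hK.conjTranspose_mul_mul_same g').trace_nonneg).1.trans' (by simp)
  simp only [trace_add, trace_one, map_add, ← frobenius_norm_sq_eq_trace] at h4
  have h6 : RCLike.re ((Fintype.card n : ℕ) : ℂ) = (Fintype.card n : ℝ) := by simp
  linarith

theorem norm_sq_eq_eigSq_of_conformal {n : Type*} [Fintype n] [DecidableEq n]
    {u : Matrix n n ℂ} {c : ℝ} (hu : uᴴ * u = (c : ℂ) • (1 : Matrix n n ℂ)) :
    ‖u‖ ^ 2 = eigSq u := by
  have h1 : ‖u‖ ^ 2 = Fintype.card n * c := by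
    rw [frobenius_norm_sq_eq_trace, hu]
    simp [mul_comm]
  have h2 : ∀ z ∈ u.charpoly.roots, ‖z‖ ^ 2 = c := by
    intro z hz
    have hz' := (Polynomial.mem_roots'.1 hz).2
    rw [Polynomial.IsRoot, eval_charpoly, ← exists_mulVec_eq_zero_iff] at hz'
    obtain ⟨v, hv, hv0⟩ := hz'
    have huv : u *ᵥ v = z • v := by
      rw [sub_mulVec, sub_eq_zero] at hv0
      rw [← hv0]; simp 
    have h3 : star (u *ᵥ v) ⬝ᵥ (u *ᵥ v) = (c : ℂ) * (star v ⬝ᵥ v) := by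
      rw [star_mulVec, ← dotProduct_mulVec, mulVec_mulVec, hu]
      simp [smul_mulVec]
    rw [huv] at h3
    have h4 : star v ⬝ᵥ v ≠ 0 := by simpa using hv
    simp only [star_smul, smul_dotProduct, dotProduct_smul, smul_eq_mul, ← mul_assoc] at h3
    have h5 := mul_right_cancel₀ h4 h3
    rw [RCLike.star_def, RCLike.mul_conj] at h5
    exact Complex.ofReal_injective (by simpa using h5)
  have h3 : u.charpoly.roots.card = Fintype.card n := by
    rw [← charpoly_natDegree_eq_dim u]
    exact (Polynomial.splits_iff_card_roots.1 (IsAlgClosed.splits _))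
  rw [h1, eigSq, Multiset.map_congr rfl h2, Multiset.map_const', Multiset.sum_replicate, h3]
  simp

theorem norm_apply_le_frobenius {m n : Type*} [Fintype m] [Fintype n] {𝕜 : Type*} [RCLike 𝕜]
    (A : Matrix m n 𝕜) (i : m) (j : n) : ‖A i j‖ ≤ ‖A‖ := by
  rw [← sq_le_sq₀ (norm_nonneg _) (norm_nonneg _), frobenius_norm_sq]
  calc ‖A i j‖ ^ 2 ≤ ∑ j, ‖A i j‖ ^ 2 :=
        Finset.single_le_sum (f := fun j => ‖A i j‖ ^ 2) (fun _ _ => by positivity)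
          (Finset.mem_univ j)
    _ ≤ _ := Finset.single_le_sum (f := fun i => ∑ j, ‖A i j‖ ^ 2) (fun _ _ => by positivity)
          (Finset.mem_univ i)

theorem norm_det_rpow_le {d : ℕ} (hd : 0 < d) (A : Matrix (Fin d) (Fin d) ℂ) :
    ‖A.det‖ ^ (2 / d : ℝ) ≤ (d.factorial : ℝ) ^ (2 / d : ℝ) * ‖A‖ ^ 2 := by
  have h := Matrix.det_le (A := A) (abv := NormedField.toAbsoluteValue ℂ) (x := ‖A‖)
    (fun i j => norm_apply_le_frobenius A i j)
  have h' : ‖A.det‖ ≤ d.factorial * ‖A‖ ^ d := by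
    change ‖A.det‖ ≤ _ at h
    simpa using h
  calc ‖A.det‖ ^ (2 / d : ℝ) ≤ (d.factorial * ‖A‖ ^ d) ^ (2 / d : ℝ) :=
        Real.rpow_le_rpow (norm_nonneg _) h' (by positivity)
    _ = _ := by
        rw [Real.mul_rpow (by positivity) (by positivity), ← Real.rpow_natCast ‖A‖ d,
          ← Real.rpow_mul (norm_nonneg _), mul_div_cancel₀ _ (by positivity)]
        norm_num

end Conformal

section Halving

open Matrix
open scoped Matrix.Norms.Frobenius ComplexOrder

theorem exists_conformal {Γ : Type*} [Group Γ] {Γ₀ : Subgroup Γ} [Γ₀.Normal] [Fintype (Γ ⧸ Γ₀)]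
    {S : Finset Γ} (hout : ∀ q : Γ ⧸ Γ₀, q.out ∈ S) (hinv : ∀ s ∈ S, s⁻¹ ∈ S) {d : ℕ}
    (hd : 0 < d) (x : Γ →* Matrix (Fin d) (Fin d) ℂ)
    (hx : ∀ γ ∈ Γ₀, ∃ c : ℂ, x γ = c • 1) {R : ℝ} (hR : ∀ s ∈ S, ‖x s‖ ^ 2 ≤ R) :
    ∃ g g' : Matrix (Fin d) (Fin d) ℂ, g * g' = 1 ∧ g' * g = 1 ∧
      ‖g‖ ^ 2 ≤ Fintype.card (Γ ⧸ Γ₀) * ((d.factorial : ℝ) ^ (2 / d : ℝ) * R * R) ∧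
      ‖g'‖ ^ 2 ≤ d ∧
      ∀ γ, ∃ c : ℝ, (g * x γ * g')ᴴ * (g * x γ * g') =
        (c : ℂ) • (1 : Matrix (Fin d) (Fin d) ℂ) := by
  classical
  have hd' : (d : ℝ) ≠ 0 := by positivity
  set χ : Γ → ℝ := fun γ => ‖(x γ).det‖ ^ (2 / d : ℝ) with hχ
  have hχmul : ∀ γ δ, χ (γ * δ) = χ γ * χ δ := by
    intro γ δ
    simp only [hχ, map_mul, det_mul, norm_mul]
    exact Real.mul_rpow (norm_nonneg _) (norm_nonneg _)
  have hχ1 : χ 1 = 1 := by simp [hχ]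
  have hχ0 : ∀ γ, 0 ≤ χ γ := fun γ => Real.rpow_nonneg (norm_nonneg _) _
  have hχinv : ∀ γ, χ γ * χ γ⁻¹ = 1 := fun γ => by rw [← hχmul, mul_inv_cancel, hχ1]
  have hχpos : ∀ γ, 0 < χ γ := fun γ =>
    (hχ0 γ).lt_of_ne fun h => by have := hχinv γ; rw [← h] at this; simp at this
  have hχinv' : ∀ γ, (χ γ)⁻¹ = χ γ⁻¹ := fun γ => (eq_inv_of_mul_eq_one_right (hχinv γ)).symm
  set f : Γ → Matrix (Fin d) (Fin d) ℂ := fun γ => ((χ γ)⁻¹ : ℝ) • ((x γ)ᴴ * x γ) with hf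
  have hfz : ∀ γ, ∀ z ∈ Γ₀, f (γ * z) = f γ := by
    intro γ z hz
    obtain ⟨c, hc⟩ := hx z hz
    have h1 : χ z = ‖c‖ ^ 2 := by
      simp only [hχ, hc, det_smul, det_one, mul_one, norm_pow, Fintype.card_fin]
      rw [← Real.rpow_natCast, ← Real.rpow_mul (norm_nonneg _), mul_div_cancel₀ _ hd']
      norm_num
    have h2 := hχpos z
    simp only [hf, hχmul, map_mul, hc]
    have h3 : (x γ * c • (1 : Matrix (Fin d) (Fin d) ℂ))ᴴ * (x γ * c • 1) =
        (χ z) • ((x γ)ᴴ * x γ) := by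
      have : c * star c = ((χ z : ℝ) : ℂ) := by
        rw [h1, RCLike.star_def, RCLike.mul_conj]; simp
      simp only [Matrix.mul_smul, Matrix.mul_one, conjTranspose_smul, Matrix.smul_mul, smul_smul,
        this, Complex.coe_smul]
    rw [h3, smul_smul]
    congr 1
    field_simp
  have hconj : ∀ γ δ, (x δ)ᴴ * f γ * x δ = χ δ • f (γ * δ) := by
    intro γ δ
    simp only [hf, map_mul, hχmul, smul_smul, conjTranspose_mul, Matrix.mul_smul, Matrix.smul_mul,
      Matrix.mul_assoc]
    congr 1
    have := hχpos δ
    have := hχpos γ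
    field_simp
  have hfmk : ∀ γ : Γ, f ((γ : Γ ⧸ Γ₀)).out = f γ := by
    intro γ
    obtain ⟨z, hz⟩ := QuotientGroup.mk_out_eq_mul Γ₀ γ
    rw [hz]
    exact hfz γ z z.2
  have hf1 : f 1 = 1 := by simp [hf, hχ1]
  have hfpos : ∀ γ, (f γ).PosSemidef := fun γ =>
    (posSemidef_conjTranspose_mul_self (x γ)).smul (inv_nonneg.2 (hχ0 γ))
  set K := ∑ q ∈ Finset.univ.erase (1 : Γ ⧸ Γ₀), f q.out with hK
  have hH : ∑ q : Γ ⧸ Γ₀, f q.out = 1 + K := by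
    rw [hK, ← Finset.add_sum_erase _ _ (Finset.mem_univ (1 : Γ ⧸ Γ₀))]
    congr 1
    rw [← QuotientGroup.mk_one, hfmk, hf1]
  have hKpos : K.PosSemidef := posSemidef_sum _ fun q _ => hfpos _
  obtain ⟨g, g', hgg', hg'g, hg, hg'⟩ := exists_gram_of_one_add hKpos
  refine ⟨g, g', hgg', hg'g, ?_, by simpa using hg', fun γ => ⟨χ γ, ?_⟩⟩
  · rw [frobenius_norm_sq_eq_trace, hg, ← hH, trace_sum, map_sum]
    calc ∑ q : Γ ⧸ Γ₀, RCLike.re (f q.out).trace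
        ≤ ∑ q : Γ ⧸ Γ₀, ((d.factorial : ℝ) ^ (2 / d : ℝ) * R * R) := by
          refine Finset.sum_le_sum fun q _ => ?_
          have h1 : RCLike.re (f q.out).trace = χ q.out⁻¹ * ‖x q.out‖ ^ 2 := by
            simp only [hf, trace_smul, RCLike.smul_re, ← frobenius_norm_sq_eq_trace, hχinv']
          have h2 : χ q.out⁻¹ ≤ (d.factorial : ℝ) ^ (2 / d : ℝ) * R :=
            (norm_det_rpow_le hd _).trans
              (mul_le_mul_of_nonneg_left (hR _ (hinv _ (hout q))) (by positivity))
          rw [h1]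
          exact mul_le_mul h2 (hR _ (hout q)) (by positivity) ((hχ0 _).trans h2)
      _ = _ := by simp
  · have h1 : (x γ)ᴴ * (gᴴ * g) * x γ = χ γ • (gᴴ * g) := by
      rw [hg, ← hH, Finset.mul_sum, Finset.sum_mul, Finset.smul_sum]
      simp only [hconj]
      rw [← Equiv.sum_comp (Equiv.mulRight ((γ : Γ ⧸ Γ₀))) fun q : Γ ⧸ Γ₀ => χ γ • f q.out]
      refine Finset.sum_congr rfl fun q _ => ?_
      congr 1
      rw [Equiv.coe_mulRight, ← hfmk (q.out * γ), QuotientGroup.mk_mul, QuotientGroup.out_eq']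
    calc (g * x γ * g')ᴴ * (g * x γ * g') = g'ᴴ * ((x γ)ᴴ * (gᴴ * g) * x γ) * g' := by
          simp only [conjTranspose_mul, Matrix.mul_assoc]
      _ = χ γ • ((g * g')ᴴ * (g * g')) := by
          rw [h1]; simp only [conjTranspose_mul g, Matrix.mul_assoc, Matrix.mul_smul,
            Matrix.smul_mul]
      _ = _ := by rw [hgg']; simp

/-- On a bounded set of representations one can conjugate by a bounded matrix so as to halve the
distance from the minimal norm in the conjugacy class. -/
theorem exists_conj_halving {Γ : Type*} [Group Γ] {Γ₀ : Subgroup Γ} [Γ₀.Normal]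
    [Fintype (Γ ⧸ Γ₀)] {S : Finset Γ} (hout : ∀ q : Γ ⧸ Γ₀, q.out ∈ S)
    (hinv : ∀ s ∈ S, s⁻¹ ∈ S) {n : ℕ}
    (hsc : ∀ d ≤ n, ∀ x : Γ →* Matrix (Fin d) (Fin d) ℂ, IsIrrRep x →
        ∀ γ ∈ Γ₀, ∃ c : ℂ, x γ = c • 1) (R : ℝ) (d : ℕ) (hdn : d ≤ n) :
    ∃ K : ℝ, ∀ x : Γ →* Matrix (Fin d) (Fin d) ℂ, (∀ s ∈ S, ‖x s‖ ^ 2 ≤ R) →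
      ∃ g g' : Matrix (Fin d) (Fin d) ℂ, g * g' = 1 ∧ g' * g = 1 ∧ ‖g‖ ^ 2 ≤ K ∧ ‖g'‖ ^ 2 ≤ K ∧
        ∑ s ∈ S, (‖g * x s * g'‖ ^ 2 - eigSq (x s)) ≤
          (∑ s ∈ S, (‖x s‖ ^ 2 - eigSq (x s))) / 2 := by
  induction d using Nat.strong_induction_on with
  | _ d ih =>
  rcases Nat.eq_zero_or_pos d with rfl | hd
  · refine ⟨0, fun x _ => ⟨1, 1, by simp, by simp, ?_, ?_, ?_⟩⟩
    · simp [frobenius_norm_sq]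
    · simp [frobenius_norm_sq]
    · have h1 : ∀ A : Matrix (Fin 0) (Fin 0) ℂ, ‖A‖ ^ 2 - eigSq A = 0 := fun A => by
        simp [frobenius_norm_sq, eigSq]
      simp [h1]
  have ih' : ∀ k : Fin d, ∃ K : ℝ, ∀ x : Γ →* Matrix (Fin k) (Fin k) ℂ,
      (∀ s ∈ S, ‖x s‖ ^ 2 ≤ R) →
      ∃ g g' : Matrix (Fin k) (Fin k) ℂ, g * g' = 1 ∧ g' * g = 1 ∧ ‖g‖ ^ 2 ≤ K ∧ ‖g'‖ ^ 2 ≤ K ∧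
        ∑ s ∈ S, (‖g * x s * g'‖ ^ 2 - eigSq (x s)) ≤
          (∑ s ∈ S, (‖x s‖ ^ 2 - eigSq (x s))) / 2 := fun k => ih k k.2 (k.2.le.trans hdn)
  choose Kf hKf using ih'
  obtain ⟨K, hK⟩ : ∃ K : ℝ, ∀ k, Kf k ≤ K := by
    obtain ⟨K, hK⟩ := (Set.finite_range Kf).bddAbove
    exact ⟨K, fun k => hK ⟨k, rfl⟩⟩
  set r : ℝ := (Real.sqrt (2 * (K ^ 2 + 1)))⁻¹ with hr
  have hr0 : 0 < r := by positivity
  have hr2 : r ^ 2 * (2 * (K ^ 2 + 1)) = 1 := by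
    rw [hr, inv_pow, Real.sq_sqrt (by positivity), inv_mul_cancel₀ (by positivity)]
  have hri2 : (r⁻¹) ^ 2 = 2 * (K ^ 2 + 1) := by
    rw [hr, inv_inv, Real.sq_sqrt (by positivity)]
  have hr1 : r ^ 2 ≤ 1 := by nlinarith [sq_nonneg K, sq_nonneg r]
  set K₁ := Fintype.card (Γ ⧸ Γ₀) * ((d.factorial : ℝ) ^ (2 / d : ℝ) * R * R) with hK₁
  refine ⟨max (max K₁ d) ((2 * (K ^ 2 + 1) + 1) * K), fun x hx => ?_⟩
  by_cases hirr : IsIrrRep x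
  · obtain ⟨g, g', h1, h2, h3, h4, h5⟩ := exists_conformal hout hinv hd x (hsc d hdn x hirr) hx
    refine ⟨g, g', h1, h2, h3.trans ((le_max_left _ _).trans (le_max_left _ _)),
      h4.trans ((le_max_right _ _).trans (le_max_left _ _)), ?_⟩
    have h6 : ∀ s ∈ S, ‖g * x s * g'‖ ^ 2 - eigSq (x s) = 0 := by
      intro s _
      obtain ⟨c, hc⟩ := h5 s
      rw [norm_sq_eq_eigSq_of_conformal hc, eigSq_conj h1 h2, sub_self]
    rw [Finset.sum_congr rfl h6, Finset.sum_const_zero]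
    exact div_nonneg (Finset.sum_nonneg fun s _ => sub_nonneg.2 (eigSq_le_and_normal _).1)
      zero_le_two
  · obtain ⟨k, l, hk, hl, W, hW, hW', a, e, b, hb⟩ := exists_block_of_not_isIrrRep x hirr
    have hnorm : ∀ s, ‖x s‖ ^ 2 = ‖a s‖ ^ 2 + ‖b s‖ ^ 2 + ‖e s‖ ^ 2 := by
      intro s
      rw [hb s, frobenius_norm_mul_isometry (by simpa using hW), frobenius_norm_isometry_mul hW,
        frobenius_norm_sq_fromBlocks]
      simp
    have heig : ∀ s, eigSq (x s) = eigSq (a s) + eigSq (e s) := by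
      intro s
      rw [hb s, eigSq_conj hW' hW, eigSq_fromBlocks]
    obtain ⟨ga, ga', ha1, ha2, ha3, ha4, ha5⟩ := hKf ⟨k, hk⟩ a fun s hs => by
      nlinarith [hx s hs, hnorm s, sq_nonneg ‖b s‖, sq_nonneg ‖e s‖]
    obtain ⟨ge, ge', he1, he2, he3, he4, he5⟩ := hKf ⟨l, hl⟩ e fun s hs => by
      nlinarith [hx s hs, hnorm s, sq_nonneg ‖b s‖, sq_nonneg ‖a s‖]
    have hK0 : 0 ≤ K := (sq_nonneg ‖ga‖).trans (ha3.trans (hK _))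
    refine ⟨W * fromBlocks (r • ga) 0 0 ge * Wᴴ, W * fromBlocks (r⁻¹ • ga') 0 0 ge' * Wᴴ,
      ?_, ?_, ?_, ?_, ?_⟩
    · calc _ = W * fromBlocks (r • ga) 0 0 ge * (Wᴴ * W) * fromBlocks (r⁻¹ • ga') 0 0 ge' * Wᴴ := by
            simp only [Matrix.mul_assoc]
        _ = 1 := by
            rw [hW, Matrix.mul_one, Matrix.mul_assoc W, fromBlocks_multiply]
            simp [ha1, he1, smul_smul, hr0.ne', hW']
    · calc _ = W * fromBlocks (r⁻¹ • ga') 0 0 ge' * (Wᴴ * W) * fromBlocks (r • ga) 0 0 ge * Wᴴ := by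
            simp only [Matrix.mul_assoc]
        _ = 1 := by
            rw [hW, Matrix.mul_one, Matrix.mul_assoc W, fromBlocks_multiply]
            simp [ha2, he2, smul_smul, hr0.ne', hW']
    · refine le_max_of_le_right ?_
      rw [frobenius_norm_mul_isometry (by simpa using hW), frobenius_norm_isometry_mul hW,
        frobenius_norm_sq_fromBlocks, norm_smul, mul_pow, Real.norm_eq_abs, sq_abs]
      simp only [norm_zero]
      nlinarith [ha3.trans (hK _), he3.trans (hK _), sq_nonneg ‖ga‖, sq_nonneg K,
        mul_nonneg hK0 (sq_nonneg K)]
    · refine le_max_of_le_right ?_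
      rw [frobenius_norm_mul_isometry (by simpa using hW), frobenius_norm_isometry_mul hW,
        frobenius_norm_sq_fromBlocks, norm_smul, mul_pow, Real.norm_eq_abs, sq_abs, hri2]
      simp only [norm_zero]
      nlinarith [mul_le_mul_of_nonneg_left (ha4.trans (hK _))
        (by positivity : 0 ≤ 2 * (K ^ 2 + 1)), he4.trans (hK _)]
    · have key : ∀ s, ‖W * fromBlocks (r • ga) 0 0 ge * Wᴴ * x s *
          (W * fromBlocks (r⁻¹ • ga') 0 0 ge' * Wᴴ)‖ ^ 2 =
          ‖ga * a s * ga'‖ ^ 2 + r ^ 2 * ‖ga * b s * ge'‖ ^ 2 + ‖ge * e s * ge'‖ ^ 2 := by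
        intro s
        have : W * fromBlocks (r • ga) 0 0 ge * Wᴴ * x s *
          (W * fromBlocks (r⁻¹ • ga') 0 0 ge' * Wᴴ) =
          W * fromBlocks (ga * a s * ga') (r • (ga * b s * ge')) 0 (ge * e s * ge') * Wᴴ := by
          calc _ = W * fromBlocks (r • ga) 0 0 ge * (Wᴴ * W) * fromBlocks (a s) (b s) 0 (e s) *
                (Wᴴ * W) * fromBlocks (r⁻¹ • ga') 0 0 ge' * Wᴴ := by
                rw [hb s]; simp only [Matrix.mul_assoc]
            _ = W * (fromBlocks (r • ga) 0 0 ge * fromBlocks (a s) (b s) 0 (e s) *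
                fromBlocks (r⁻¹ • ga') 0 0 ge') * Wᴴ := by
                rw [hW]; simp only [Matrix.mul_assoc, Matrix.one_mul]
            _ = _ := by
                rw [fromBlocks_multiply, fromBlocks_multiply]
                simp [smul_smul, hr0.ne']
        rw [this, frobenius_norm_mul_isometry (by simpa using hW), frobenius_norm_isometry_mul hW,
          frobenius_norm_sq_fromBlocks, norm_smul, mul_pow, Real.norm_eq_abs, sq_abs]
        simp
      have hbb : ∀ s, r ^ 2 * ‖ga * b s * ge'‖ ^ 2 ≤ ‖b s‖ ^ 2 / 2 := by
        intro s
        have h1 : ‖ga * b s * ge'‖ ≤ ‖ga‖ * ‖b s‖ * ‖ge'‖ :=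
          (frobenius_norm_mul _ _).trans
            (mul_le_mul_of_nonneg_right (frobenius_norm_mul _ _) (norm_nonneg _))
        have h2 : ‖ga * b s * ge'‖ ^ 2 ≤ K * K * ‖b s‖ ^ 2 := by
          calc ‖ga * b s * ge'‖ ^ 2 ≤ (‖ga‖ * ‖b s‖ * ‖ge'‖) ^ 2 :=
                pow_le_pow_left₀ (norm_nonneg _) h1 2
            _ = (‖ga‖ ^ 2 * ‖ge'‖ ^ 2) * ‖b s‖ ^ 2 := by ring
            _ ≤ _ := mul_le_mul_of_nonneg_right (mul_le_mul (ha3.trans (hK _))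
                (he4.trans (hK _)) (sq_nonneg _) hK0) (sq_nonneg _)
        have h3 := mul_le_mul_of_nonneg_left h2 (sq_nonneg r)
        nlinarith [mul_nonneg (sq_nonneg r) (sq_nonneg ‖b s‖)]
      have hsum := add_le_add (add_le_add ha5 he5)
        (Finset.sum_le_sum fun s (_ : s ∈ S) => hbb s)
      simp only [key, heig, hnorm]
      rw [← Finset.sum_add_distrib, ← Finset.sum_add_distrib, Finset.sum_div, Finset.sum_div,
        ← Finset.sum_add_distrib, ← Finset.sum_add_distrib] at hsum
      rw [Finset.sum_div]
      refine (Finset.sum_congr rfl fun s _ => ?_).trans_le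
        (hsum.trans_eq (Finset.sum_congr rfl fun s _ => ?_)) <;> ring

end Halving

section Spectral

open Matrix
open scoped Matrix.Norms.Frobenius ComplexOrder

variable {𝕜 n : Type*} [RCLike 𝕜] [Fintype n] [DecidableEq n]

theorem Matrix.IsHermitian.exists_diagonalization {A : Matrix n n 𝕜} (hA : A.IsHermitian) :
    ∃ (U : Matrix n n 𝕜) (a : n → ℝ), Uᴴ * U = 1 ∧ U * Uᴴ = 1 ∧
      A = U * diagonal (fun i => (a i : 𝕜)) * Uᴴ := by
  refine ⟨hA.eigenvectorUnitary, hA.eigenvalues, ?_, ?_, ?_⟩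
  · exact Unitary.coe_star_mul_self _
  · exact Unitary.coe_mul_star_self _
  · conv_lhs => rw [hA.spectral_theorem, Unitary.conjStarAlgAut_apply]
    rfl

/-- The commutator of `X` with a diagonalized matrix, in the eigenbasis. -/
theorem commutator_diagonalized {U A : Matrix n n 𝕜} {a : n → ℝ} (h2 : U * Uᴴ = 1)
    (hA : A = U * diagonal (fun i => (a i : 𝕜)) * Uᴴ)
    (X : Matrix n n 𝕜) : A * X - X * A =
      U * (of fun i j => ((a i - a j : ℝ) : 𝕜) * (Uᴴ * X * U) i j) * Uᴴ := by
  have h : (of fun i j => ((a i - a j : ℝ) : 𝕜) * (Uᴴ * X * U) i j) =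
      diagonal (fun i => (a i : 𝕜)) * (Uᴴ * X * U) -
        (Uᴴ * X * U) * diagonal (fun i => (a i : 𝕜)) := by
    ext i j
    simp only [of_apply, Matrix.sub_apply, diagonal_mul, mul_diagonal]
    push_cast
    ring
  rw [h, hA]
  set D := diagonal (fun i => (a i : 𝕜))
  calc U * D * Uᴴ * X - X * (U * D * Uᴴ) =
      U * D * Uᴴ * X * (U * Uᴴ) - (U * Uᴴ) * X * (U * D * Uᴴ) := by
        rw [h2, Matrix.one_mul, Matrix.mul_one]
    _ = _ := by simp only [Matrix.mul_sub, Matrix.sub_mul, Matrix.mul_assoc]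

theorem norm_sq_commutator_diagonalized {U A : Matrix n n 𝕜} {a : n → ℝ} (h1 : Uᴴ * U = 1)
    (h2 : U * Uᴴ = 1) (hA : A = U * diagonal (fun i => (a i : 𝕜)) * Uᴴ)
    (X : Matrix n n 𝕜) : ‖A * X - X * A‖ ^ 2 =
      ∑ i, ∑ j, ‖(Uᴴ * X * U) i j‖ ^ 2 * (a i - a j) ^ 2 := by
  rw [commutator_diagonalized h2 hA, frobenius_norm_mul_isometry (by simpa using h1),
    frobenius_norm_isometry_mul h1, frobenius_norm_sq]
  refine Finset.sum_congr rfl fun i _ => Finset.sum_congr rfl fun j _ => ?_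
  rw [of_apply, norm_mul, mul_pow, RCLike.norm_ofReal, sq_abs, mul_comm]

theorem norm_sq_diagonalized {U : Matrix n n 𝕜}
    (h2 : U * Uᴴ = 1) (X : Matrix n n 𝕜) : ‖X‖ ^ 2 =
      ∑ i, ∑ j, ‖(Uᴴ * X * U) i j‖ ^ 2 := by
  rw [← frobenius_norm_sq, frobenius_norm_mul_isometry h2, frobenius_norm_isometry_mul]
  simpa using h2

theorem trace_commutator_diagonalized {U A : Matrix n n 𝕜} {a : n → ℝ}
    (h2 : U * Uᴴ = 1) (hA : A = U * diagonal (fun i => (a i : 𝕜)) * Uᴴ)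
    (X : Matrix n n 𝕜) : RCLike.re (Xᴴ * (A * X - X * A)).trace =
      ∑ i, ∑ j, ‖(Uᴴ * X * U) i j‖ ^ 2 * (a i - a j) := by
  rw [commutator_diagonalized h2 hA]
  set Y := of fun i j => ((a i - a j : ℝ) : 𝕜) * (Uᴴ * X * U) i j with hY
  have : (Xᴴ * (U * Y * Uᴴ)).trace = ((Uᴴ * X * U)ᴴ * Y).trace := by
    rw [← Matrix.mul_assoc, trace_mul_comm]
    simp only [conjTranspose_mul, Matrix.mul_assoc, conjTranspose_conjTranspose]
  rw [this, trace]
  simp only [diag_apply, mul_apply (M := (Uᴴ * X * U)ᴴ), map_sum]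
  rw [Finset.sum_comm]
  refine Finset.sum_congr rfl fun i _ => Finset.sum_congr rfl fun j _ => ?_
  rw [hY, of_apply, conjTranspose_apply, mul_left_comm, RCLike.re_ofReal_mul, RCLike.star_def,
    RCLike.conj_mul, mul_comm]
  norm_cast

/-- The norm of a conjugate depends only on the Gram matrix of the conjugating matrix. -/
theorem norm_sq_conj_diagonalized {U g g' : Matrix n n 𝕜} {a : n → ℝ}
    (hg : gᴴ * g = U * diagonal (fun i => ((Real.exp (-2 * a i) : ℝ) : 𝕜)) * Uᴴ)
    (hg' : g' * g'ᴴ = U * diagonal (fun i => ((Real.exp (2 * a i) : ℝ) : 𝕜)) * Uᴴ)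
    (X : Matrix n n 𝕜) : ‖g * X * g'‖ ^ 2 =
      ∑ i, ∑ j, ‖(Uᴴ * X * U) i j‖ ^ 2 * Real.exp (-2 * (a i - a j)) := by
  set D : Matrix n n 𝕜 := diagonal (fun i => ((Real.exp (-a i) : ℝ) : 𝕜)) with hD
  set D' : Matrix n n 𝕜 := diagonal (fun i => ((Real.exp (a i) : ℝ) : 𝕜)) with hD'
  have hDD : diagonal (fun i => ((Real.exp (-2 * a i) : ℝ) : 𝕜)) = Dᴴ * D := by
    rw [hD, diagonal_conjTranspose, diagonal_mul_diagonal]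
    congr 1
    ext i
    rw [Pi.star_apply, RCLike.star_def, RCLike.conj_ofReal, ← RCLike.ofReal_mul, ← Real.exp_add]
    ring_nf
  have hDD' : diagonal (fun i => ((Real.exp (2 * a i) : ℝ) : 𝕜)) = D' * D'ᴴ := by
    rw [hD', diagonal_conjTranspose, diagonal_mul_diagonal]
    congr 1
    ext i
    rw [Pi.star_apply, RCLike.star_def, RCLike.conj_ofReal, ← RCLike.ofReal_mul, ← Real.exp_add]
    ring_nf
  have key : ‖g * X * g'‖ ^ 2 = ‖D * (Uᴴ * X * U) * D'‖ ^ 2 := by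
    rw [frobenius_norm_sq_eq_trace, frobenius_norm_sq_eq_trace]
    congr 1
    calc ((g * X * g')ᴴ * (g * X * g')).trace
        = (g'ᴴ * (Xᴴ * (gᴴ * g) * X * g')).trace := by
          simp only [conjTranspose_mul, Matrix.mul_assoc]
      _ = (Xᴴ * (gᴴ * g) * X * (g' * g'ᴴ)).trace := by
          rw [trace_mul_comm]; simp only [Matrix.mul_assoc]
      _ = ((Xᴴ * U * Dᴴ * D * Uᴴ * X * U * D') * (D'ᴴ * Uᴴ)).trace := by
          rw [hg, hg', hDD, hDD']; simp only [Matrix.mul_assoc]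
      _ = _ := by
          rw [trace_mul_comm]
          simp only [conjTranspose_mul, Matrix.mul_assoc, conjTranspose_conjTranspose]
  rw [key, frobenius_norm_sq]
  refine Finset.sum_congr rfl fun i _ => Finset.sum_congr rfl fun j _ => ?_
  rw [hD, hD', mul_diagonal, diagonal_mul, norm_mul, norm_mul, RCLike.norm_ofReal,
    RCLike.norm_ofReal, Real.abs_exp, Real.abs_exp, mul_pow, mul_pow, ← Real.exp_nat_mul,
    ← Real.exp_nat_mul, mul_right_comm, ← Real.exp_add, mul_comm]
  congr 2
  push_cast
  ring

theorem exists_diagonalization_gram {g g' : Matrix n n 𝕜} (hgg' : g * g' = 1)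
    {K : ℝ} (hg : ‖g‖ ^ 2 ≤ K) (hg' : ‖g'‖ ^ 2 ≤ K) :
    ∃ (U : Matrix n n 𝕜) (a : n → ℝ), Uᴴ * U = 1 ∧ U * Uᴴ = 1 ∧
      gᴴ * g = U * diagonal (fun i => ((Real.exp (-2 * a i) : ℝ) : 𝕜)) * Uᴴ ∧
      g' * g'ᴴ = U * diagonal (fun i => ((Real.exp (2 * a i) : ℝ) : 𝕜)) * Uᴴ ∧
      ∀ i, |a i| ≤ Real.log K / 2 := by
  obtain ⟨U, h, h1, h2, hH⟩ := (isHermitian_conjTranspose_mul_self g).exists_diagonalization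
  have hg'g : g' * g = 1 := mul_eq_one_comm.1 hgg'
  set D : Matrix n n 𝕜 := diagonal (fun i => (h i : 𝕜)) with hD
  have hDeq : Uᴴ * (gᴴ * g) * U = D := by
    rw [hH]
    calc Uᴴ * (U * D * Uᴴ) * U = (Uᴴ * U) * D * (Uᴴ * U) := by simp only [Matrix.mul_assoc]
      _ = D := by rw [h1]; simp
  set E := Uᴴ * (g' * g'ᴴ) * U with hE
  have hDE : D * E = 1 := by
    rw [← hDeq]
    calc Uᴴ * (gᴴ * g) * U * (Uᴴ * (g' * g'ᴴ) * U)
        = Uᴴ * (gᴴ * g) * (U * Uᴴ) * (g' * g'ᴴ) * U := by simp only [Matrix.mul_assoc]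
      _ = Uᴴ * (gᴴ * (g * g') * g'ᴴ) * U := by rw [h2]; simp only [Matrix.mul_assoc, Matrix.one_mul]
      _ = 1 := by rw [hgg', Matrix.mul_one, ← conjTranspose_mul, hg'g]; simp [h1]
  have hDEi : ∀ i, (h i : 𝕜) * E i i = 1 := by
    intro i
    have := congrFun (congrFun hDE i) i
    rwa [hD, diagonal_mul, one_apply_eq] at this
  have hdiag : ∀ i, (h i : 𝕜) = ∑ j, ((‖(g * U) j i‖ ^ 2 : ℝ) : 𝕜) := by
    intro i
    have h3 : (h i : 𝕜) = D i i := by rw [hD, diagonal_apply_eq]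
    have h4 : D = (g * U)ᴴ * (g * U) := by
      rw [← hDeq]; simp only [conjTranspose_mul, Matrix.mul_assoc]
    rw [h3, h4, mul_apply]
    refine Finset.sum_congr rfl fun j _ => ?_
    rw [conjTranspose_apply, RCLike.star_def, RCLike.conj_mul]
    norm_cast
  have hpos : ∀ i, 0 < h i := by
    intro i
    have h3 : 0 ≤ h i := by
      have := hdiag i
      rw [← map_sum] at this
      rw [RCLike.ofReal_injective this]
      positivity
    refine h3.lt_of_ne fun h4 => ?_
    have := hDEi i
    rw [← h4] at this
    simp at this
  have hbound1 : ∀ i, h i ≤ K := by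
    intro i
    have h3 : ‖(h i : 𝕜)‖ ≤ ‖D‖ := by
      have := norm_apply_le_frobenius D i i
      rwa [hD, diagonal_apply_eq] at this
    rw [RCLike.norm_ofReal, abs_of_pos (hpos i), ← hDeq, frobenius_norm_mul_isometry h2,
      frobenius_norm_isometry_mul (by simpa using h2)] at h3
    calc h i ≤ ‖gᴴ * g‖ := h3
      _ ≤ ‖gᴴ‖ * ‖g‖ := frobenius_norm_mul _ _
      _ = ‖g‖ ^ 2 := by rw [frobenius_norm_conjTranspose, sq]
      _ ≤ K := hg
  have hbound2 : ∀ i, (h i)⁻¹ ≤ K := by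
    intro i
    have h4 : ‖E i i‖ = (h i)⁻¹ := by
      have := congrArg norm (hDEi i)
      rw [norm_mul, RCLike.norm_ofReal, abs_of_pos (hpos i), norm_one] at this
      exact eq_inv_of_mul_eq_one_right this
    have h3 := norm_apply_le_frobenius E i i
    rw [h4, hE, frobenius_norm_mul_isometry h2,
      frobenius_norm_isometry_mul (by simpa using h2)] at h3
    calc (h i)⁻¹ ≤ ‖g' * g'ᴴ‖ := h3
      _ ≤ ‖g'‖ * ‖g'ᴴ‖ := frobenius_norm_mul _ _
      _ = ‖g'‖ ^ 2 := by rw [frobenius_norm_conjTranspose, sq]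
      _ ≤ K := hg'
  have hexp : ∀ i, Real.exp (-2 * (-Real.log (h i) / 2)) = h i := fun i => by
    rw [show -2 * (-Real.log (h i) / 2) = Real.log (h i) by ring, Real.exp_log (hpos i)]
  have hexp' : ∀ i, Real.exp (2 * (-Real.log (h i) / 2)) = (h i)⁻¹ := fun i => by
    rw [show 2 * (-Real.log (h i) / 2) = -Real.log (h i) by ring, Real.exp_neg,
      Real.exp_log (hpos i)]
  refine ⟨U, fun i => -Real.log (h i) / 2, h1, h2, ?_, ?_, ?_⟩
  · simp only [hexp]; exact hH
  · simp only [hexp']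
    have h5 : E = diagonal (fun i => (((h i)⁻¹ : ℝ) : 𝕜)) := by
      have h6 : diagonal (fun i => (((h i)⁻¹ : ℝ) : 𝕜)) * D = 1 := by
        rw [hD, diagonal_mul_diagonal, ← diagonal_one]
        congr 1
        ext i
        rw [← RCLike.ofReal_mul, inv_mul_cancel₀ (hpos i).ne', RCLike.ofReal_one]
      exact (left_inv_eq_right_inv h6 hDE).symm
    rw [← h5, hE]
    calc g' * g'ᴴ = (U * Uᴴ) * (g' * g'ᴴ) * (U * Uᴴ) := by rw [h2]; simp
      _ = _ := by simp only [Matrix.mul_assoc]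
  · intro i
    have h3 := Real.log_le_log (hpos i) (hbound1 i)
    have h4 := Real.log_le_log (inv_pos.2 (hpos i)) (hbound2 i)
    rw [Real.log_inv] at h4
    rw [abs_le]
    constructor <;> linarith

theorem exists_exp_lower_bound (V : ℝ) : ∃ c : ℝ, 0 < c ∧ ∀ v : ℝ, |v| ≤ V →
    1 + v + c * v ^ 2 ≤ Real.exp v := by
  refine ⟨min (1 / 4) (1 / (2 * (|V| + 1))), by positivity, fun v hv => ?_⟩
  have hc1 := min_le_left (1 / 4) (1 / (2 * (|V| + 1)))
  have hc2 := min_le_right (1 / 4) (1 / (2 * (|V| + 1)))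
  set c := min (1 / 4) (1 / (2 * (|V| + 1)))
  rcases le_or_gt (-2) v with h | h
  · have h1 := Real.add_one_le_exp (v / 2)
    have h2 : (v / 2 + 1) ^ 2 ≤ Real.exp (v / 2) ^ 2 := pow_le_pow_left₀ (by linarith) h1 2
    rw [← Real.exp_nat_mul] at h2
    have h3 : ((2 : ℕ) : ℝ) * (v / 2) = v := by push_cast; ring
    rw [h3] at h2
    nlinarith [sq_nonneg v]
  · have h1 := Real.exp_pos v
    have h2 : |v| = -v := abs_of_neg (by linarith)
    have h3 : -v ≤ |V| + 1 := by rw [← h2]; exact (hv.trans (le_abs_self V)).trans (by linarith)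
    have h4 : c * v ^ 2 ≤ -v / 2 := by
      calc c * v ^ 2 ≤ 1 / (2 * (|V| + 1)) * v ^ 2 := mul_le_mul_of_nonneg_right hc2 (sq_nonneg v)
        _ ≤ 1 / (2 * (|V| + 1)) * ((-v) * (|V| + 1)) := by
            apply mul_le_mul_of_nonneg_left _ (by positivity); nlinarith
        _ = -v / 2 := by field_simp
    linarith

end Spectral

section RealSpectral

open Matrix
open scoped Matrix.Norms.Frobenius ComplexOrder

/-- The total departure from normality of the matrices `x s`, `s ∈ S`. -/
noncomputable def defect {Γ : Type*} (S : Finset Γ) {n : ℕ}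
    (x : Γ → Matrix (Fin n) (Fin n) ℝ) : ℝ :=
  ∑ s ∈ S, (‖x s‖ ^ 2 - eigSq ((x s).map Complex.ofReal))

theorem frobenius_norm_map_ofReal {n : ℕ} (A : Matrix (Fin n) (Fin n) ℝ) :
    ‖A.map Complex.ofReal‖ = ‖A‖ :=
  frobenius_norm_map_eq A _ Complex.norm_real

theorem frobenius_norm_sq_map_re_le {n : ℕ} (A : Matrix (Fin n) (Fin n) ℂ) :
    ‖A.map Complex.re‖ ^ 2 ≤ ‖A‖ ^ 2 := by
  rw [frobenius_norm_sq, frobenius_norm_sq]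
  refine Finset.sum_le_sum fun i _ => Finset.sum_le_sum fun j _ => ?_
  rw [map_apply, Real.norm_eq_abs]
  exact pow_le_pow_left₀ (abs_nonneg _) (Complex.abs_re_le_norm _) 2

theorem map_re_mul_ofReal {n : ℕ} (A : Matrix (Fin n) (Fin n) ℂ) (X : Matrix (Fin n) (Fin n) ℝ) :
    (A * X.map Complex.ofReal).map Complex.re = A.map Complex.re * X := by
  ext i j
  simp [mul_apply]

theorem map_re_ofReal_mul {n : ℕ} (A : Matrix (Fin n) (Fin n) ℂ) (X : Matrix (Fin n) (Fin n) ℝ) :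
    (X.map Complex.ofReal * A).map Complex.re = X * A.map Complex.re := by
  ext i j
  simp [mul_apply]

theorem exists_gradient_bound {Γ : Type*} [Group Γ] {Γ₀ : Subgroup Γ} [Γ₀.Normal]
    [Fintype (Γ ⧸ Γ₀)] {S : Finset Γ} (hout : ∀ q : Γ ⧸ Γ₀, q.out ∈ S)
    (hinv : ∀ s ∈ S, s⁻¹ ∈ S) {n : ℕ}
    (hsc : ∀ d ≤ n, ∀ x : Γ →* Matrix (Fin d) (Fin d) ℂ, IsIrrRep x →
      ∀ γ ∈ Γ₀, ∃ c : ℂ, x γ = c • 1) (R : ℝ) :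
    ∃ T c : ℝ, 0 < T ∧ 0 < c ∧ ∀ x : Γ →* Matrix (Fin n) (Fin n) ℝ,
      (∀ s ∈ S, ‖x s‖ ^ 2 ≤ R) → ∃ η : Matrix (Fin n) (Fin n) ℝ, ηᵀ = η ∧ ‖η‖ ^ 2 ≤ T ∧
        defect S x / 4 + c * ∑ s ∈ S, ‖η * x s - x s * η‖ ^ 2 ≤
          ∑ s ∈ S, ((x s)ᵀ * (η * x s - x s * η)).trace := by
  obtain ⟨K, hK⟩ := exists_conj_halving hout hinv hsc R n le_rfl
  obtain ⟨c, hc, hexp⟩ := exists_exp_lower_bound (2 * |Real.log K|)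
  refine ⟨n * (Real.log K / 2) ^ 2 + 1, 2 * c, by positivity, by positivity, fun x hx => ?_⟩
  set z : Γ →* Matrix (Fin n) (Fin n) ℂ :=
    (Complex.ofRealHom.mapMatrix : Matrix (Fin n) (Fin n) ℝ →+* _).toMonoidHom.comp x with hz
  have hzx : ∀ s, z s = (x s).map Complex.ofReal := fun s => rfl
  obtain ⟨g, g', h1, h2, hg, hg', hhalf⟩ := hK z fun s hs => by
    rw [hzx, frobenius_norm_map_ofReal]; exact hx s hs
  obtain ⟨U, a, hU, hU', hga, hga', ha⟩ := exists_diagonalization_gram h1 hg hg'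
  set A : Matrix (Fin n) (Fin n) ℂ := U * diagonal (fun i => (a i : ℂ)) * Uᴴ with hA
  have hAherm : Aᴴ = A := by
    rw [hA]
    simp only [conjTranspose_mul, conjTranspose_conjTranspose, Matrix.mul_assoc,
      diagonal_conjTranspose]
    congr 3
    ext i
    simp
  have hAnorm : ‖A‖ ^ 2 ≤ n * (Real.log K / 2) ^ 2 := by
    rw [hA, frobenius_norm_mul_isometry (by simpa using hU), frobenius_norm_isometry_mul hU,
      frobenius_norm_sq]
    have : ∀ i : Fin n, ∑ j, ‖diagonal (fun i => (a i : ℂ)) i j‖ ^ 2 ≤ (Real.log K / 2) ^ 2 := by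
      intro i
      rw [Finset.sum_eq_single i (fun j _ hj => by simp [diagonal_apply_ne' _ hj]) (by simp),
        diagonal_apply_eq, Complex.norm_real, Real.norm_eq_abs]
      exact pow_le_pow_left₀ (abs_nonneg _) (ha i) 2
    calc _ ≤ ∑ _i : Fin n, (Real.log K / 2) ^ 2 := Finset.sum_le_sum fun i _ => this i
      _ = _ := by simp
  have hη : ∀ X : Matrix (Fin n) (Fin n) ℝ, (A * X.map Complex.ofReal - X.map Complex.ofReal * A).map
      Complex.re = A.map Complex.re * X - X * A.map Complex.re := by
    intro X
    rw [← map_re_mul_ofReal, ← map_re_ofReal_mul]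
    ext i j
    simp
  have hη2 : ∀ X : Matrix (Fin n) (Fin n) ℝ, (Xᵀ * (A.map Complex.re * X - X * A.map Complex.re)).trace
      = RCLike.re ((X.map Complex.ofReal)ᴴ *
        (A * X.map Complex.ofReal - X.map Complex.ofReal * A)).trace := by
    intro X
    have h3 : (X.map Complex.ofReal)ᴴ = Xᵀ.map Complex.ofReal := by
      ext i j; simp
    rw [← hη, ← map_re_ofReal_mul, h3, trace, trace]
    simp [map_sum]
  refine ⟨A.map Complex.re, ?_, ?_, ?_⟩
  · ext i j
    have := congrFun (congrFun hAherm i) j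
    rw [transpose_apply, map_apply, map_apply, ← this, conjTranspose_apply]
    simp
  · exact (frobenius_norm_sq_map_re_le A).trans (by linarith)
  · have key : ∀ s, ‖x s‖ ^ 2 - 2 * ((x s)ᵀ * (A.map Complex.re * x s - x s * A.map Complex.re)).trace
        + 4 * c * ‖A.map Complex.re * x s - x s * A.map Complex.re‖ ^ 2 ≤ ‖g * z s * g'‖ ^ 2 := by
      intro s
      have h4 : ‖A.map Complex.re * x s - x s * A.map Complex.re‖ ^ 2 ≤
          ‖A * z s - z s * A‖ ^ 2 := by
        rw [← hη]; exact frobenius_norm_sq_map_re_le _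
      have h5 : 4 * c * ‖A.map Complex.re * x s - x s * A.map Complex.re‖ ^ 2 ≤
          4 * c * ‖A * z s - z s * A‖ ^ 2 := mul_le_mul_of_nonneg_left h4 (by positivity)
      refine (add_le_add_right h5 _).trans ?_
      rw [hη2, ← frobenius_norm_map_ofReal, ← hzx,
        norm_sq_conj_diagonalized hga hga', norm_sq_commutator_diagonalized hU hU' hA,
        trace_commutator_diagonalized hU' hA, norm_sq_diagonalized hU',
        Finset.mul_sum, Finset.mul_sum, ← Finset.sum_sub_distrib, ← Finset.sum_add_distrib]
      refine Finset.sum_le_sum fun i _ => ?_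
      rw [Finset.mul_sum, Finset.mul_sum, ← Finset.sum_sub_distrib, ← Finset.sum_add_distrib]
      refine Finset.sum_le_sum fun j _ => ?_
      have h6 := hexp (-2 * (a i - a j)) (by
        have h7 := (ha i).trans (div_le_div_of_nonneg_right (le_abs_self (Real.log K)) two_pos.le)
        have h8 := (ha j).trans (div_le_div_of_nonneg_right (le_abs_self (Real.log K)) two_pos.le)
        rw [abs_le] at h7 h8 ⊢
        constructor <;> linarith [abs_nonneg (Real.log K)])
      have h9 := mul_le_mul_of_nonneg_left h6 (sq_nonneg ‖(Uᴴ * z s * U) i j‖)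
      linarith
    have hsum := Finset.sum_le_sum fun s (_ : s ∈ S) => key s
    simp only [Finset.sum_add_distrib, Finset.sum_sub_distrib, ← Finset.mul_sum] at hsum
    simp only [Finset.sum_sub_distrib] at hhalf
    simp only [hzx, frobenius_norm_map_ofReal] at hhalf hsum
    rw [defect, Finset.sum_sub_distrib]
    linarith

end RealSpectral

section Descent

open Matrix
open scoped Matrix.Norms.Frobenius ComplexOrder

variable {Γ : Type*} {S : Finset Γ} {n : ℕ}

theorem eigSq_map_ofReal_le (A : Matrix (Fin n) (Fin n) ℝ) :
    eigSq (A.map Complex.ofReal) ≤ ‖A‖ ^ 2 := by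
  rw [← frobenius_norm_map_ofReal]
  exact (eigSq_le_and_normal _).1

theorem transpose_mul_comm_of_norm_sq_eq {A : Matrix (Fin n) (Fin n) ℝ}
    (h : ‖A‖ ^ 2 = eigSq (A.map Complex.ofReal)) : Aᵀ * A = A * Aᵀ := by
  rw [← frobenius_norm_map_ofReal] at h
  have h1 := (eigSq_le_and_normal _).2 h
  have h2 : (A.map Complex.ofReal)ᴴ = Aᵀ.map Complex.ofReal := by
    ext i j; simp
  rw [h2] at h1
  apply Matrix.map_injective Complex.ofReal_injective
  have h3 : ∀ B C : Matrix (Fin n) (Fin n) ℝ,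
      (B * C).map Complex.ofReal = B.map Complex.ofReal * C.map Complex.ofReal := fun B C =>
    Matrix.map_mul (f := Complex.ofRealHom)
  exact (h3 _ _).trans (h1.trans (h3 _ _).symm)

theorem defect_nonneg (x : Γ → Matrix (Fin n) (Fin n) ℝ) : 0 ≤ defect S x :=
  Finset.sum_nonneg fun _ _ => sub_nonneg.2 (eigSq_map_ofReal_le _)

theorem transpose_mul_comm_of_defect_eq_zero {x : Γ → Matrix (Fin n) (Fin n) ℝ}
    (h : defect S x = 0) {s : Γ} (hs : s ∈ S) : (x s)ᵀ * x s = x s * (x s)ᵀ :=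
  transpose_mul_comm_of_norm_sq_eq <| sub_eq_zero.1 <|
    (Finset.sum_eq_zero_iff_of_nonneg fun _ _ => sub_nonneg.2 (eigSq_map_ofReal_le _)).1 h s hs

/-- The moment map of the conjugation action on tuples of matrices. -/
noncomputable def moment (S : Finset Γ) (x : Γ → Matrix (Fin n) (Fin n) ℝ) :
    Matrix (Fin n) (Fin n) ℝ :=
  ∑ s ∈ S, (x s * (x s)ᵀ - (x s)ᵀ * x s)

theorem transpose_moment (x : Γ → Matrix (Fin n) (Fin n) ℝ) : (moment S x)ᵀ = moment S x := by
  simp [moment, transpose_sum]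

theorem sum_trace_commutator (x : Γ → Matrix (Fin n) (Fin n) ℝ) (ξ : Matrix (Fin n) (Fin n) ℝ) :
    ∑ s ∈ S, ((x s)ᵀ * (ξ * x s - x s * ξ)).trace = (moment S x * ξ).trace := by
  rw [moment, Matrix.sum_mul, trace_sum]
  refine Finset.sum_congr rfl fun s _ => ?_
  rw [Matrix.mul_sub, Matrix.sub_mul, trace_sub, trace_sub, ← Matrix.mul_assoc, trace_mul_comm,
    ← Matrix.mul_assoc, ← Matrix.mul_assoc]

theorem abs_trace_mul_le (A B : Matrix (Fin n) (Fin n) ℝ) : |(A * B).trace| ≤ ‖A‖ * ‖B‖ := by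
  rw [← Real.sqrt_sq (norm_nonneg A), ← Real.sqrt_sq (norm_nonneg B), ← Real.sqrt_mul (sq_nonneg _)]
  refine Real.abs_le_sqrt ?_
  rw [← frobenius_norm_transpose B, frobenius_norm_sq, frobenius_norm_sq, trace]
  simp only [diag_apply, mul_apply]
  rw [← Finset.univ.sum_product' Finset.univ (fun i j => A i j * B j i),
    ← Finset.univ.sum_product' Finset.univ (fun i j => ‖A i j‖ ^ 2),
    ← Finset.univ.sum_product' Finset.univ (fun i j => ‖Bᵀ i j‖ ^ 2)]
  refine (Finset.sum_mul_sq_le_sq_mul_sq _ _ _).trans_eq ?_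
  simp

theorem trace_transpose_mul_self (A : Matrix (Fin n) (Fin n) ℝ) : (Aᵀ * A).trace = ‖A‖ ^ 2 := by
  rw [frobenius_norm_sq_eq_trace, conjTranspose_eq_transpose_of_trivial]
  rfl

theorem exists_diagonalization_exp {ξ : Matrix (Fin n) (Fin n) ℝ} (hξ : ξᵀ = ξ) :
    ∃ (U : Matrix (Fin n) (Fin n) ℝ) (a : Fin n → ℝ), Uᴴ * U = 1 ∧ U * Uᴴ = 1 ∧
      ξ = U * diagonal (fun i => ((a i : ℝ) : ℝ)) * Uᴴ ∧ (∀ i, |a i| ≤ ‖ξ‖) ∧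
      ∀ t : ℝ, NormedSpace.exp (t • ξ) = U * diagonal (fun i => Real.exp (t * a i)) * Uᴴ := by
  obtain ⟨U, a, h1, h2, h3⟩ := IsHermitian.exists_diagonalization (A := ξ)
    (by rw [IsHermitian, conjTranspose_eq_transpose_of_trivial, hξ])
  refine ⟨U, a, h1, h2, h3, fun i => ?_, fun t => ?_⟩
  · have h4 : ‖ξ‖ = ‖diagonal (fun i => ((a i : ℝ) : ℝ))‖ := by
      rw [h3]
      erw [frobenius_norm_mul_isometry (by simpa using h1), frobenius_norm_isometry_mul h1]
      rfl
    rw [h4]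
    have := norm_apply_le_frobenius (diagonal (fun i => ((a i : ℝ) : ℝ))) i i
    rwa [diagonal_apply_eq] at this
  · have hU : IsUnit U := IsUnit.of_mul_eq_one _ h2
    have hinv : Uᴴ = U⁻¹ := (inv_eq_right_inv h2).symm
    have h5 : t • ξ = U * diagonal (fun i => t * a i) * U⁻¹ := by
      rw [h3, hinv, ← Matrix.smul_mul, ← Matrix.mul_smul]
      congr 2
      ext i j
      by_cases hij : i = j
      · subst hij; simp
      · simp [hij]
    rw [h5, exp_conj _ _ hU, exp_diagonal, hinv]
    congr 3
    ext i
    rw [Pi.coe_exp, Real.exp_eq_exp_ℝ]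

theorem exp_conj_step {ξ : Matrix (Fin n) (Fin n) ℝ} (hξ : ξᵀ = ξ) (hle : ‖ξ‖ ≤ 1 / 4)
    (X : Matrix (Fin n) (Fin n) ℝ) :
    ‖NormedSpace.exp (-ξ) * X * NormedSpace.exp ξ‖ ^ 2 ≤
      ‖X‖ ^ 2 - 2 * (Xᵀ * (ξ * X - X * ξ)).trace + 4 * ‖ξ * X - X * ξ‖ ^ 2 ∧
    ‖NormedSpace.exp (-ξ) * X * NormedSpace.exp ξ - X‖ ^ 2 ≤ 4 * ‖ξ * X - X * ξ‖ ^ 2 := by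
  obtain ⟨U, a, h1, h2, h3, ha, hexp⟩ := exists_diagonalization_exp hξ
  have he := hexp 1
  have he' := hexp (-1)
  simp only [one_smul, neg_smul, one_mul, neg_mul] at he he'
  have hv : ∀ i j, |a i - a j| ≤ 1 / 2 := fun i j => by
    have h4 := (ha i).trans hle
    have h5 := (ha j).trans hle
    rw [abs_le] at h4 h5 ⊢
    constructor <;> linarith
  have hcomm := norm_sq_commutator_diagonalized h1 h2 h3 X
  constructor
  · have hg : (NormedSpace.exp (-ξ))ᴴ * NormedSpace.exp (-ξ) =
        U * diagonal (fun i => ((Real.exp (-2 * a i) : ℝ) : ℝ)) * Uᴴ := by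
      rw [← Matrix.exp_conjTranspose, conjTranspose_eq_transpose_of_trivial, transpose_neg, hξ,
        ← Matrix.exp_add_of_commute _ _ (Commute.refl _), ← hexp]
      congr 1
      rw [neg_smul, two_smul, neg_add]
    have hg' : NormedSpace.exp ξ * (NormedSpace.exp ξ)ᴴ =
        U * diagonal (fun i => ((Real.exp (2 * a i) : ℝ) : ℝ)) * Uᴴ := by
      rw [← Matrix.exp_conjTranspose, conjTranspose_eq_transpose_of_trivial, hξ,
        ← Matrix.exp_add_of_commute _ _ (Commute.refl _), ← hexp, two_smul]
    have htr := trace_commutator_diagonalized h2 h3 X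
    rw [conjTranspose_eq_transpose_of_trivial] at htr
    rw [norm_sq_conj_diagonalized hg hg', hcomm, norm_sq_diagonalized h2 X]
    change _ ≤ _ - 2 * RCLike.re (Xᵀ * (ξ * X - X * ξ)).trace + _
    rw [htr, Finset.mul_sum, Finset.mul_sum, ← Finset.sum_sub_distrib, ← Finset.sum_add_distrib]
    refine Finset.sum_le_sum fun i _ => ?_
    rw [Finset.mul_sum, Finset.mul_sum, ← Finset.sum_sub_distrib, ← Finset.sum_add_distrib]
    refine Finset.sum_le_sum fun j _ => ?_
    have h6 := Real.abs_exp_sub_one_sub_id_le (x := -2 * (a i - a j)) (by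
      rw [abs_mul]; norm_num; linarith [hv i j])
    have h7 := (abs_le.1 h6).2
    have h9 := mul_le_mul_of_nonneg_left h7 (sq_nonneg ‖(Uᴴ * X * U) i j‖)
    linarith
  · rw [hcomm]
    have h4 : NormedSpace.exp (-ξ) * X * NormedSpace.exp ξ - X =
        U * (of fun i j => (Real.exp (a j - a i) - 1) * (Uᴴ * X * U) i j) * Uᴴ := by
      have h5 : (of fun i j => (Real.exp (a j - a i) - 1) * (Uᴴ * X * U) i j) =
          diagonal (fun i => Real.exp (-a i)) * (Uᴴ * X * U) * diagonal (fun i => Real.exp (a i)) -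
            Uᴴ * X * U := by
        ext i j
        simp only [of_apply, Matrix.sub_apply, diagonal_mul, mul_diagonal]
        rw [sub_eq_neg_add (a j), Real.exp_add]
        ring
      rw [h5, he, he', Matrix.mul_sub, Matrix.sub_mul]
      have h6 : U * (Uᴴ * X * U) * Uᴴ = X := by
        calc _ = (U * Uᴴ) * X * (U * Uᴴ) := by simp only [Matrix.mul_assoc]
          _ = X := by rw [h2]; simp
      rw [h6]
      simp only [Matrix.mul_assoc]
    rw [h4, frobenius_norm_mul_isometry (by simpa using h1), frobenius_norm_isometry_mul h1,
      frobenius_norm_sq, Finset.mul_sum]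
    refine Finset.sum_le_sum fun i _ => ?_
    rw [Finset.mul_sum]
    refine Finset.sum_le_sum fun j _ => ?_
    rw [of_apply, norm_mul, mul_pow, Real.norm_eq_abs]
    have h7 := Real.abs_exp_sub_one_le (x := a j - a i) (by linarith [hv j i])
    have h8 := pow_le_pow_left₀ (abs_nonneg _) h7 2
    rw [mul_pow, sq_abs (a j - a i)] at h8
    have h9 := mul_le_mul_of_nonneg_left h8 (sq_nonneg ‖(Uᴴ * X * U) i j‖)
    linarith

end Descent

section Ridge

open Matrix
open scoped Matrix.Norms.Frobenius

variable {Γ : Type*} {S : Finset Γ} {n : ℕ}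

/-- The symmetric part of a matrix. -/
noncomputable def symPart (n : ℕ) : Matrix (Fin n) (Fin n) ℝ →ₗ[ℝ] Matrix (Fin n) (Fin n) ℝ :=
  (1 / 2 : ℝ) • (LinearMap.id + (transposeLinearEquiv (Fin n) (Fin n) ℝ ℝ).toLinearMap)

/-- The commutator `ξ ↦ ξ * X - X * ξ`. -/
noncomputable def commRight (X : Matrix (Fin n) (Fin n) ℝ) :
    Matrix (Fin n) (Fin n) ℝ →ₗ[ℝ] Matrix (Fin n) (Fin n) ℝ :=
  LinearMap.mulRight ℝ X - LinearMap.mulLeft ℝ X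

theorem symPart_apply (ξ : Matrix (Fin n) (Fin n) ℝ) :
    symPart n ξ = (1 / 2 : ℝ) • (ξ + ξᵀ) := rfl

theorem commRight_apply (X ξ : Matrix (Fin n) (Fin n) ℝ) : commRight X ξ = ξ * X - X * ξ := rfl

theorem transpose_symPart (ξ : Matrix (Fin n) (Fin n) ℝ) : (symPart n ξ)ᵀ = symPart n ξ := by
  rw [symPart_apply, transpose_smul, transpose_add, transpose_transpose, add_comm]

theorem symPart_eq_self {ξ : Matrix (Fin n) (Fin n) ℝ} (h : ξᵀ = ξ) : symPart n ξ = ξ := by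
  rw [symPart_apply, h, ← two_smul ℝ, smul_smul]
  norm_num

theorem trace_transpose_mul_symPart (η ξ : Matrix (Fin n) (Fin n) ℝ) :
    (ηᵀ * symPart n ξ).trace = ((symPart n η)ᵀ * ξ).trace := by
  rw [transpose_symPart, symPart_apply, symPart_apply, Matrix.mul_smul, Matrix.smul_mul,
    trace_smul, trace_smul, Matrix.mul_add, Matrix.add_mul, trace_add, trace_add, add_comm]
  congr 2
  rw [← trace_transpose, transpose_mul, transpose_transpose, transpose_transpose, trace_mul_comm]

theorem trace_transpose_mul_commRight (η ξ X : Matrix (Fin n) (Fin n) ℝ) :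
    (ηᵀ * commRight Xᵀ ξ).trace = ((commRight X η)ᵀ * ξ).trace := by
  simp only [commRight_apply, transpose_sub, transpose_mul, Matrix.sub_mul, Matrix.mul_sub,
    trace_sub]
  congr 1
  · rw [← Matrix.mul_assoc, trace_mul_comm, Matrix.mul_assoc]
  · rw [Matrix.mul_assoc]

/-- The regularized normal operator, whose solution gives the descent direction. -/
noncomputable def ridgeOp (S : Finset Γ) (x : Γ → Matrix (Fin n) (Fin n) ℝ) :
    Matrix (Fin n) (Fin n) ℝ →ₗ[ℝ] Matrix (Fin n) (Fin n) ℝ :=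
  symPart n ∘ₗ (∑ s ∈ S, commRight (x s)ᵀ ∘ₗ commRight (x s)) ∘ₗ symPart n +
    ‖moment S x‖ ^ 2 • LinearMap.id

theorem ridgeOp_apply (x : Γ → Matrix (Fin n) (Fin n) ℝ) (ξ : Matrix (Fin n) (Fin n) ℝ) :
    ridgeOp S x ξ = symPart n (∑ s ∈ S, commRight (x s)ᵀ (commRight (x s) (symPart n ξ))) +
      ‖moment S x‖ ^ 2 • ξ := by
  simp [ridgeOp]

theorem trace_transpose_mul_ridgeOp (x : Γ → Matrix (Fin n) (Fin n) ℝ)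
    (η ξ : Matrix (Fin n) (Fin n) ℝ) : (ηᵀ * ridgeOp S x ξ).trace =
      ∑ s ∈ S, ((commRight (x s) (symPart n η))ᵀ * commRight (x s) (symPart n ξ)).trace +
        ‖moment S x‖ ^ 2 * (ηᵀ * ξ).trace := by
  rw [ridgeOp_apply, Matrix.mul_add, trace_add, trace_transpose_mul_symPart, Matrix.mul_sum,
    trace_sum, Matrix.mul_smul, trace_smul, smul_eq_mul]
  simp only [trace_transpose_mul_commRight]

theorem norm_le_norm_ridgeOp (x : Γ → Matrix (Fin n) (Fin n) ℝ) (ξ : Matrix (Fin n) (Fin n) ℝ) :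
    ‖moment S x‖ ^ 2 * ‖ξ‖ ≤ ‖ridgeOp S x ξ‖ := by
  rcases (norm_nonneg ξ).eq_or_lt with h | h
  · rw [← h, mul_zero]; exact norm_nonneg _
  have h1 := trace_transpose_mul_ridgeOp (S := S) x ξ ξ
  have h2 := (le_abs_self _).trans (abs_trace_mul_le ξᵀ (ridgeOp S x ξ))
  rw [frobenius_norm_transpose, h1, trace_transpose_mul_self] at h2
  have h3 : 0 ≤ ∑ s ∈ S,
      ((commRight (x s) (symPart n ξ))ᵀ * commRight (x s) (symPart n ξ)).trace :=
    Finset.sum_nonneg fun s _ => by rw [trace_transpose_mul_self]; positivity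
  refine le_of_mul_le_mul_left ?_ h
  nlinarith

theorem ridgeOp_surjective {x : Γ → Matrix (Fin n) (Fin n) ℝ} (h : moment S x ≠ 0) :
    Function.Surjective (ridgeOp S x) := by
  refine LinearMap.injective_iff_surjective.1 ?_
  rw [injective_iff_map_eq_zero]
  intro ξ hξ
  have h1 := norm_le_norm_ridgeOp (S := S) x ξ
  rw [hξ, norm_zero] at h1
  have h2 : 0 < ‖moment S x‖ ^ 2 := by positivity
  exact norm_le_zero_iff.1 (by nlinarith)

open Classical in
/-- The descent direction at the tuple `x`. -/
noncomputable def ridgeSol (S : Finset Γ) (x : Γ → Matrix (Fin n) (Fin n) ℝ) :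
    Matrix (Fin n) (Fin n) ℝ :=
  if moment S x = 0 then 0 else Function.invFun (ridgeOp S x) (moment S x)

theorem ridgeOp_ridgeSol (x : Γ → Matrix (Fin n) (Fin n) ℝ) :
    ridgeOp S x (ridgeSol S x) = moment S x := by
  by_cases h : moment S x = 0
  · rw [ridgeSol, if_pos h, map_zero, h]
  · rw [ridgeSol, if_neg h]
    exact Function.invFun_eq (ridgeOp_surjective h _)

theorem ridgeSol_eq_zero {x : Γ → Matrix (Fin n) (Fin n) ℝ} (h : moment S x = 0) :
    ridgeSol S x = 0 := if_pos h

theorem transpose_ridgeSol (x : Γ → Matrix (Fin n) (Fin n) ℝ) :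
    (ridgeSol S x)ᵀ = ridgeSol S x := by
  by_cases h : moment S x = 0
  · rw [ridgeSol_eq_zero h, transpose_zero]
  have h1 := ridgeOp_ridgeSol (S := S) x
  rw [ridgeOp_apply] at h1
  have h2 := eq_sub_of_add_eq' h1
  have h3 : (‖moment S x‖ ^ 2 • ridgeSol S x)ᵀ = ‖moment S x‖ ^ 2 • ridgeSol S x := by
    rw [h2, transpose_sub, transpose_moment, transpose_symPart]
  rw [transpose_smul] at h3
  exact smul_right_injective _ (by positivity : ‖moment S x‖ ^ 2 ≠ 0) h3

theorem trace_moment_mul (x : Γ → Matrix (Fin n) (Fin n) ℝ) {η : Matrix (Fin n) (Fin n) ℝ}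
    (hη : ηᵀ = η) : (moment S x * η).trace =
      ∑ s ∈ S, ((η * x s - x s * η)ᵀ * (ridgeSol S x * x s - x s * ridgeSol S x)).trace +
        ‖moment S x‖ ^ 2 * (ηᵀ * ridgeSol S x).trace := by
  have h := trace_transpose_mul_ridgeOp (S := S) x η (ridgeSol S x)
  rw [ridgeOp_ridgeSol, hη, trace_mul_comm, symPart_eq_self hη,
    symPart_eq_self (transpose_ridgeSol x)] at h
  rw [h, hη]
  rfl

theorem trace_moment_mul_ridgeSol (x : Γ → Matrix (Fin n) (Fin n) ℝ) :
    (moment S x * ridgeSol S x).trace =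
      ∑ s ∈ S, ‖ridgeSol S x * x s - x s * ridgeSol S x‖ ^ 2 +
        ‖moment S x‖ ^ 2 * ‖ridgeSol S x‖ ^ 2 := by
  rw [trace_moment_mul x (transpose_ridgeSol x)]
  simp only [trace_transpose_mul_self]

theorem two_mul_trace_transpose_mul_le (A B : Matrix (Fin n) (Fin n) ℝ) (t : ℝ) :
    2 * t * (Bᵀ * A).trace ≤ ‖A‖ ^ 2 + t ^ 2 * ‖B‖ ^ 2 := by
  have h1 := (le_abs_self _).trans (abs_trace_mul_le Bᵀ A)
  have h2 := (neg_le_abs _).trans (abs_trace_mul_le Bᵀ A)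
  rw [frobenius_norm_transpose] at h1 h2
  rcases le_total 0 t with ht | ht
  · nlinarith [sq_nonneg (‖A‖ - t * ‖B‖)]
  · nlinarith [sq_nonneg (‖A‖ + t * ‖B‖)]

/-- The variational characterization of the descent direction. -/
theorem le_trace_moment_mul_ridgeSol (x : Γ → Matrix (Fin n) (Fin n) ℝ)
    {η : Matrix (Fin n) (Fin n) ℝ} (hη : ηᵀ = η) (t : ℝ) :
    2 * t * (moment S x * η).trace -
      t ^ 2 * (∑ s ∈ S, ‖η * x s - x s * η‖ ^ 2 + ‖moment S x‖ ^ 2 * ‖η‖ ^ 2) ≤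
        (moment S x * ridgeSol S x).trace := by
  rw [trace_moment_mul x hη, trace_moment_mul_ridgeSol]
  have h1 := Finset.sum_le_sum fun s (_ : s ∈ S) => two_mul_trace_transpose_mul_le
    (ridgeSol S x * x s - x s * ridgeSol S x) (η * x s - x s * η) t
  rw [← Finset.mul_sum, Finset.sum_add_distrib, ← Finset.mul_sum] at h1
  have h2 := mul_le_mul_of_nonneg_left (two_mul_trace_transpose_mul_le (ridgeSol S x) η t)
    (sq_nonneg ‖moment S x‖)
  linarith

theorem continuous_moment (S : Finset Γ) (n : ℕ) :
    Continuous (moment S : (Γ → Matrix (Fin n) (Fin n) ℝ) → _) := by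
  unfold moment
  fun_prop

theorem continuousAt_ridgeSol {x : Γ → Matrix (Fin n) (Fin n) ℝ} (h : moment S x ≠ 0) :
    ContinuousAt (ridgeSol S) x := by
  have hμ : Continuous fun y : Γ → Matrix (Fin n) (Fin n) ℝ => moment S y :=
    continuous_moment S n
  have h1 : Continuous fun y => ‖moment S y - ridgeOp S y (ridgeSol S x)‖ := by
    simp only [ridgeOp_apply, commRight_apply, symPart_apply]
    fun_prop
  have h2 : Filter.Tendsto (fun y => ‖moment S y - ridgeOp S y (ridgeSol S x)‖ /
      ‖moment S y‖ ^ 2) (nhds x) (nhds 0) := by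
    have h3 : ContinuousAt (fun y => ‖moment S y - ridgeOp S y (ridgeSol S x)‖ /
        ‖moment S y‖ ^ 2) x :=
      h1.continuousAt.div (hμ.norm.pow 2).continuousAt (by positivity)
    have h4 := h3.tendsto
    simpa only [ridgeOp_ridgeSol, sub_self, norm_zero, zero_div] using h4
  refine tendsto_iff_norm_sub_tendsto_zero.2 ?_
  refine squeeze_zero' (Filter.Eventually.of_forall fun _ => norm_nonneg _) ?_ h2
  filter_upwards [hμ.continuousAt.eventually_ne h] with y hy
  rw [le_div_iff₀ (by positivity), mul_comm]
  refine (norm_le_norm_ridgeOp y _).trans_eq ?_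
  rw [map_sub, ridgeOp_ridgeSol]

/-- Conjugation by an orthogonal matrix. -/
theorem mul_mul_transpose_mul {u : Matrix (Fin n) (Fin n) ℝ} (hu : uᵀ * u = 1)
    (A B : Matrix (Fin n) (Fin n) ℝ) : u * A * uᵀ * (u * B * uᵀ) = u * (A * B) * uᵀ := by
  calc _ = u * A * (uᵀ * u) * B * uᵀ := by simp only [Matrix.mul_assoc]
    _ = _ := by rw [hu, Matrix.mul_one, Matrix.mul_assoc u]

theorem transpose_mul_mul_transpose (u A : Matrix (Fin n) (Fin n) ℝ) :
    (u * A * uᵀ)ᵀ = u * Aᵀ * uᵀ := by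
  simp [Matrix.mul_assoc]

theorem frobenius_norm_orthogonal_conj {u : Matrix (Fin n) (Fin n) ℝ} (hu : uᵀ * u = 1)
    (A : Matrix (Fin n) (Fin n) ℝ) : ‖u * A * uᵀ‖ = ‖A‖ := by
  have h : uᴴ * u = 1 := by rwa [conjTranspose_eq_transpose_of_trivial]
  rw [frobenius_norm_mul_isometry, frobenius_norm_isometry_mul h]
  rw [conjTranspose_eq_transpose_of_trivial, transpose_transpose, hu]

variable {u : Matrix (Fin n) (Fin n) ℝ} {x y : Γ → Matrix (Fin n) (Fin n) ℝ}

theorem moment_orthogonal_conj (hu : uᵀ * u = 1) (hxy : ∀ s, y s = u * x s * uᵀ) :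
    moment S y = u * moment S x * uᵀ := by
  rw [moment, moment, Matrix.mul_sum, Matrix.sum_mul]
  refine Finset.sum_congr rfl fun s _ => ?_
  rw [hxy, transpose_mul_mul_transpose, mul_mul_transpose_mul hu, mul_mul_transpose_mul hu,
    Matrix.mul_sub, Matrix.sub_mul]

theorem symPart_orthogonal_conj (ξ : Matrix (Fin n) (Fin n) ℝ) :
    symPart n (u * ξ * uᵀ) = u * symPart n ξ * uᵀ := by
  rw [symPart_apply, symPart_apply, transpose_mul_mul_transpose, Matrix.mul_smul, Matrix.smul_mul,
    Matrix.mul_add, Matrix.add_mul]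

theorem commRight_orthogonal_conj (hu : uᵀ * u = 1) (X ξ : Matrix (Fin n) (Fin n) ℝ) :
    commRight (u * X * uᵀ) (u * ξ * uᵀ) = u * commRight X ξ * uᵀ := by
  rw [commRight_apply, commRight_apply, mul_mul_transpose_mul hu, mul_mul_transpose_mul hu,
    Matrix.mul_sub, Matrix.sub_mul]

theorem ridgeOp_orthogonal_conj (hu : uᵀ * u = 1) (hxy : ∀ s, y s = u * x s * uᵀ)
    (ξ : Matrix (Fin n) (Fin n) ℝ) :
    ridgeOp S y (u * ξ * uᵀ) = u * ridgeOp S x ξ * uᵀ := by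
  rw [ridgeOp_apply, ridgeOp_apply, moment_orthogonal_conj hu hxy,
    frobenius_norm_orthogonal_conj hu, Matrix.mul_add, Matrix.add_mul, Matrix.mul_smul,
    Matrix.smul_mul, ← symPart_orthogonal_conj, Matrix.mul_sum, Matrix.sum_mul]
  simp only [hxy, transpose_mul_mul_transpose, symPart_orthogonal_conj,
    commRight_orthogonal_conj hu]

theorem ridgeSol_orthogonal_conj (hu : uᵀ * u = 1) (hxy : ∀ s, y s = u * x s * uᵀ) :
    ridgeSol S y = u * ridgeSol S x * uᵀ := by
  have hμ := moment_orthogonal_conj (S := S) hu hxy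
  by_cases h : moment S x = 0
  · rw [ridgeSol_eq_zero h, ridgeSol_eq_zero (by rw [hμ, h]; simp)]
    simp
  · have hn : ‖moment S y‖ = ‖moment S x‖ := by rw [hμ, frobenius_norm_orthogonal_conj hu]
    have h1 := norm_le_norm_ridgeOp (S := S) y (ridgeSol S y - u * ridgeSol S x * uᵀ)
    rw [map_sub, ridgeOp_ridgeSol, ridgeOp_orthogonal_conj hu hxy, ridgeOp_ridgeSol, hμ, sub_self,
      norm_zero, frobenius_norm_orthogonal_conj hu] at h1
    have h2 : 0 < ‖moment S x‖ ^ 2 := by positivity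
    exact sub_eq_zero.1 (norm_le_zero_iff.1 (by nlinarith))

end Ridge

section Step

open Matrix
open scoped Matrix.Norms.Frobenius

variable {Γ : Type*} [Group Γ] {S : Finset Γ} {n : ℕ}

theorem exp_mul_exp_neg (ζ : Matrix (Fin n) (Fin n) ℝ) :
    NormedSpace.exp ζ * NormedSpace.exp (-ζ) = 1 := by
  rw [← Matrix.exp_add_of_commute _ _ (Commute.neg_right (Commute.refl ζ)), add_neg_cancel,
    NormedSpace.exp_zero]

/-- Conjugation of a representation by a matrix exponential. -/
noncomputable def conjExp (ζ : Matrix (Fin n) (Fin n) ℝ) (x : Γ →* Matrix (Fin n) (Fin n) ℝ) :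
    Γ →* Matrix (Fin n) (Fin n) ℝ where
  toFun γ := NormedSpace.exp (-ζ) * x γ * NormedSpace.exp ζ
  map_one' := by
    rw [map_one, Matrix.mul_one]
    simpa using exp_mul_exp_neg (-ζ)
  map_mul' γ δ := by
    rw [map_mul]
    calc _ = NormedSpace.exp (-ζ) * x γ * 1 * x δ * NormedSpace.exp ζ := by
          simp only [Matrix.mul_one, Matrix.mul_assoc]
      _ = _ := by rw [← exp_mul_exp_neg ζ]; simp only [Matrix.mul_assoc]

theorem conjExp_apply (ζ : Matrix (Fin n) (Fin n) ℝ) (x : Γ →* Matrix (Fin n) (Fin n) ℝ) (γ : Γ) :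
    conjExp ζ x γ = NormedSpace.exp (-ζ) * x γ * NormedSpace.exp ζ := rfl

theorem conjExp_zero (x : Γ →* Matrix (Fin n) (Fin n) ℝ) : conjExp 0 x = x := by
  ext1 γ
  rw [conjExp_apply, neg_zero, NormedSpace.exp_zero, Matrix.one_mul, Matrix.mul_one]

/-- The sum of the squared norms of the generators. -/
noncomputable def energy (S : Finset Γ) (x : Γ →* Matrix (Fin n) (Fin n) ℝ) : ℝ :=
  ∑ s ∈ S, ‖x s‖ ^ 2

theorem defect_le_energy (x : Γ →* Matrix (Fin n) (Fin n) ℝ) : defect S x ≤ energy S x :=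
  Finset.sum_le_sum fun _ _ => sub_le_self _ (eigSq_nonneg _)

theorem norm_sq_le_energy (x : Γ →* Matrix (Fin n) (Fin n) ℝ) {s : Γ} (hs : s ∈ S) :
    ‖x s‖ ^ 2 ≤ energy S x :=
  Finset.single_le_sum (f := fun s => ‖x s‖ ^ 2) (fun _ _ => sq_nonneg _) hs

theorem defect_sub_defect_conjExp (x : Γ →* Matrix (Fin n) (Fin n) ℝ)
    (ζ : Matrix (Fin n) (Fin n) ℝ) :
    defect S x - defect S (conjExp ζ x) = energy S x - energy S (conjExp ζ x) := by
  have h3 : ∀ B C : Matrix (Fin n) (Fin n) ℝ,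
      (B * C).map Complex.ofReal = B.map Complex.ofReal * C.map Complex.ofReal := fun B C =>
    Matrix.map_mul (f := Complex.ofRealHom)
  have h4 : (1 : Matrix (Fin n) (Fin n) ℝ).map Complex.ofReal = 1 :=
    Matrix.map_one _ Complex.ofReal_zero Complex.ofReal_one
  have h : ∀ s, eigSq ((conjExp ζ x s).map Complex.ofReal) = eigSq ((x s).map Complex.ofReal) := by
    intro s
    rw [conjExp_apply, h3, h3]
    apply eigSq_conj
    · rw [← h3, ← h4]
      congr 1
      simpa using exp_mul_exp_neg (-ζ)
    · rw [← h3, ← h4, exp_mul_exp_neg]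
  simp only [defect, energy, Finset.sum_sub_distrib, h]
  ring

theorem conjExp_bounds (x : Γ →* Matrix (Fin n) (Fin n) ℝ) {ξ : Matrix (Fin n) (Fin n) ℝ}
    (hξ : ξᵀ = ξ) {σ : ℝ} (hσ : ‖σ • ξ‖ ≤ 1 / 4) :
    2 * σ * (moment S x * ξ).trace - 4 * σ ^ 2 * ∑ s ∈ S, ‖ξ * x s - x s * ξ‖ ^ 2 ≤
      defect S x - defect S (conjExp (σ • ξ) x) ∧
    ∑ s ∈ S, ‖conjExp (σ • ξ) x s - x s‖ ^ 2 ≤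
      4 * σ ^ 2 * ∑ s ∈ S, ‖ξ * x s - x s * ξ‖ ^ 2 := by
  have hsymm : (σ • ξ)ᵀ = σ • ξ := by rw [transpose_smul, hξ]
  have hsm : ∀ s, (σ • ξ) * x s - x s * (σ • ξ) = σ • (ξ * x s - x s * ξ) := fun s => by
    rw [Matrix.smul_mul, Matrix.mul_smul, smul_sub]
  have hn : ∀ s, ‖(σ • ξ) * x s - x s * (σ • ξ)‖ ^ 2 = σ ^ 2 * ‖ξ * x s - x s * ξ‖ ^ 2 := fun s => by
    rw [hsm, norm_smul, mul_pow, Real.norm_eq_abs, sq_abs]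
  have h := fun s => exp_conj_step hsymm hσ (x s)
  simp only [hn] at h
  constructor
  · rw [defect_sub_defect_conjExp, ← sum_trace_commutator]
    have h1 := Finset.sum_le_sum fun s (_ : s ∈ S) => (h s).1
    have htr : ∀ s, ((x s)ᵀ * ((σ • ξ) * x s - x s * (σ • ξ))).trace =
        σ * ((x s)ᵀ * (ξ * x s - x s * ξ)).trace := fun s => by
      rw [hsm, Matrix.mul_smul, trace_smul, smul_eq_mul]
    simp only [htr, Finset.sum_add_distrib, Finset.sum_sub_distrib, ← Finset.mul_sum] at h1
    rw [energy, energy]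
    simp only [conjExp_apply]
    linarith
  · rw [Finset.mul_sum]
    refine Finset.sum_le_sum fun s _ => ?_
    rw [mul_assoc]
    exact (h s).2

/-- The quantitative statement that representations with small moment map are almost normal. -/
def HasGradientBound (S : Finset Γ) (n : ℕ) : Prop :=
  ∀ R : ℝ, ∃ T c : ℝ, 0 < T ∧ 0 < c ∧ ∀ x : Γ →* Matrix (Fin n) (Fin n) ℝ,
    (∀ s ∈ S, ‖x s‖ ^ 2 ≤ R) → ∃ η : Matrix (Fin n) (Fin n) ℝ, ηᵀ = η ∧ ‖η‖ ^ 2 ≤ T ∧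
      defect S x / 4 + c * ∑ s ∈ S, ‖η * x s - x s * η‖ ^ 2 ≤
        ∑ s ∈ S, ((x s)ᵀ * (η * x s - x s * η)).trace

theorem norm_sq_moment_le {x : Γ →* Matrix (Fin n) (Fin n) ℝ} {R : ℝ} (hx : energy S x ≤ R) :
    ‖moment S x‖ ^ 2 ≤ 16 * (R + 1) * defect S x := by
  have hR : 0 ≤ R := le_trans (Finset.sum_nonneg fun _ _ => sq_nonneg _) hx
  have h1 : ‖moment S x‖ ≤ 2 * R := by
    refine le_trans ?_ (mul_le_mul_of_nonneg_left hx two_pos.le)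
    rw [moment, energy, Finset.mul_sum]
    refine norm_sum_le_of_le _ fun s _ => ?_
    refine (norm_sub_le _ _).trans ?_
    have h2 := frobenius_norm_mul (x s) (x s)ᵀ
    have h3 := frobenius_norm_mul (x s)ᵀ (x s)
    rw [frobenius_norm_transpose] at h2 h3
    nlinarith
  have h2 : ∑ s ∈ S, ‖moment S x * x s - x s * moment S x‖ ^ 2 ≤ 4 * R * ‖moment S x‖ ^ 2 := by
    calc _ ≤ ∑ s ∈ S, 4 * ‖moment S x‖ ^ 2 * ‖x s‖ ^ 2 := by
          refine Finset.sum_le_sum fun s _ => ?_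
          have h3 : ‖moment S x * x s - x s * moment S x‖ ≤ 2 * (‖moment S x‖ * ‖x s‖) := by
            refine (norm_sub_le _ _).trans ?_
            have h4 := frobenius_norm_mul (moment S x) (x s)
            have h5 := frobenius_norm_mul (x s) (moment S x)
            linarith
          refine (pow_le_pow_left₀ (norm_nonneg _) h3 2).trans_eq (by ring)
      _ = 4 * ‖moment S x‖ ^ 2 * energy S x := by rw [energy, Finset.mul_sum]
      _ ≤ 4 * ‖moment S x‖ ^ 2 * R := mul_le_mul_of_nonneg_left hx (by positivity)
      _ = _ := by ring
  set σ := 1 / (16 * (R + 1)) with hσ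
  have hσ0 : 0 < σ := by positivity
  have hσR : σ * (16 * (R + 1)) = 1 := by rw [hσ]; field_simp
  have h3 := (conjExp_bounds (S := S) x (transpose_moment (S := S) x) (σ := σ) (by
    rw [norm_smul, Real.norm_eq_abs, abs_of_pos hσ0]; nlinarith)).1
  have h4 : (moment S x * moment S x).trace = ‖moment S x‖ ^ 2 := by
    rw [← trace_transpose_mul_self, transpose_moment]
  rw [h4] at h3
  have h5 := defect_nonneg (S := S) (conjExp (σ • moment S x) x)
  have h6 := mul_le_mul_of_nonneg_left h2 (by positivity : 0 ≤ 4 * σ ^ 2)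
  have h7 : σ * ‖moment S x‖ ^ 2 ≤ defect S x := by
    have h8 : 4 * σ ^ 2 * (4 * R * ‖moment S x‖ ^ 2) ≤ σ * ‖moment S x‖ ^ 2 := by
      have h9 : σ * (16 * R) ≤ 1 := by nlinarith
      have h10 : 0 ≤ σ * ‖moment S x‖ ^ 2 := by positivity
      nlinarith
    linarith
  calc ‖moment S x‖ ^ 2 = 16 * (R + 1) * (σ * ‖moment S x‖ ^ 2) := by
        rw [← mul_assoc, mul_comm _ σ, hσR, one_mul]
    _ ≤ _ := mul_le_mul_of_nonneg_left h7 (by positivity)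

/-- Lower bounds for the moment map and the squared gradient in terms of the defect. -/
theorem HasGradientBound.exists_bounds (hS : HasGradientBound S n) (R : ℝ) :
    ∃ T c : ℝ, 0 < T ∧ 0 < c ∧ ∀ x : Γ →* Matrix (Fin n) (Fin n) ℝ, energy S x ≤ R →
      defect S x ≤ T * ‖moment S x‖ ∧ c * defect S x ≤ (moment S x * ridgeSol S x).trace := by
  obtain ⟨T, c, hT, hc, h⟩ := hS R
  rcases lt_or_ge R 0 with hR | hR
  · exact ⟨1, 1, one_pos, one_pos, fun x hx =>
      absurd (le_trans (Finset.sum_nonneg fun _ _ => sq_nonneg _) hx) (not_le.2 hR)⟩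
  set t := min (2 * c) (1 / (64 * T * (R + 1))) with ht
  have ht0 : 0 < t := by positivity
  refine ⟨4 * Real.sqrt T, t / 4, by positivity, by positivity, fun x hx => ?_⟩
  obtain ⟨η, hη, hηT, hgrad⟩ := h x fun s hs => (norm_sq_le_energy x hs).trans hx
  rw [sum_trace_commutator] at hgrad
  have hm : 0 ≤ ∑ s ∈ S, ‖η * x s - x s * η‖ ^ 2 := Finset.sum_nonneg fun _ _ => sq_nonneg _
  have hΔ := defect_nonneg (S := S) x
  have hcm := mul_nonneg hc.le hm
  constructor
  · have h1 := (le_abs_self _).trans (abs_trace_mul_le (moment S x) η)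
    have h2 : ‖η‖ ≤ Real.sqrt T := Real.le_sqrt_of_sq_le hηT
    have h3 := mul_le_mul_of_nonneg_left h2 (norm_nonneg (moment S x))
    linarith
  · refine le_trans ?_ (le_trace_moment_mul_ridgeSol x hη t)
    set m := ∑ s ∈ S, ‖η * x s - x s * η‖ ^ 2
    have h1 : ‖moment S x‖ ^ 2 * ‖η‖ ^ 2 ≤ 16 * (R + 1) * defect S x * T :=
      mul_le_mul (norm_sq_moment_le hx) hηT (sq_nonneg _) (by positivity)
    have h2 : t * (64 * T * (R + 1)) ≤ 1 := by
      rw [← le_div_iff₀ (by positivity)]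
      exact min_le_right _ _
    have h3 : t * m ≤ 2 * c * m := mul_le_mul_of_nonneg_right (min_le_left _ _) hm
    have h4 : t * (t * m) ≤ t * (2 * c * m) := mul_le_mul_of_nonneg_left h3 ht0.le
    have h5 : t ^ 2 * (‖moment S x‖ ^ 2 * ‖η‖ ^ 2) ≤ t * (defect S x / 4) := by
      calc _ ≤ t ^ 2 * (16 * (R + 1) * defect S x * T) :=
            mul_le_mul_of_nonneg_left h1 (sq_nonneg _)
        _ = t * ((t * (64 * T * (R + 1))) * (defect S x / 4)) := by ring
        _ ≤ t * (1 * (defect S x / 4)) := by gcongr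
        _ = _ := by ring
    have h6 : t * (defect S x / 4 + c * m) ≤ t * (moment S x * η).trace :=
      mul_le_mul_of_nonneg_left hgrad ht0.le
    linarith

/-- The length of a full descent step, in units of `ridgeSol`. -/
noncomputable def stepScale (S : Finset Γ) (x : Γ →* Matrix (Fin n) (Fin n) ℝ) : ℝ :=
  1 / (4 * (1 + ‖ridgeSol S x‖))

/-- A descent step of relative length `θ`. -/
noncomputable def descStep (S : Finset Γ) (θ : ℝ) (x : Γ →* Matrix (Fin n) (Fin n) ℝ) :
    Γ →* Matrix (Fin n) (Fin n) ℝ :=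
  conjExp ((θ * stepScale S x) • ridgeSol S x) x

theorem descStep_zero (x : Γ →* Matrix (Fin n) (Fin n) ℝ) : descStep S 0 x = x := by
  rw [descStep, zero_mul, zero_smul, conjExp_zero]

theorem descStep_eq_self {x : Γ →* Matrix (Fin n) (Fin n) ℝ} (h : moment S x = 0) (θ : ℝ) :
    descStep S θ x = x := by
  rw [descStep, ridgeSol_eq_zero h, smul_zero, conjExp_zero]

theorem stepScale_pos (x : Γ →* Matrix (Fin n) (Fin n) ℝ) : 0 < stepScale S x := by
  rw [stepScale]; positivity

theorem stepScale_mul (x : Γ →* Matrix (Fin n) (Fin n) ℝ) :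
    stepScale S x * (4 * (1 + ‖ridgeSol S x‖)) = 1 := by
  rw [stepScale]; field_simp

theorem trace_moment_mul_ridgeSol_nonneg (x : Γ →* Matrix (Fin n) (Fin n) ℝ) :
    0 ≤ (moment S x * ridgeSol S x).trace := by
  rw [trace_moment_mul_ridgeSol]
  positivity

theorem descStep_bounds (x : Γ →* Matrix (Fin n) (Fin n) ℝ) {θ : ℝ} (h0 : 0 ≤ θ) (h1 : θ ≤ 1) :
    θ * stepScale S x * (moment S x * ridgeSol S x).trace ≤
      defect S x - defect S (descStep S θ x) ∧
    ∑ s ∈ S, ‖descStep S θ x s - x s‖ ^ 2 ≤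
      4 * (θ * stepScale S x) ^ 2 * (moment S x * ridgeSol S x).trace := by
  have hτ := stepScale_pos (S := S) x
  have hτ1 := stepScale_mul (S := S) x
  have hξ := norm_nonneg (ridgeSol S x)
  have hσ0 : 0 ≤ θ * stepScale S x := by positivity
  have hστ : θ * stepScale S x ≤ stepScale S x := mul_le_of_le_one_left hτ.le h1
  have hσ4 : θ * stepScale S x ≤ 1 / 4 := by nlinarith
  obtain ⟨h2, h3⟩ := conjExp_bounds (S := S) x (transpose_ridgeSol (S := S) x)
    (σ := θ * stepScale S x) (by
      rw [norm_smul, Real.norm_eq_abs, abs_of_nonneg hσ0]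
      nlinarith)
  have hE := trace_moment_mul_ridgeSol (S := S) x
  have hE0 := trace_moment_mul_ridgeSol_nonneg (S := S) x
  have hm : ∑ s ∈ S, ‖ridgeSol S x * x s - x s * ridgeSol S x‖ ^ 2 ≤
      (moment S x * ridgeSol S x).trace := by
    rw [hE]; exact le_add_of_nonneg_right (by positivity)
  have h4 := mul_le_mul_of_nonneg_left hm (by positivity : 0 ≤ 4 * (θ * stepScale S x) ^ 2)
  refine ⟨?_, h3.trans h4⟩
  have h5 : 4 * (θ * stepScale S x) ^ 2 * (moment S x * ridgeSol S x).trace ≤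
      θ * stepScale S x * (moment S x * ridgeSol S x).trace :=
    mul_le_mul_of_nonneg_right (by nlinarith) hE0
  change _ ≤ _ - defect S (conjExp ((θ * stepScale S x) • ridgeSol S x) x)
  linarith

theorem defect_descStep_le (x : Γ →* Matrix (Fin n) (Fin n) ℝ) {θ : ℝ} (h0 : 0 ≤ θ) (h1 : θ ≤ 1) :
    defect S (descStep S θ x) ≤ defect S x := by
  have h2 := (descStep_bounds (S := S) x h0 h1).1
  have h3 := mul_nonneg (mul_nonneg h0 (stepScale_pos (S := S) x).le)
    (trace_moment_mul_ridgeSol_nonneg (S := S) x)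
  linarith

theorem energy_descStep_le (x : Γ →* Matrix (Fin n) (Fin n) ℝ) {θ : ℝ} (h0 : 0 ≤ θ) (h1 : θ ≤ 1) :
    energy S (descStep S θ x) ≤ energy S x := by
  have h2 := defect_descStep_le (S := S) x h0 h1
  have h3 := defect_sub_defect_conjExp (S := S) x ((θ * stepScale S x) • ridgeSol S x)
  change _ - defect S (descStep S θ x) = _ - energy S (descStep S θ x) at h3
  linarith

theorem norm_sq_descStep_sub_le (x : Γ →* Matrix (Fin n) (Fin n) ℝ) {θ : ℝ} (h0 : 0 ≤ θ)
    (h1 : θ ≤ 1) {s : Γ} (hs : s ∈ S) : ‖descStep S θ x s - x s‖ ^ 2 ≤ defect S x := by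
  obtain ⟨h2, h3⟩ := descStep_bounds (S := S) x h0 h1
  have hτ := stepScale_pos (S := S) x
  have hτ1 := stepScale_mul (S := S) x
  have hξ := norm_nonneg (ridgeSol S x)
  have hσ0 : 0 ≤ θ * stepScale S x := by positivity
  have hστ : θ * stepScale S x ≤ stepScale S x := mul_le_of_le_one_left hτ.le h1
  have hσ4 : θ * stepScale S x ≤ 1 / 4 := by nlinarith
  have h5 : 4 * (θ * stepScale S x) ^ 2 * (moment S x * ridgeSol S x).trace ≤
      θ * stepScale S x * (moment S x * ridgeSol S x).trace :=
    mul_le_mul_of_nonneg_right (by nlinarith) (trace_moment_mul_ridgeSol_nonneg (S := S) x)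
  have h6 := Finset.single_le_sum (f := fun s => ‖descStep S θ x s - x s‖ ^ 2)
    (fun _ _ => sq_nonneg _) hs
  have h7 := defect_nonneg (S := S) (descStep S θ x)
  linarith

/-- Uniform estimates for descent steps on sets of bounded energy. -/
theorem HasGradientBound.exists_step_bounds (hS : HasGradientBound S n) (R : ℝ) :
    ∃ C c : ℝ, 0 < C ∧ 0 < c ∧ ∀ x : Γ →* Matrix (Fin n) (Fin n) ℝ, energy S x ≤ R →
      defect S (descStep S 1 x) ≤ defect S x - c * defect S x ^ 2 ∧
      ∀ θ, 0 ≤ θ → θ ≤ 1 → ∀ s ∈ S, ‖descStep S θ x s - x s‖ ≤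
        C * (√(defect S x) - √(defect S (descStep S θ x))) := by
  obtain ⟨T, c, hT, hc, h⟩ := hS.exists_bounds R
  rcases lt_or_ge R 0 with hR | hR
  · exact ⟨1, 1, one_pos, one_pos, fun x hx =>
      absurd (le_trans (Finset.sum_nonneg fun _ _ => sq_nonneg _) hx) (not_le.2 hR)⟩
  refine ⟨4 / √c, min (c / (8 * (R + 1))) (1 / (8 * T ^ 2)), by positivity, by positivity,
    fun x hx => ⟨?_, fun θ h0 h1 s hs => ?_⟩⟩
  · obtain ⟨h2, -⟩ := descStep_bounds (S := S) x zero_le_one le_rfl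
    rw [one_mul] at h2
    obtain ⟨h3, h4⟩ := h x hx
    have hΔ := defect_nonneg (S := S) x
    have hΔR : defect S x ≤ R := (defect_le_energy x).trans hx
    have hτ := stepScale_pos (S := S) x
    have hτ1 := stepScale_mul (S := S) x
    have hE0 := trace_moment_mul_ridgeSol_nonneg (S := S) x
    have hE := trace_moment_mul_ridgeSol (S := S) x
    have hξ := norm_nonneg (ridgeSol S x)
    have hE' : ‖moment S x‖ ^ 2 * ‖ridgeSol S x‖ ^ 2 ≤ (moment S x * ridgeSol S x).trace := by
      rw [hE]; exact le_add_of_nonneg_left (Finset.sum_nonneg fun _ _ => sq_nonneg _)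
    suffices h5 : min (c / (8 * (R + 1))) (1 / (8 * T ^ 2)) * defect S x ^ 2 ≤
        stepScale S x * (moment S x * ridgeSol S x).trace by linarith
    rcases le_total ‖ridgeSol S x‖ 1 with h6 | h6
    · have h7 : 1 / 8 ≤ stepScale S x := by nlinarith
      calc _ ≤ c / (8 * (R + 1)) * defect S x ^ 2 :=
            mul_le_mul_of_nonneg_right (min_le_left _ _) (sq_nonneg _)
        _ ≤ c / (8 * (R + 1)) * (defect S x * (R + 1)) := by
            apply mul_le_mul_of_nonneg_left _ (by positivity); nlinarith
        _ = 1 / 8 * (c * defect S x) := by field_simp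
        _ ≤ _ := mul_le_mul h7 h4 (by positivity) hτ.le
    · have h7 : 1 / 8 ≤ stepScale S x * ‖ridgeSol S x‖ := by nlinarith
      calc _ ≤ 1 / (8 * T ^ 2) * defect S x ^ 2 :=
            mul_le_mul_of_nonneg_right (min_le_right _ _) (sq_nonneg _)
        _ ≤ 1 / (8 * T ^ 2) * (T * ‖moment S x‖) ^ 2 := by gcongr
        _ = 1 / 8 * ‖moment S x‖ ^ 2 := by field_simp
        _ ≤ stepScale S x * ‖ridgeSol S x‖ * ‖moment S x‖ ^ 2 :=
            mul_le_mul_of_nonneg_right h7 (sq_nonneg _)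
        _ ≤ stepScale S x * ‖ridgeSol S x‖ * ‖moment S x‖ ^ 2 * ‖ridgeSol S x‖ :=
            le_mul_of_one_le_right (by positivity) h6
        _ = stepScale S x * (‖moment S x‖ ^ 2 * ‖ridgeSol S x‖ ^ 2) := by ring
        _ ≤ _ := mul_le_mul_of_nonneg_left hE' hτ.le
  · obtain ⟨h2, h3⟩ := descStep_bounds (S := S) x h0 h1
    obtain ⟨-, h4⟩ := h x hx
    have hΔ := defect_nonneg (S := S) x
    have hΔ' := defect_nonneg (S := S) (descStep S θ x)
    have hle := defect_descStep_le (S := S) x h0 h1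
    have hE0 := trace_moment_mul_ridgeSol_nonneg (S := S) x
    have hσ0 : 0 ≤ θ * stepScale S x := mul_nonneg h0 (stepScale_pos x).le
    have h6 := (Finset.single_le_sum (f := fun s => ‖descStep S θ x s - x s‖ ^ 2)
      (fun _ _ => sq_nonneg _) hs).trans h3
    set E := (moment S x * ridgeSol S x).trace
    set σ := θ * stepScale S x
    have hsE := Real.sq_sqrt hE0
    have h7 : ‖descStep S θ x s - x s‖ ≤ 2 * σ * √E := by
      refine le_of_sq_le_sq ?_ (by positivity)
      calc _ ≤ _ := h6
        _ = 4 * σ ^ 2 * √E ^ 2 := by rw [hsE]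
        _ = _ := by ring
    have hs1 := Real.sq_sqrt hΔ
    have hs2 := Real.sq_sqrt hΔ'
    have hsc := Real.sq_sqrt hc.le
    have hsle := Real.sqrt_le_sqrt hle
    have hc' : 0 < √c := Real.sqrt_pos.2 hc
    have h8 : √c * √(defect S x) ≤ √E := by
      rw [← Real.sqrt_mul hc.le]; exact Real.sqrt_le_sqrt h4
    refine h7.trans ?_
    rcases (Real.sqrt_nonneg E).eq_or_lt with h9 | h9
    · rw [← h9, mul_zero]
      exact mul_nonneg (by positivity) (sub_nonneg.2 hsle)
    · rw [div_mul_eq_mul_div, le_div_iff₀ hc']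
      refine le_of_mul_le_mul_right ?_ h9
      have h10 := Real.sqrt_nonneg (defect S (descStep S θ x))
      have h11 := Real.sqrt_nonneg (defect S x)
      set p := √(defect S x)
      set q := √(defect S (descStep S θ x))
      calc 2 * σ * √E * √c * √E = 2 * √c * (σ * √E ^ 2) := by ring
        _ ≤ 2 * √c * (p ^ 2 - q ^ 2) := by
            rw [hs1, hs2, hsE]; exact mul_le_mul_of_nonneg_left h2 (by positivity)
        _ = 2 * (p - q) * (√c * (p + q)) := by ring
        _ ≤ 2 * (p - q) * (√c * (p + p)) := by
            gcongr
        _ = 4 * (p - q) * (√c * p) := by ring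
        _ ≤ 4 * (p - q) * √E := mul_le_mul_of_nonneg_left h8 (by linarith)

end Step

section Flow

open Matrix Filter Topology
open scoped Matrix.Norms.Frobenius

variable {Γ : Type*} [Group Γ] {S : Finset Γ} {n : ℕ}

theorem exp_orthogonal_conj {u : Matrix (Fin n) (Fin n) ℝ} (hu : uᵀ * u = 1)
    (ζ : Matrix (Fin n) (Fin n) ℝ) :
    NormedSpace.exp (u * ζ * uᵀ) = u * NormedSpace.exp ζ * uᵀ := by
  have h : u⁻¹ = uᵀ := inv_eq_left_inv hu
  rw [← h]
  exact Matrix.exp_conj _ _ (IsUnit.of_mul_eq_one _ (mul_eq_one_comm.1 hu))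

theorem descStep_orthogonal_conj {u : Matrix (Fin n) (Fin n) ℝ} (hu : uᵀ * u = 1)
    {x y : Γ →* Matrix (Fin n) (Fin n) ℝ} (hxy : ∀ γ, y γ = u * x γ * uᵀ) (θ : ℝ) (γ : Γ) :
    descStep S θ y γ = u * descStep S θ x γ * uᵀ := by
  have h1 : ridgeSol S y = u * ridgeSol S x * uᵀ := ridgeSol_orthogonal_conj hu hxy
  have h2 : (θ * stepScale S y) • ridgeSol S y =
      u * ((θ * stepScale S x) • ridgeSol S x) * uᵀ := by
    rw [stepScale, stepScale, h1, frobenius_norm_orthogonal_conj hu, Matrix.mul_smul,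
      Matrix.smul_mul]
  rw [descStep, descStep, conjExp_apply, conjExp_apply, h2, ← Matrix.neg_mul, ← Matrix.mul_neg,
    exp_orthogonal_conj hu, exp_orthogonal_conj hu, hxy, mul_mul_transpose_mul hu,
    mul_mul_transpose_mul hu]

theorem continuous_of_generators {Y : Type*} [TopologicalSpace Y]
    (hgen : Submonoid.closure (S : Set Γ) = ⊤) {f : Y → Γ →* Matrix (Fin n) (Fin n) ℝ}
    (h : ∀ s ∈ S, Continuous fun y => f y s) (γ : Γ) : Continuous fun y => f y γ := by
  have hγ : γ ∈ Submonoid.closure (S : Set Γ) := hgen ▸ Submonoid.mem_top γ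
  induction hγ using Submonoid.closure_induction with
  | mem s hs => exact h s hs
  | one => simpa using continuous_const
  | mul a b _ _ ha hb =>
    simp only [map_mul]
    exact ha.mul hb

theorem continuous_energy {Y : Type*} [TopologicalSpace Y]
    {X : Y → Γ →* Matrix (Fin n) (Fin n) ℝ} (hX : ∀ γ, Continuous fun y => X y γ) :
    Continuous fun y => energy S (X y) := by
  unfold energy
  exact continuous_finsetSum _ fun s _ => (hX s).norm.pow 2

theorem continuous_descStep (hS : HasGradientBound S n)
    (hgen : Submonoid.closure (S : Set Γ) = ⊤) {Y : Type*} [TopologicalSpace Y]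
    {X : Y → Γ →* Matrix (Fin n) (Fin n) ℝ} (hX : ∀ γ, Continuous fun y => X y γ) {θ : Y → ℝ}
    (hθ : Continuous θ) (h0 : ∀ y, 0 ≤ θ y) (h1 : ∀ y, θ y ≤ 1) (γ : Γ) :
    Continuous fun y => descStep S (θ y) (X y) γ := by
  have hX' : Continuous fun y => (X y : Γ → Matrix (Fin n) (Fin n) ℝ) := continuous_pi hX
  have hμ : Continuous fun y => moment S (X y) := (continuous_moment S n).comp hX'
  refine continuous_of_generators (S := S) hgen (fun s hs => ?_) γ
  refine continuous_iff_continuousAt.2 fun y₀ => ?_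
  by_cases h : moment S (X y₀) = 0
  · obtain ⟨T, c, hT, hc, hb⟩ := hS.exists_bounds (energy S (X y₀) + 1)
    have hev : ∀ᶠ y in 𝓝 y₀, energy S (X y) < energy S (X y₀) + 1 :=
      (continuous_energy hX).continuousAt.eventually_lt_const (by linarith)
    have h2 : Tendsto (fun y => √(T * ‖moment S (X y)‖)) (𝓝 y₀) (𝓝 0) := by
      have h3 : Continuous fun y => √(T * ‖moment S (X y)‖) :=
        (continuous_const.mul hμ.norm).sqrt
      have h4 := h3.tendsto y₀
      simpa [h] using h4
    have h3 : Tendsto (fun y => descStep S (θ y) (X y) s - X y s) (𝓝 y₀) (𝓝 0) := by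
      refine squeeze_zero_norm' ?_ h2
      filter_upwards [hev] with y hy
      refine Real.le_sqrt_of_sq_le ?_
      exact (norm_sq_descStep_sub_le (X y) (h0 y) (h1 y) hs).trans (hb (X y) hy.le).1
    have h4 := h3.add ((hX s).tendsto y₀)
    simp only [sub_add_cancel, zero_add] at h4
    rw [ContinuousAt, descStep_eq_self h]
    exact h4
  · have h2 : ContinuousAt (fun y => ridgeSol S (X y)) y₀ :=
      ContinuousAt.comp (f := fun y => (X y : Γ → Matrix (Fin n) (Fin n) ℝ))
        (continuousAt_ridgeSol h) hX'.continuousAt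
    have h3 : ContinuousAt (fun y => stepScale S (X y)) y₀ := by
      unfold stepScale
      refine continuousAt_const.div (continuousAt_const.mul (continuousAt_const.add h2.norm)) ?_
      positivity
    have h4 : ContinuousAt (fun y => (θ y * stepScale S (X y)) • ridgeSol S (X y)) y₀ :=
      (hθ.continuousAt.mul h3).smul h2
    have hexp : Continuous (NormedSpace.exp : Matrix (Fin n) (Fin n) ℝ → _) :=
      NormedSpace.exp_continuous
    exact ((hexp.continuousAt.comp h4.neg).mul (hX s).continuousAt).mul (hexp.continuousAt.comp h4)

/-- The time reparametrization for the `k`-th descent step. -/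
noncomputable def stepTime (k : ℕ) (t : ℝ) : ℝ :=
  max 0 (min 1 (2 - 2 ^ (k + 1) * (1 - t)))

theorem stepTime_nonneg (k : ℕ) (t : ℝ) : 0 ≤ stepTime k t := le_max_left _ _

theorem stepTime_le_one (k : ℕ) (t : ℝ) : stepTime k t ≤ 1 :=
  max_le zero_le_one (min_le_left _ _)

theorem stepTime_one (k : ℕ) : stepTime k 1 = 1 := by
  norm_num [stepTime]

theorem stepTime_zero (k : ℕ) : stepTime k 0 = 0 := by
  have : (1 : ℝ) ≤ 2 ^ k := one_le_pow₀ one_le_two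
  refine max_eq_left (min_le_iff.2 (Or.inr ?_))
  rw [pow_succ]
  linarith

theorem continuous_stepTime (k : ℕ) : Continuous (stepTime k) := by
  unfold stepTime
  fun_prop

theorem stepTime_eq_zero {j k : ℕ} (hjk : j < k) {t : ℝ} (h : stepTime j t ≠ 1) :
    stepTime k t = 0 := by
  have h1 : 1 < 2 ^ (j + 1) * (1 - t) := by
    by_contra! h2
    refine h ?_
    rw [stepTime, min_eq_left (by linarith), max_eq_right zero_le_one]
  have h3 : (2 : ℝ) ^ (j + 1) ≤ 2 ^ k := pow_le_pow_right₀ one_le_two hjk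
  have h4 : 0 < 1 - t := by
    by_contra! h5
    have : (0 : ℝ) < 2 ^ (j + 1) := by positivity
    nlinarith
  refine max_eq_left (min_le_iff.2 (Or.inr ?_))
  rw [pow_succ]
  nlinarith

/-- The iterated descent steps. -/
noncomputable def descIter (S : Finset Γ) (x : Γ →* Matrix (Fin n) (Fin n) ℝ) (t : ℝ) :
    ℕ → Γ →* Matrix (Fin n) (Fin n) ℝ
  | 0 => x
  | k + 1 => descStep S (stepTime k t) (descIter S x t k)

theorem continuous_descIter (hS : HasGradientBound S n)
    (hgen : Submonoid.closure (S : Set Γ) = ⊤) {Y : Type*} [TopologicalSpace Y]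
    {X : Y → Γ →* Matrix (Fin n) (Fin n) ℝ} (hX : ∀ γ, Continuous fun y => X y γ) {t : Y → ℝ}
    (ht : Continuous t) (k : ℕ) (γ : Γ) : Continuous fun y => descIter S (X y) (t y) k γ := by
  induction k generalizing γ with
  | zero => exact hX γ
  | succ k ih =>
    exact continuous_descStep hS hgen ih ((continuous_stepTime k).comp ht)
      (fun _ => stepTime_nonneg _ _) (fun _ => stepTime_le_one _ _) γ

theorem descIter_orthogonal_conj {u : Matrix (Fin n) (Fin n) ℝ} (hu : uᵀ * u = 1)
    {x y : Γ →* Matrix (Fin n) (Fin n) ℝ} (hxy : ∀ γ, y γ = u * x γ * uᵀ) (t : ℝ) (k : ℕ)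
    (γ : Γ) : descIter S y t k γ = u * descIter S x t k γ * uᵀ := by
  induction k generalizing γ with
  | zero => exact hxy γ
  | succ k ih => exact descStep_orthogonal_conj hu ih _ γ

theorem descIter_zero_time (x : Γ →* Matrix (Fin n) (Fin n) ℝ) (k : ℕ) :
    descIter S x 0 k = x := by
  induction k with
  | zero => rfl
  | succ k ih => rw [descIter, ih, stepTime_zero, descStep_zero]

theorem descIter_eq_self {x : Γ →* Matrix (Fin n) (Fin n) ℝ} (h : moment S x = 0) (t : ℝ)
    (k : ℕ) : descIter S x t k = x := by
  induction k with
  | zero => rfl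
  | succ k ih => rw [descIter, ih, descStep_eq_self h]

theorem energy_descIter_le (x : Γ →* Matrix (Fin n) (Fin n) ℝ) (t : ℝ) (k : ℕ) :
    energy S (descIter S x t k) ≤ energy S x := by
  induction k with
  | zero => exact le_rfl
  | succ k ih =>
    exact (energy_descStep_le _ (stepTime_nonneg _ _) (stepTime_le_one _ _)).trans ih

theorem antitone_defect_descIter (x : Γ →* Matrix (Fin n) (Fin n) ℝ) (t : ℝ) :
    Antitone fun k => defect S (descIter S x t k) :=
  antitone_nat_of_succ_le fun k =>
    defect_descStep_le _ (stepTime_nonneg k t) (stepTime_le_one k t)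

theorem descIter_eq_of_stepTime_ne_one (x : Γ →* Matrix (Fin n) (Fin n) ℝ) {t : ℝ} {j : ℕ}
    (h : stepTime j t ≠ 1) {k m : ℕ} (hjk : j < k) (hkm : k ≤ m) :
    descIter S x t m = descIter S x t k := by
  induction m, hkm using Nat.le_induction with
  | base => rfl
  | succ m hkm ih => rw [descIter, stepTime_eq_zero (hjk.trans_le hkm) h, descStep_zero, ih]

theorem HasGradientBound.exists_tail_bound (hS : HasGradientBound S n) (R : ℝ) :
    ∃ b : ℕ → ℝ, Tendsto b atTop (𝓝 0) ∧ ∀ x : Γ →* Matrix (Fin n) (Fin n) ℝ, energy S x ≤ R →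
      (∀ k, defect S (descIter S x 1 k) ≤ b k) ∧
      ∀ t k m, k ≤ m → ∀ s ∈ S, ‖descIter S x t k s - descIter S x t m s‖ ≤ b k := by
  obtain ⟨C, c, hC, hc, h⟩ := hS.exists_step_bounds R
  rcases lt_or_ge R 0 with hR | hR
  · exact ⟨fun _ => 0, tendsto_const_nhds, fun x hx =>
      absurd (le_trans (Finset.sum_nonneg fun _ _ => sq_nonneg _) hx) (not_le.2 hR)⟩
  set δ : ℕ → ℝ := fun k => √((R + c * R ^ 2) / c * (1 / ((k : ℝ) + 1))) with hδ
  have hδ0 : Tendsto δ atTop (𝓝 0) := by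
    have h1 := ((tendsto_one_div_add_atTop_nhds_zero_nat (𝕜 := ℝ)).const_mul
      ((R + c * R ^ 2) / c)).sqrt
    rwa [mul_zero, Real.sqrt_zero] at h1
  have hdefect : ∀ x : Γ →* Matrix (Fin n) (Fin n) ℝ, energy S x ≤ R → ∀ t k,
      (∀ j < k, stepTime j t = 1) → defect S (descIter S x t k) ≤ δ k := by
    intro x hx t k hk
    have hen : ∀ j, energy S (descIter S x t j) ≤ R := fun j => (energy_descIter_le x t j).trans hx
    have h1 : ∀ j ≤ k, defect S (descIter S x t j) +
        j * (c * defect S (descIter S x t k) ^ 2) ≤ R := by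
      intro j hj
      induction j with
      | zero =>
        rw [Nat.cast_zero, zero_mul, add_zero]
        exact (defect_le_energy _).trans (hen 0)
      | succ j ih =>
        have h2 := (h _ (hen j)).1
        have h3 : descIter S x t (j + 1) = descStep S 1 (descIter S x t j) := by
          rw [descIter, hk j hj]
        rw [← h3] at h2
        have h4 := ih (by omega)
        have h5 := antitone_defect_descIter (S := S) x t (show j ≤ k by omega)
        have h6 : c * defect S (descIter S x t k) ^ 2 ≤ c * defect S (descIter S x t j) ^ 2 :=
          mul_le_mul_of_nonneg_left (pow_le_pow_left₀ (defect_nonneg _) h5 2) hc.le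
        push_cast
        linarith
    have h2 := h1 k le_rfl
    have h3 := defect_nonneg (S := S) (descIter S x t k)
    have h4 := (defect_le_energy (S := S) _).trans (hen k)
    refine Real.le_sqrt_of_sq_le ?_
    rw [mul_one_div, div_div, le_div_iff₀ (by positivity)]
    have h5 : c * defect S (descIter S x t k) ^ 2 ≤ c * R ^ 2 :=
      mul_le_mul_of_nonneg_left (pow_le_pow_left₀ h3 h4 2) hc.le
    linarith
  have hmove : ∀ x : Γ →* Matrix (Fin n) (Fin n) ℝ, energy S x ≤ R → ∀ t k m, k ≤ m →
      ∀ s ∈ S, ‖descIter S x t k s - descIter S x t m s‖ ≤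
        C * (√(defect S (descIter S x t k)) - √(defect S (descIter S x t m))) := by
    intro x hx t k m hkm s hs
    induction m, hkm using Nat.le_induction with
    | base => simp
    | succ m hkm ih =>
      have h1 := (h _ ((energy_descIter_le (S := S) x t m).trans hx)).2 (stepTime m t)
        (stepTime_nonneg _ _) (stepTime_le_one _ _) s hs
      rw [norm_sub_rev] at h1
      have h2 := norm_sub_le_norm_sub_add_norm_sub (descIter S x t k s) (descIter S x t m s)
        (descIter S x t (m + 1) s)
      rw [descIter] at h2 ⊢
      linarith
  refine ⟨fun k => δ k + C * √(δ k), ?_, fun x hx => ⟨fun k => ?_, fun t k m hkm s hs => ?_⟩⟩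
  · simpa using hδ0.add (hδ0.sqrt.const_mul C)
  · exact (hdefect x hx 1 k fun j _ => stepTime_one j).trans
      (le_add_of_nonneg_right (by positivity))
  · have hδk : 0 ≤ δ k := Real.sqrt_nonneg _
    by_cases hk : ∀ j < k, stepTime j t = 1
    · refine (hmove x hx t k m hkm s hs).trans ?_
      have h1 := Real.sqrt_le_sqrt (hdefect x hx t k hk)
      have h2 := Real.sqrt_nonneg (defect S (descIter S x t m))
      calc _ ≤ C * √(δ k) := mul_le_mul_of_nonneg_left (by linarith) hC.le
        _ ≤ _ := le_add_of_nonneg_left hδk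
    · push Not at hk
      obtain ⟨j, hj, hjt⟩ := hk
      rw [descIter_eq_of_stepTime_ne_one x hjt hj hkm, sub_self, norm_zero]
      positivity

theorem HasGradientBound.exists_limit (hS : HasGradientBound S n)
    (hgen : Submonoid.closure (S : Set Γ) = ⊤) (x : Γ →* Matrix (Fin n) (Fin n) ℝ) (t : ℝ) :
    ∃ y : Γ →* Matrix (Fin n) (Fin n) ℝ,
      ∀ γ, Tendsto (fun k => descIter S x t k γ) atTop (𝓝 (y γ)) := by
  obtain ⟨b, hb, h⟩ := hS.exists_tail_bound (energy S x)
  have h1 : ∀ γ, ∃ l, Tendsto (fun k => descIter S x t k γ) atTop (𝓝 l) := by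
    intro γ
    have hγ : γ ∈ Submonoid.closure (S : Set Γ) := hgen ▸ Submonoid.mem_top γ
    induction hγ using Submonoid.closure_induction with
    | mem s hs =>
      have : CompleteSpace (Matrix (Fin n) (Fin n) ℝ) := FiniteDimensional.complete ℝ _
      refine cauchySeq_tendsto_of_complete (cauchySeq_of_le_tendsto_0' b (fun k m hkm => ?_) hb)
      rw [dist_eq_norm]
      exact (h x le_rfl).2 t k m hkm s hs
    | one => exact ⟨1, by simp⟩
    | mul a b _ _ ha hb =>
      obtain ⟨la, ha⟩ := ha
      obtain ⟨lb, hb⟩ := hb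
      exact ⟨la * lb, by simpa using ha.mul hb⟩
  choose y hy using h1
  refine ⟨⟨⟨y, ?_⟩, fun γ δ => ?_⟩, hy⟩
  · exact tendsto_nhds_unique (hy 1) (by simp)
  · exact tendsto_nhds_unique (hy (γ * δ)) (by simpa using (hy γ).mul (hy δ))

/-- An equivariant deformation of representations to representations that are normal on the
generators. -/
theorem HasGradientBound.exists_flow (hS : HasGradientBound S n)
    (hgen : Submonoid.closure (S : Set Γ) = ⊤) :
    ∃ L : (Γ →* Matrix (Fin n) (Fin n) ℝ) → ℝ → (Γ →* Matrix (Fin n) (Fin n) ℝ),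
      (∀ (Y : Type) [TopologicalSpace Y] (X : Y → Γ →* Matrix (Fin n) (Fin n) ℝ),
        (∀ γ, Continuous fun y => X y γ) → ∀ t : Y → ℝ, Continuous t →
          ∀ γ, Continuous fun y => L (X y) (t y) γ) ∧
      (∀ x, L x 0 = x) ∧
      (∀ x, ∀ s ∈ S, (L x 1 s)ᵀ * L x 1 s = L x 1 s * (L x 1 s)ᵀ) ∧
      (∀ x, (∀ γ, (x γ)ᵀ * x γ = 1) → ∀ t, L x t = x) ∧
      (∀ (u : Matrix (Fin n) (Fin n) ℝ), uᵀ * u = 1 → ∀ x y : Γ →* Matrix (Fin n) (Fin n) ℝ,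
        (∀ γ, y γ = u * x γ * uᵀ) → ∀ t γ, L y t γ = u * L x t γ * uᵀ) := by
  choose L hL using hS.exists_limit hgen
  refine ⟨L, fun Y _ X hX t ht γ => ?_, fun x => ?_, fun x s hs => ?_, fun x hx t => ?_,
    fun u hu x y hxy t γ => ?_⟩
  · refine continuous_of_generators (S := S) hgen (fun s hs => ?_) γ
    refine continuous_iff_continuousAt.2 fun y₀ => ?_
    obtain ⟨b, hb, h⟩ := hS.exists_tail_bound (energy S (X y₀) + 1)
    have hev : ∀ᶠ y in 𝓝 y₀, energy S (X y) < energy S (X y₀) + 1 :=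
      (continuous_energy hX).continuousAt.eventually_lt_const (by linarith)
    refine continuousAt_of_locally_uniform_approx_of_continuousAt fun V hV => ?_
    obtain ⟨ε, hε, hεV⟩ := Metric.mem_uniformity_dist.1 hV
    obtain ⟨k, hk⟩ := (hb.eventually_lt_const hε).exists
    refine ⟨_, hev, fun y => descIter S (X y) (t y) k s,
      (continuous_descIter hS hgen hX ht k s).continuousAt, fun y hy => hεV ?_⟩
    refine lt_of_le_of_lt ?_ hk
    rw [dist_comm, dist_eq_norm]
    refine le_of_tendsto ((tendsto_const_nhds.sub (hL (X y) (t y) s)).norm) ?_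
    filter_upwards [eventually_ge_atTop k] with m hm
    exact (h (X y) (le_of_lt hy)).2 (t y) k m hm s hs
  · ext1 γ
    refine tendsto_nhds_unique (hL x 0 γ) ?_
    simp only [descIter_zero_time]
    exact tendsto_const_nhds
  · obtain ⟨b, hb, h⟩ := hS.exists_tail_bound (energy S x)
    obtain ⟨T, c, hT, hc, hbd⟩ := hS.exists_bounds (energy S (L x 1))
    have hLx : Tendsto (fun k => (descIter S x 1 k : Γ → Matrix (Fin n) (Fin n) ℝ)) atTop
        (𝓝 (L x 1)) := tendsto_pi_nhds.2 fun γ => hL x 1 γ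
    have h1 : Tendsto (fun k => ‖moment S (descIter S x 1 k)‖ ^ 2) atTop
        (𝓝 (‖moment S (L x 1)‖ ^ 2)) :=
      ((((continuous_moment S n).tendsto _).comp hLx).norm).pow 2
    have h2 : Tendsto (fun k => ‖moment S (descIter S x 1 k)‖ ^ 2) atTop (𝓝 0) := by
      have h3 := hb.const_mul (16 * (energy S x + 1))
      rw [mul_zero] at h3
      have h4 : 0 ≤ energy S x := Finset.sum_nonneg fun _ _ => sq_nonneg _
      refine squeeze_zero (fun _ => sq_nonneg _) (fun k => ?_) h3
      exact (norm_sq_moment_le (energy_descIter_le x 1 k)).trans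
        (mul_le_mul_of_nonneg_left ((h x le_rfl).1 k) (by positivity))
    have h3 := tendsto_nhds_unique h1 h2
    have h4 : ‖moment S (L x 1)‖ = 0 := by simpa using h3
    have h5 := (hbd (L x 1) le_rfl).1
    rw [h4, mul_zero] at h5
    exact transpose_mul_comm_of_defect_eq_zero (le_antisymm h5 (defect_nonneg _)) hs
  · have hμ : moment S x = 0 := by
      refine Finset.sum_eq_zero fun s _ => ?_
      rw [hx s, mul_eq_one_comm.1 (hx s), sub_self]
    ext1 γ
    refine tendsto_nhds_unique (hL x t γ) ?_
    simp only [descIter_eq_self hμ]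
    exact tendsto_const_nhds
  · refine tendsto_nhds_unique (hL y t γ) ?_
    simp only [descIter_orthogonal_conj hu hxy]
    exact (tendsto_const_nhds.mul (hL x t γ)).mul tendsto_const_nhds

end Flow

section Polar

open Matrix Filter Topology
open scoped Matrix.Norms.Frobenius

variable {Γ : Type*} [Group Γ] {n : ℕ}

theorem abs_sub_le_mul_abs_exp_sub {a b K : ℝ} (ha : Real.exp (-a) ≤ K) (hb : Real.exp (-b) ≤ K) :
    |a - b| ≤ K * |Real.exp a - Real.exp b| := by
  wlog h : b ≤ a generalizing a b
  · rw [abs_sub_comm, abs_sub_comm (Real.exp a)]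
    exact this hb ha (le_of_not_ge h)
  have h1 := Real.add_one_le_exp (a - b)
  have h2 : Real.exp b ≤ Real.exp a := Real.exp_le_exp.2 h
  rw [abs_of_nonneg (sub_nonneg.2 h), abs_of_nonneg (sub_nonneg.2 h2)]
  calc a - b ≤ Real.exp (a - b) - 1 := by linarith
    _ = Real.exp (-b) * (Real.exp a - Real.exp b) := by
        rw [mul_sub, ← Real.exp_add, ← Real.exp_add, neg_add_cancel, Real.exp_zero, neg_add_eq_sub]
    _ ≤ _ := mul_le_mul_of_nonneg_right hb (sub_nonneg.2 h2)

/-- The exponential is expanding on symmetric matrices, relative to the size of the inverses. -/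
theorem norm_sub_le_norm_exp_sub {ζ η : Matrix (Fin n) (Fin n) ℝ} (hζ : ζᵀ = ζ) (hη : ηᵀ = η)
    {K : ℝ} (h1 : ‖NormedSpace.exp (-ζ)‖ ≤ K) (h2 : ‖NormedSpace.exp (-η)‖ ≤ K) :
    ‖ζ - η‖ ≤ K * ‖NormedSpace.exp ζ - NormedSpace.exp η‖ := by
  obtain ⟨U, a, hU, hU', hUa, -, hUexp⟩ := exists_diagonalization_exp hζ
  obtain ⟨V, b, hV, hV', hVb, -, hVexp⟩ := exists_diagonalization_exp hη
  have hK : 0 ≤ K := (norm_nonneg _).trans h1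
  have hmixed : ∀ c d : Fin n → ℝ,
      ‖U * diagonal c * Uᴴ - V * diagonal d * Vᴴ‖ ^ 2 =
        ∑ i, ∑ j, ((c i - d j) * (Uᴴ * V) i j) ^ 2 := by
    intro c d
    have h3 : U * diagonal c * Uᴴ - V * diagonal d * Vᴴ =
        U * (diagonal c * (Uᴴ * V) - (Uᴴ * V) * diagonal d) * Vᴴ := by
      calc _ = U * diagonal c * Uᴴ * (V * Vᴴ) - (U * Uᴴ) * V * diagonal d * Vᴴ := by
            rw [hV', hU', Matrix.mul_one, Matrix.one_mul]
        _ = _ := by simp only [Matrix.mul_sub, Matrix.sub_mul, Matrix.mul_assoc]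
    rw [h3, frobenius_norm_mul_isometry (by simpa using hV), frobenius_norm_isometry_mul hU,
      frobenius_norm_sq]
    refine Finset.sum_congr rfl fun i _ => Finset.sum_congr rfl fun j _ => ?_
    rw [Matrix.sub_apply, diagonal_mul, mul_diagonal, Real.norm_eq_abs, sq_abs]
    ring
  have hentry : ∀ {W : Matrix (Fin n) (Fin n) ℝ} {c : Fin n → ℝ} {ω : Matrix (Fin n) (Fin n) ℝ},
      Wᴴ * W = 1 → (∀ t : ℝ, NormedSpace.exp (t • ω) =
        W * diagonal (fun i => Real.exp (t * c i)) * Wᴴ) → ‖NormedSpace.exp (-ω)‖ ≤ K →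
      ∀ i, Real.exp (-c i) ≤ K := by
    intro W c ω hW hω hle i
    have h3 := hω (-1)
    rw [neg_one_smul] at h3
    rw [h3, frobenius_norm_mul_isometry (by simpa using hW), frobenius_norm_isometry_mul hW] at hle
    have h4 := (norm_apply_le_frobenius _ i i).trans hle
    rw [diagonal_apply_eq, Real.norm_eq_abs, Real.abs_exp, neg_one_mul] at h4
    exact h4
  have ha := hentry hU hUexp h1
  have hb := hentry hV hVexp h2
  have hζe := hUexp 1
  have hηe := hVexp 1
  simp only [one_smul, one_mul] at hζe hηe
  refine le_of_sq_le_sq ?_ (by positivity)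
  rw [mul_pow, hζe, hηe, hmixed]
  have h3 := hmixed a b
  rw [← hUa, ← hVb] at h3
  rw [h3, Finset.mul_sum]
  refine Finset.sum_le_sum fun i _ => ?_
  rw [Finset.mul_sum]
  refine Finset.sum_le_sum fun j _ => ?_
  have h4 := pow_le_pow_left₀ (abs_nonneg _) (abs_sub_le_mul_abs_exp_sub (ha i) (hb j)) 2
  rw [mul_pow, sq_abs, sq_abs] at h4
  have h5 := mul_le_mul_of_nonneg_right h4 (sq_nonneg ((Uᴴ * V) i j))
  linarith

theorem exp_injOn_symmetric {ζ η : Matrix (Fin n) (Fin n) ℝ} (hζ : ζᵀ = ζ) (hη : ηᵀ = η)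
    (h : NormedSpace.exp ζ = NormedSpace.exp η) : ζ = η := by
  have h1 := norm_sub_le_norm_exp_sub hζ hη (le_max_left _ ‖NormedSpace.exp (-η)‖)
    (le_max_right _ _)
  rw [h, sub_self, norm_zero, mul_zero] at h1
  exact sub_eq_zero.1 (norm_le_zero_iff.1 h1)

theorem commute_of_commute_exp {ζ X : Matrix (Fin n) (Fin n) ℝ} (hζ : ζᵀ = ζ)
    (h : Commute (NormedSpace.exp ζ) X) : Commute ζ X := by
  obtain ⟨U, a, hU, hU', hUa, -, hUexp⟩ := exists_diagonalization_exp hζ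
  have he := hUexp 1
  simp only [one_smul, one_mul] at he
  have h1 := norm_sq_commutator_diagonalized hU hU' (a := fun i => Real.exp (a i)) he X
  rw [h.eq, sub_self, norm_zero, zero_pow two_ne_zero, eq_comm] at h1
  have h2 := norm_sq_commutator_diagonalized hU hU' hUa X
  have h3 : ∀ i j, ‖(Uᴴ * X * U) i j‖ ^ 2 * (a i - a j) ^ 2 = 0 := by
    intro i j
    have h4 := (Finset.sum_eq_zero_iff_of_nonneg fun i _ =>
      Finset.sum_nonneg fun j _ => by positivity).1 h1 i (Finset.mem_univ i)
    have h5 := (Finset.sum_eq_zero_iff_of_nonneg fun j _ => by positivity).1 h4 j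
      (Finset.mem_univ j)
    rcases mul_eq_zero.1 h5 with h6 | h6
    · rw [h6, zero_mul]
    · rw [Real.exp_injective (sub_eq_zero.1 (pow_eq_zero_iff two_ne_zero |>.1 h6)), sub_self,
        zero_pow two_ne_zero, mul_zero]
  simp only [h3, Finset.sum_const_zero] at h2
  exact sub_eq_zero.1 (norm_eq_zero.1 (pow_eq_zero_iff two_ne_zero |>.1 h2))

theorem exists_exp_eq_transpose_mul_self {g g' : Matrix (Fin n) (Fin n) ℝ} (h : g * g' = 1) :
    ∃ ζ : Matrix (Fin n) (Fin n) ℝ, ζᵀ = ζ ∧ NormedSpace.exp ζ = gᵀ * g := by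
  obtain ⟨U, a, hU, hU', hg, -, -⟩ := exists_diagonalization_gram h
    (le_max_left (‖g‖ ^ 2) (‖g'‖ ^ 2)) (le_max_right _ _)
  have hinv : Uᴴ = U⁻¹ := (inv_eq_right_inv hU').symm
  refine ⟨U * diagonal (fun i => -2 * a i) * Uᴴ, ?_, ?_⟩
  · rw [conjTranspose_eq_transpose_of_trivial, transpose_mul_mul_transpose, diagonal_transpose]
  · rw [hinv, exp_conj _ _ (IsUnit.of_mul_eq_one _ hU'), exp_diagonal, ← hinv,
      ← conjTranspose_eq_transpose_of_trivial, hg]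
    congr 3
    ext i
    rw [Pi.coe_exp, Real.exp_eq_exp_ℝ]
    rfl

theorem hom_mul_hom_inv (x : Γ →* Matrix (Fin n) (Fin n) ℝ) (γ : Γ) : x γ * x γ⁻¹ = 1 := by
  rw [← map_mul, mul_inv_cancel, map_one]

/-- The logarithm of `(x γ)ᵀ * x γ`. -/
noncomputable def gramLog (x : Γ →* Matrix (Fin n) (Fin n) ℝ) (γ : Γ) :
    Matrix (Fin n) (Fin n) ℝ :=
  (exists_exp_eq_transpose_mul_self (hom_mul_hom_inv x γ)).choose

theorem transpose_gramLog (x : Γ →* Matrix (Fin n) (Fin n) ℝ) (γ : Γ) :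
    (gramLog x γ)ᵀ = gramLog x γ :=
  (exists_exp_eq_transpose_mul_self (hom_mul_hom_inv x γ)).choose_spec.1

theorem exp_gramLog (x : Γ →* Matrix (Fin n) (Fin n) ℝ) (γ : Γ) :
    NormedSpace.exp (gramLog x γ) = (x γ)ᵀ * x γ :=
  (exists_exp_eq_transpose_mul_self (hom_mul_hom_inv x γ)).choose_spec.2

theorem exp_neg_gramLog (x : Γ →* Matrix (Fin n) (Fin n) ℝ) (γ : Γ) :
    NormedSpace.exp (-gramLog x γ) = x γ⁻¹ * (x γ⁻¹)ᵀ := by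
  refine left_inv_eq_right_inv (a := NormedSpace.exp (gramLog x γ)) ?_ ?_
  · simpa using exp_mul_exp_neg (-gramLog x γ)
  · have h := hom_mul_hom_inv x γ
    have h' : (x γ)ᵀ * (x γ⁻¹)ᵀ = 1 := by
      rw [← transpose_mul, mul_eq_one_comm.1 h, transpose_one]
    rw [exp_gramLog]
    calc _ = (x γ)ᵀ * (x γ * x γ⁻¹) * (x γ⁻¹)ᵀ := by simp only [Matrix.mul_assoc]
      _ = 1 := by rw [h, Matrix.mul_one, h']

theorem continuous_gramLog {Y : Type*} [TopologicalSpace Y]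
    {X : Y → Γ →* Matrix (Fin n) (Fin n) ℝ} (hX : ∀ γ, Continuous fun y => X y γ) (γ : Γ) :
    Continuous fun y => gramLog (X y) γ := by
  have h1 : Continuous fun y => NormedSpace.exp (gramLog (X y) γ) := by
    simp only [exp_gramLog]
    exact (hX γ).matrix_transpose.mul (hX γ)
  have h2 : Continuous fun y => NormedSpace.exp (-gramLog (X y) γ) := by
    simp only [exp_neg_gramLog]
    exact (hX γ⁻¹).mul (hX γ⁻¹).matrix_transpose
  refine continuous_iff_continuousAt.2 fun y₀ => ?_
  refine tendsto_iff_norm_sub_tendsto_zero.2 ?_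
  have h3 : Continuous fun y => max ‖NormedSpace.exp (-gramLog (X y) γ)‖
      ‖NormedSpace.exp (-gramLog (X y₀) γ)‖ *
        ‖NormedSpace.exp (gramLog (X y) γ) - NormedSpace.exp (gramLog (X y₀) γ)‖ :=
    (h2.norm.max continuous_const).mul (h1.sub continuous_const).norm
  have h4 := h3.tendsto y₀
  simp only [sub_self, norm_zero, mul_zero] at h4
  exact squeeze_zero (fun _ => norm_nonneg _) (fun y => norm_sub_le_norm_exp_sub
    (transpose_gramLog _ _) (transpose_gramLog _ _) (le_max_left _ _) (le_max_right _ _)) h4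

theorem gramLog_eq_zero {x : Γ →* Matrix (Fin n) (Fin n) ℝ} {γ : Γ} (h : (x γ)ᵀ * x γ = 1) :
    gramLog x γ = 0 :=
  exp_injOn_symmetric (transpose_gramLog x γ) transpose_zero
    (by rw [exp_gramLog, h, NormedSpace.exp_zero])

theorem gramLog_orthogonal_conj {u : Matrix (Fin n) (Fin n) ℝ} (hu : uᵀ * u = 1)
    {x y : Γ →* Matrix (Fin n) (Fin n) ℝ} (hxy : ∀ γ, y γ = u * x γ * uᵀ) (γ : Γ) :
    gramLog y γ = u * gramLog x γ * uᵀ := by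
  refine exp_injOn_symmetric (transpose_gramLog y γ) ?_ ?_
  · rw [transpose_mul_mul_transpose, transpose_gramLog]
  · rw [exp_orthogonal_conj hu, exp_gramLog, exp_gramLog, hxy, transpose_mul_mul_transpose,
      mul_mul_transpose_mul hu]

/-- The representation has central Gram matrices. -/
def HasCentralGram (x : Γ →* Matrix (Fin n) (Fin n) ℝ) : Prop :=
  ∀ γ δ, Commute ((x γ)ᵀ * x γ) (x δ)

theorem HasCentralGram.commute_gramLog {x : Γ →* Matrix (Fin n) (Fin n) ℝ}
    (hx : HasCentralGram x) (γ δ : Γ) : Commute (gramLog x γ) (x δ) :=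
  commute_of_commute_exp (transpose_gramLog x γ) (by rw [exp_gramLog]; exact hx γ δ)

theorem HasCentralGram.gramLog_mul {x : Γ →* Matrix (Fin n) (Fin n) ℝ}
    (hx : HasCentralGram x) (γ δ : Γ) : gramLog x (γ * δ) = gramLog x γ + gramLog x δ := by
  have htr : ∀ {A : Matrix (Fin n) (Fin n) ℝ} (δ : Γ), Aᵀ = A → Commute A (x δ) →
      Commute A (x δ)ᵀ := by
    intro A δ hA h
    have h1 := congrArg transpose h.eq
    rw [transpose_mul, transpose_mul, hA] at h1
    exact h1.symm
  have hcomm : Commute (gramLog x γ) (gramLog x δ) := by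
    refine (commute_of_commute_exp (transpose_gramLog x δ) ?_).symm
    rw [exp_gramLog]
    exact ((htr δ (transpose_gramLog x γ) (hx.commute_gramLog γ δ)).mul_right
      (hx.commute_gramLog γ δ)).symm
  refine exp_injOn_symmetric (transpose_gramLog x _) ?_ ?_
  · rw [transpose_add, transpose_gramLog, transpose_gramLog]
  · rw [Matrix.exp_add_of_commute _ _ hcomm, exp_gramLog, exp_gramLog, exp_gramLog, map_mul,
      transpose_mul]
    have h1 := (htr (A := (x γ)ᵀ * x γ) δ (by simp) (hx γ δ)).eq
    calc _ = (x δ)ᵀ * ((x γ)ᵀ * x γ) * x δ := by simp only [Matrix.mul_assoc]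
      _ = _ := by rw [← h1]; simp only [Matrix.mul_assoc]

/-- The path from a representation to its polar part. -/
noncomputable def polarPath (x : Γ →* Matrix (Fin n) (Fin n) ℝ) (r : ℝ) (γ : Γ) :
    Matrix (Fin n) (Fin n) ℝ :=
  x γ * NormedSpace.exp (-(r / 2) • gramLog x γ)

theorem polarPath_zero (x : Γ →* Matrix (Fin n) (Fin n) ℝ) : polarPath x 0 = x := by
  ext1 γ
  rw [polarPath, zero_div, neg_zero, zero_smul, NormedSpace.exp_zero, Matrix.mul_one]

theorem polarPath_one_apply (x : Γ →* Matrix (Fin n) (Fin n) ℝ) (r : ℝ) : polarPath x r 1 = 1 := by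
  rw [polarPath, gramLog_eq_zero (by simp), smul_zero, NormedSpace.exp_zero, map_one,
    Matrix.mul_one]

theorem HasCentralGram.polarPath_mul {x : Γ →* Matrix (Fin n) (Fin n) ℝ}
    (hx : HasCentralGram x) (r : ℝ) (γ δ : Γ) :
    polarPath x r (γ * δ) = polarPath x r γ * polarPath x r δ := by
  have htr : Commute (gramLog x γ) (gramLog x δ) := by
    have h1 := hx.gramLog_mul γ δ
    have h2 := congrArg NormedSpace.exp h1
    refine (commute_of_commute_exp (transpose_gramLog x δ) ?_).symm
    rw [exp_gramLog]
    have h3 := congrArg transpose (hx.commute_gramLog γ δ).eq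
    rw [transpose_mul, transpose_mul, transpose_gramLog] at h3
    exact (Commute.mul_right (show Commute (gramLog x γ) (x δ)ᵀ from h3.symm)
      (hx.commute_gramLog γ δ)).symm
  have h4 : Commute (NormedSpace.exp (-(r / 2) • gramLog x γ)) (x δ) :=
    ((hx.commute_gramLog γ δ).smul_left _).exp_left
  rw [polarPath, polarPath, polarPath, map_mul, hx.gramLog_mul, smul_add,
    Matrix.exp_add_of_commute _ _ ((htr.smul_left _).smul_right _)]
  calc _ = x γ * (x δ * NormedSpace.exp (-(r / 2) • gramLog x γ)) *
        NormedSpace.exp (-(r / 2) • gramLog x δ) := by simp only [Matrix.mul_assoc]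
    _ = _ := by rw [← h4.eq]; simp only [Matrix.mul_assoc]

theorem polarPath_orthogonal (x : Γ →* Matrix (Fin n) (Fin n) ℝ) (γ : Γ) :
    (polarPath x 1 γ)ᵀ * polarPath x 1 γ = 1 := by
  have h1 : (NormedSpace.exp (-(1 / 2 : ℝ) • gramLog x γ))ᵀ =
      NormedSpace.exp (-(1 / 2 : ℝ) • gramLog x γ) := by
    rw [← Matrix.exp_transpose, transpose_smul, transpose_gramLog]
  have h2 : ∀ a b : ℝ, NormedSpace.exp (a • gramLog x γ) * NormedSpace.exp (b • gramLog x γ) =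
      NormedSpace.exp ((a + b) • gramLog x γ) := fun a b => by
    rw [add_smul, Matrix.exp_add_of_commute]
    exact ((Commute.refl _).smul_left _).smul_right _
  have h3 : (x γ)ᵀ * x γ = NormedSpace.exp ((1 : ℝ) • gramLog x γ) := by
    rw [one_smul, exp_gramLog]
  rw [polarPath, transpose_mul, h1]
  calc _ = NormedSpace.exp (-(1 / 2 : ℝ) • gramLog x γ) * ((x γ)ᵀ * x γ) *
        NormedSpace.exp (-(1 / 2 : ℝ) • gramLog x γ) := by simp only [Matrix.mul_assoc]
    _ = 1 := by
      rw [h3, h2, h2]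
      norm_num

theorem polarPath_eq_self {x : Γ →* Matrix (Fin n) (Fin n) ℝ} (h : ∀ γ, (x γ)ᵀ * x γ = 1)
    (r : ℝ) : polarPath x r = x := by
  ext1 γ
  rw [polarPath, gramLog_eq_zero (h γ), smul_zero, NormedSpace.exp_zero, Matrix.mul_one]

theorem continuous_polarPath {Y : Type*} [TopologicalSpace Y]
    {X : Y → Γ →* Matrix (Fin n) (Fin n) ℝ} (hX : ∀ γ, Continuous fun y => X y γ) {r : Y → ℝ}
    (hr : Continuous r) (γ : Γ) : Continuous fun y => polarPath (X y) (r y) γ := by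
  have hexp : Continuous (NormedSpace.exp : Matrix (Fin n) (Fin n) ℝ → _) :=
    NormedSpace.exp_continuous
  exact (hX γ).mul (hexp.comp ((hr.div_const 2).neg.smul (continuous_gramLog hX γ)))

theorem polarPath_orthogonal_conj {u : Matrix (Fin n) (Fin n) ℝ} (hu : uᵀ * u = 1)
    {x y : Γ →* Matrix (Fin n) (Fin n) ℝ} (hxy : ∀ γ, y γ = u * x γ * uᵀ) (r : ℝ) (γ : Γ) :
    polarPath y r γ = u * polarPath x r γ * uᵀ := by
  rw [polarPath, polarPath, gramLog_orthogonal_conj hu hxy, ← Matrix.smul_mul, ← Matrix.mul_smul,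
    exp_orthogonal_conj hu, hxy, mul_mul_transpose_mul hu]

end Polar

section CentralGram

open Matrix
open scoped Matrix.Norms.Frobenius ComplexOrder

theorem Matrix.PosSemidef.exists_eq_smul_one_of_pow {ι : Type*} [Fintype ι] [DecidableEq ι]
    {A : Matrix ι ι ℂ} (hA : A.PosSemidef) {N : ℕ} (hN : 0 < N) {c : ℂ}
    (h : A ^ N = c • (1 : Matrix ι ι ℂ)) : ∃ c : ℂ, A = c • (1 : Matrix ι ι ℂ) := by
  obtain ⟨U, a, h1, h2, hU⟩ := hA.isHermitian.exists_diagonalization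
  have hD : Uᴴ * A * U = diagonal fun i => (a i : ℂ) := by
    rw [hU]
    calc Uᴴ * (U * diagonal (fun i => (a i : ℂ)) * Uᴴ) * U
        = (Uᴴ * U) * diagonal (fun i => (a i : ℂ)) * (Uᴴ * U) := by simp only [Matrix.mul_assoc]
      _ = _ := by rw [h1]; simp
  have hpow : ∀ k : ℕ, (Uᴴ * A * U) ^ k = Uᴴ * A ^ k * U := by
    intro k
    induction k with
    | zero => simp [h1]
    | succ k ih =>
      rw [pow_succ, ih, pow_succ]
      calc Uᴴ * A ^ k * U * (Uᴴ * A * U) = Uᴴ * A ^ k * (U * Uᴴ) * A * U := by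
            simp only [Matrix.mul_assoc]
        _ = _ := by rw [h2]; simp [Matrix.mul_assoc]
  have hnonneg : ∀ i, 0 ≤ a i := by
    have hpsd := hA.conjTranspose_mul_mul_same U
    rw [hD, posSemidef_diagonal_iff] at hpsd
    exact fun i => by exact_mod_cast hpsd i
  have heq : ∀ i, (a i : ℂ) ^ N = c := by
    intro i
    have h3 := hpow N
    rw [h, hD, diagonal_pow, Matrix.mul_smul, Matrix.smul_mul, Matrix.mul_one, h1] at h3
    simpa using congrFun (congrFun h3 i) i
  rcases isEmpty_or_nonempty ι with hι | ⟨⟨i⟩⟩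
  · exact ⟨0, Subsingleton.elim _ _⟩
  refine ⟨a i, ?_⟩
  have hconst : ∀ j, a j = a i := fun j =>
    (pow_left_inj₀ (hnonneg j) (hnonneg i) hN.ne').1 (by exact_mod_cast (heq j).trans (heq i).symm)
  rw [hU]
  simp only [hconst]
  rw [← smul_one_eq_diagonal, Matrix.mul_smul, Matrix.smul_mul, Matrix.mul_one, h2]
  rfl

/-- A normal block upper triangular matrix is block diagonal with normal blocks. -/
theorem isStarNormal_fromBlocks_zero {k l : ℕ} {a : Matrix (Fin k) (Fin k) ℂ}
    {b : Matrix (Fin k) (Fin l) ℂ} {e : Matrix (Fin l) (Fin l) ℂ}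
    (h : (fromBlocks a b 0 e)ᴴ * fromBlocks a b 0 e = fromBlocks a b 0 e * (fromBlocks a b 0 e)ᴴ) :
    b = 0 ∧ aᴴ * a = a * aᴴ ∧ eᴴ * e = e * eᴴ := by
  rw [fromBlocks_conjTranspose, fromBlocks_multiply, fromBlocks_multiply, fromBlocks_inj] at h
  obtain ⟨h1, -, -, h2⟩ := h
  simp only [conjTranspose_zero, Matrix.mul_zero, add_zero, zero_add] at h1 h2
  have hb : b = 0 := by
    have h3 := congrArg trace h1
    rw [trace_add, trace_mul_comm aᴴ a, left_eq_add, trace_mul_comm] at h3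
    have h4 := frobenius_norm_sq_eq_trace b
    rw [h3] at h4
    simpa using h4
  subst hb
  simp only [conjTranspose_zero, Matrix.zero_mul, add_zero, zero_add] at h1 h2
  exact ⟨rfl, h1, h2⟩

variable {Γ : Type*} [Group Γ]

theorem commute_gram_of_normal {Γ₀ : Subgroup Γ} {N : ℕ} (hN : 0 < N)
    (hpow : ∀ γ : Γ, γ ^ N ∈ Γ₀) {S : Finset Γ} (hgen : Submonoid.closure (S : Set Γ) = ⊤) {n : ℕ}
    (hsc : ∀ d ≤ n, ∀ x : Γ →* Matrix (Fin d) (Fin d) ℂ, IsIrrRep x →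
      ∀ γ ∈ Γ₀, ∃ c : ℂ, x γ = c • 1) (d : ℕ) (hd : d ≤ n)
    (z : Γ →* Matrix (Fin d) (Fin d) ℂ) (hz : ∀ s ∈ S, (z s)ᴴ * z s = z s * (z s)ᴴ) (γ δ : Γ) :
    Commute ((z γ)ᴴ * z γ) (z δ) := by
  induction d using Nat.strong_induction_on generalizing γ δ with
  | _ d ih =>
  by_cases hirr : IsIrrRep z
  · suffices hsmul : ∀ γ, ∃ c : ℂ, (z γ)ᴴ * z γ = c • (1 : Matrix (Fin d) (Fin d) ℂ) by
      obtain ⟨c, hc⟩ := hsmul γ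
      rw [hc]
      exact (Commute.one_left _).smul_left c
    intro γ
    have hγ : γ ∈ Submonoid.closure (S : Set Γ) := hgen ▸ Submonoid.mem_top γ
    induction hγ using Submonoid.closure_induction with
    | mem s hs =>
      obtain ⟨c, hc⟩ := hsc d hd z hirr _ (hpow s)
      refine (posSemidef_conjTranspose_mul_self (z s)).exists_eq_smul_one_of_pow hN
        (c := star c * c) ?_
      rw [Commute.mul_pow (hz s hs), ← conjTranspose_pow, ← map_pow, hc, conjTranspose_smul,
        conjTranspose_one, Matrix.smul_mul, Matrix.one_mul, smul_smul]
    | one => exact ⟨1, by simp⟩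
    | mul p q _ _ hp hq =>
      obtain ⟨c, hc⟩ := hp
      obtain ⟨c', hc'⟩ := hq
      refine ⟨c * c', ?_⟩
      rw [map_mul, conjTranspose_mul, Matrix.mul_assoc, ← Matrix.mul_assoc _ (z p), hc,
        Matrix.smul_mul, Matrix.one_mul, Matrix.mul_smul, hc', smul_smul]
  · obtain ⟨k, l, hk, hl, W, hW, hW', a, e, b, hx⟩ := exists_block_of_not_isIrrRep z hirr
    have hblock : ∀ γ, Wᴴ * z γ * W = fromBlocks (a γ) (b γ) 0 (e γ) := by
      intro γ
      rw [hx]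
      calc Wᴴ * (W * fromBlocks (a γ) (b γ) 0 (e γ) * Wᴴ) * W
          = (Wᴴ * W) * fromBlocks (a γ) (b γ) 0 (e γ) * (Wᴴ * W) := by
            simp only [Matrix.mul_assoc]
        _ = _ := by rw [hW]; simp
    have hconj : ∀ A B : Matrix (Fin d) (Fin d) ℂ,
        (Wᴴ * A * W) * (Wᴴ * B * W) = Wᴴ * (A * B) * W := by
      intro A B
      calc (Wᴴ * A * W) * (Wᴴ * B * W) = Wᴴ * A * (W * Wᴴ) * B * W := by
            simp only [Matrix.mul_assoc]
        _ = _ := by rw [hW']; simp [Matrix.mul_assoc]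
    have hnormal : ∀ s ∈ S, b s = 0 ∧ (a s)ᴴ * a s = a s * (a s)ᴴ ∧
        (e s)ᴴ * e s = e s * (e s)ᴴ := by
      intro s hs
      apply isStarNormal_fromBlocks_zero
      have hct : (Wᴴ * z s * W)ᴴ = Wᴴ * (z s)ᴴ * W := by
        simp [conjTranspose_mul, Matrix.mul_assoc]
      rw [← hblock, hct, hconj, hconj, hz s hs]
    have hb : ∀ γ, b γ = 0 := by
      intro γ
      have hγ : γ ∈ Submonoid.closure (S : Set Γ) := hgen ▸ Submonoid.mem_top γ
      induction hγ using Submonoid.closure_induction with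
      | mem s hs => exact (hnormal s hs).1
      | one =>
        have h1 := hblock 1
        rw [map_one, Matrix.mul_one, hW, ← fromBlocks_one, fromBlocks_inj] at h1
        exact h1.2.1.symm
      | mul p q _ _ hp hq =>
        have h1 := hblock (p * q)
        rw [map_mul, ← hconj, hblock, hblock, fromBlocks_multiply, fromBlocks_inj] at h1
        rw [← h1.2.1, hp, hq]
        simp
    have ha := ih k hk (hk.le.trans hd) a (fun s hs => (hnormal s hs).2.1) γ δ
    have he := ih l hl (hl.le.trans hd) e (fun s hs => (hnormal s hs).2.2) γ δ
    have hcomm : Commute ((fromBlocks (a γ) 0 0 (e γ))ᴴ * fromBlocks (a γ) 0 0 (e γ))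
        (fromBlocks (a δ) 0 0 (e δ)) := by
      rw [Commute, SemiconjBy, fromBlocks_conjTranspose]
      simp [fromBlocks_multiply, ha.eq, he.eq]
    rw [hx γ, hx δ, hb γ, hb δ]
    set P := fromBlocks (a γ) 0 0 (e γ)
    set Q := fromBlocks (a δ) 0 0 (e δ)
    calc (W * P * Wᴴ)ᴴ * (W * P * Wᴴ) * (W * Q * Wᴴ)
        = W * (Pᴴ * (Wᴴ * W) * P * (Wᴴ * W) * Q) * Wᴴ := by
          simp only [conjTranspose_mul, conjTranspose_conjTranspose, Matrix.mul_assoc]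
      _ = W * (Q * (Wᴴ * W) * Pᴴ * (Wᴴ * W) * P) * Wᴴ := by
          rw [hW, Matrix.mul_one, Matrix.mul_one, Matrix.mul_one, Matrix.mul_one, hcomm.eq,
            Matrix.mul_assoc Q]
      _ = (W * Q * Wᴴ) * ((W * P * Wᴴ)ᴴ * (W * P * Wᴴ)) := by
          simp only [conjTranspose_mul, conjTranspose_conjTranspose, Matrix.mul_assoc]

theorem hasCentralGram_of_normal {Γ₀ : Subgroup Γ} {N : ℕ} (hN : 0 < N)
    (hpow : ∀ γ : Γ, γ ^ N ∈ Γ₀) {S : Finset Γ} (hgen : Submonoid.closure (S : Set Γ) = ⊤) {n : ℕ}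
    (hsc : ∀ d ≤ n, ∀ x : Γ →* Matrix (Fin d) (Fin d) ℂ, IsIrrRep x →
      ∀ γ ∈ Γ₀, ∃ c : ℂ, x γ = c • 1)
    {x : Γ →* Matrix (Fin n) (Fin n) ℝ} (hx : ∀ s ∈ S, (x s)ᵀ * x s = x s * (x s)ᵀ) :
    HasCentralGram x := by
  intro γ δ
  let f : Matrix (Fin n) (Fin n) ℝ →+* Matrix (Fin n) (Fin n) ℂ := Complex.ofRealHom.mapMatrix
  have hf : Function.Injective f := Matrix.map_injective Complex.ofReal_injective
  have hct : ∀ A, (f A)ᴴ = f Aᵀ := by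
    intro A
    ext i j
    simp [f]
  have h := commute_gram_of_normal hN hpow hgen hsc n le_rfl (f.toMonoidHom.comp x)
    (fun s hs => by
      change (f (x s))ᴴ * f (x s) = f (x s) * (f (x s))ᴴ
      rw [hct, ← map_mul, ← map_mul, hx s hs]) γ δ
  change Commute ((f (x γ))ᴴ * f (x γ)) (f (x δ)) at h
  apply hf
  rw [map_mul f _ (x δ), map_mul f (x δ), map_mul f, ← hct]
  exact h.eq

end CentralGram
section Retraction

/-- A point of the representation space as a monoid homomorphism. -/
def RepGLR.toHom {Γ : Type} [Group Γ] {n : ℕ} (x : RepGLR Γ n) :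
    Γ →* Matrix (Fin n) (Fin n) ℝ where
  toFun := x.1
  map_one' := x.2.1
  map_mul' := x.2.2.1

/-- A finitely generated group has a finite symmetric generating set containing representatives
of all cosets of a given finite-index subgroup. -/
theorem exists_symmetric_generators_out {Γ : Type*} [Group Γ] [Group.FG Γ] (Γ₀ : Subgroup Γ)
    [Finite (Γ ⧸ Γ₀)] : ∃ S : Finset Γ, (∀ q : Γ ⧸ Γ₀, q.out ∈ S) ∧ (∀ s ∈ S, s⁻¹ ∈ S) ∧
      Submonoid.closure (S : Set Γ) = ⊤ := by
  classical
  obtain ⟨G, hG⟩ := Group.FG.out (G := Γ)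
  have hfin : (Set.range (Quotient.out : Γ ⧸ Γ₀ → Γ)).Finite := Set.finite_range _
  set T := G ∪ hfin.toFinset with hT
  refine ⟨T ∪ T.image (·⁻¹), fun q => ?_, fun s hs => ?_, ?_⟩
  · simp [hT]
  · rw [Finset.mem_union, Finset.mem_image] at hs ⊢
    rcases hs with hs | ⟨r, hr, rfl⟩
    · exact Or.inr ⟨s, hs, rfl⟩
    · exact Or.inl (by simpa using hr)
  · rw [Finset.coe_union, Finset.coe_image, Set.image_inv_eq_inv, ← Subgroup.closure_toSubmonoid,
      eq_top_iff]
    intro γ _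
    have h : γ ∈ Subgroup.closure (G : Set Γ) := hG ▸ Subgroup.mem_top γ
    exact Subgroup.closure_mono (by simp [hT]) h

end Retraction

/-- Theorem I of the paper in the real case, for `G = GL_n ℝ` and `K = O(n)`:
for a finitely generated nilpotent group `Γ`, there is an `O(n)`-equivariant strong
deformation retraction of `Hom(Γ, GL_n ℝ)` onto `Hom(Γ, O(n))`. -/
theorem theoremI_real_GL (Γ : Type) [Group Γ] [Group.FG Γ] [Group.IsNilpotent Γ]
    (n : ℕ) (hn : 1 ≤ n) :
    ∃ H : RepGLR Γ n × unitInterval → RepGLR Γ n,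
      Continuous H ∧
      (∀ x, H (x, 0) = x) ∧
      (∀ x γ, (H (x, 1)).1 γ ∈ Matrix.orthogonalGroup (Fin n) ℝ) ∧
      (∀ a : RepGLR Γ n, (∀ γ, a.1 γ ∈ Matrix.orthogonalGroup (Fin n) ℝ) →
        ∀ t, H (a, t) = a) ∧
      (∀ u : Matrix.orthogonalGroup (Fin n) ℝ, ∀ ρ σ : RepGLR Γ n,
        (∀ γ, σ.1 γ =
            (u : Matrix (Fin n) (Fin n) ℝ) * ρ.1 γ * (u : Matrix (Fin n) (Fin n) ℝ)ᵀ) →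
        ∀ t γ, (H (σ, t)).1 γ =
            (u : Matrix (Fin n) (Fin n) ℝ) * (H (ρ, t)).1 γ *
              (u : Matrix (Fin n) (Fin n) ℝ)ᵀ) := by
  obtain ⟨Γ₀, hnormal, hfin, ⟨N, hN, hpow⟩, hsc⟩ := exists_finiteIndex_scalar Γ n
  obtain ⟨S, hout, hinv, hgen⟩ := exists_symmetric_generators_out Γ₀
  have := Fintype.ofFinite (Γ ⧸ Γ₀)
  have hS : HasGradientBound S n := exists_gradient_bound hout hinv hsc
  obtain ⟨L, hLcont, hL0, hL1, hLfix, hLconj⟩ := hS.exists_flow hgen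
  have hcent : ∀ x, HasCentralGram (L x 1) := fun x =>
    hasCentralGram_of_normal hN hpow hgen hsc (hL1 x)
  have horth : ∀ A : Matrix (Fin n) (Fin n) ℝ, A ∈ Matrix.orthogonalGroup (Fin n) ℝ ↔ Aᵀ * A = 1 :=
    fun A => Matrix.mem_orthogonalGroup_iff' _ _
  let F : RepGLR Γ n × unitInterval → Γ → Matrix (Fin n) (Fin n) ℝ := fun p =>
    polarPath (L p.1.toHom (min 1 (2 * p.2))) (max 0 (2 * p.2 - 1))
  have hmul : ∀ p γ δ, F p (γ * δ) = F p γ * F p δ := by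
    intro p γ δ
    rcases le_total (2 * (p.2 : ℝ)) 1 with h | h
    · simp only [F, max_eq_left (sub_nonpos.2 h), polarPath_zero, map_mul]
    · simp only [F, min_eq_left h]
      exact (hcent _).polarPath_mul _ γ δ
  have hone : ∀ p, F p 1 = 1 := fun p => polarPath_one_apply _ _
  have hunit : ∀ p γ, IsUnit (F p γ) := fun p γ =>
    .of_mul_eq_one (F p γ⁻¹) (by rw [← hmul, mul_inv_cancel, hone])
  refine ⟨fun p => ⟨F p, hone p, hmul p, hunit p⟩, ?_, fun x => ?_, fun x γ => ?_,
    fun a ha t => ?_, fun u ρ σ h t γ => ?_⟩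
  · refine Continuous.subtype_mk (continuous_pi fun γ => ?_) _
    have ht : Continuous fun p : RepGLR Γ n × unitInterval => (p.2 : ℝ) :=
      continuous_subtype_val.comp continuous_snd
    refine continuous_polarPath (fun δ => hLcont _ (fun p => p.1.toHom) (fun δ => ?_) _
      (continuous_const.min (continuous_const.mul ht)) δ)
      (continuous_const.max ((continuous_const.mul ht).sub continuous_const)) γ
    exact (continuous_apply δ).comp (continuous_subtype_val.comp continuous_fst)
  · refine Subtype.ext ?_
    simp only [F, Set.Icc.coe_zero, mul_zero, zero_sub]
    rw [min_eq_right zero_le_one, max_eq_left (by norm_num), hL0, polarPath_zero]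
    rfl
  · rw [horth]
    simp only [F, Set.Icc.coe_one]
    rw [show max (0 : ℝ) (2 * 1 - 1) = 1 by norm_num]
    exact polarPath_orthogonal _ γ
  · refine Subtype.ext ?_
    have ha' : ∀ γ, (a.toHom γ)ᵀ * a.toHom γ = 1 := fun γ => (horth _).1 (ha γ)
    simp only [F]
    rw [hLfix _ ha', polarPath_eq_self ha']
    rfl
  · have hu := (horth _).1 u.2
    exact polarPath_orthogonal_conj hu (hLconj _ hu _ _ h _) _ γ
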